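/- A recurrent infinite binary word w is Sturmian (i.e., aperiodic with factor complexity p(n) = n+1 for all n) if and only if every factor of w has exactly two or three abelian returns in w. -/

import Mathlib

/-- The factor of length `n` of the infinite word `w` starting at position `i`. -/
def wordAt {α : Type*} (w : ℕ → α) (i n : ℕ) : List α :=
  (List.range n).map (fun k => w (i + k))

/-- `u` is a factor of the infinite word `w`. -/
def IsFactorW {α : Type*} (w : ℕ → α) (u : List α) : Prop :=
  ∃ i, u = wordAt w i u.length

/-- `w` is recurrent: every factor occurs infinitely often. -/
def RecurrentW {α : Type*} (w : ℕ → α) : Prop :=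
  ∀ u, IsFactorW w u → ∀ N, ∃ i, N ≤ i ∧ u = wordAt w i u.length

/-- `w` is (purely) periodic. -/
def PeriodicW {α : Type*} (w : ℕ → α) : Prop :=
  ∃ T, 0 < T ∧ ∀ n, w (n + T) = w n

/-- `w` is ultimately periodic. -/
def UltPeriodicW {α : Type*} (w : ℕ → α) : Prop :=
  ∃ T, 0 < T ∧ ∃ n₀, ∀ n, n₀ ≤ n → w (n + T) = w n

/-- Two finite words are abelian equivalent: same number of occurrences of each letter. -/
def AbEquiv {α : Type*} [DecidableEq α] (u v : List α) : Prop :=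
  ∀ a : α, u.count a = v.count a

/-- Positions of occurrences of words abelian equivalent to `u` in `w`. -/
def abOcc {α : Type*} [DecidableEq α] (w : ℕ → α) (u : List α) : Set ℕ :=
  {i | AbEquiv (wordAt w i u.length) u}

/-- The semi-abelian returns to (the abelian class of) `u` in `w`: words extending from one
occurrence of the abelian class of `u` to the next one. -/
def semiAbReturns {α : Type*} [DecidableEq α] (w : ℕ → α) (u : List α) : Set (List α) :=
  {r | ∃ i j, i ∈ abOcc w u ∧ j ∈ abOcc w u ∧ i < j ∧
      (∀ k, i < k → k < j → k ∉ abOcc w u) ∧ r = wordAt w i (j - i)}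

/-- Positions of (exact) occurrences of `u` in `w`. -/
def occW {α : Type*} [DecidableEq α] (w : ℕ → α) (u : List α) : Set ℕ :=
  {i | u = wordAt w i u.length}

/-- The ordinary return words of `u` in `w`. -/
def returnWords {α : Type*} [DecidableEq α] (w : ℕ → α) (u : List α) : Set (List α) :=
  {r | ∃ i j, i ∈ occW w u ∧ j ∈ occW w u ∧ i < j ∧
      (∀ k, i < k → k < j → k ∉ occW w u) ∧ r = wordAt w i (j - i)}

/-- `u` has exactly `k` semi-abelian returns in `w`. -/
def ExactlyKSemiAbReturns {α : Type*} [DecidableEq α] (w : ℕ → α) (u : List α) (k : ℕ) : Prop :=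
  ∃ f : Fin k → List α, Function.Injective f ∧ semiAbReturns w u = Set.range f

/-- `u` has exactly `k` abelian returns in `w`: there are `k` pairwise non-abelian-equivalent
representatives so that every semi-abelian return is abelian equivalent to exactly one of them,
and each representative is realized. -/
def ExactlyKAbReturns {α : Type*} [DecidableEq α] (w : ℕ → α) (u : List α) (k : ℕ) : Prop :=
  ∃ f : Fin k → List α,
    (∀ i j, AbEquiv (f i) (f j) → i = j) ∧
    (∀ r ∈ semiAbReturns w u, ∃ i, AbEquiv r (f i)) ∧
    (∀ i, ∃ r ∈ semiAbReturns w u, AbEquiv r (f i))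

/-- `u` has at most `k` abelian returns in `w`. -/
def AtMostKAbReturns {α : Type*} [DecidableEq α] (w : ℕ → α) (u : List α) (k : ℕ) : Prop :=
  ∃ f : Fin k → List α, ∀ r ∈ semiAbReturns w u, ∃ i, AbEquiv r (f i)

/-- `u` has at least `k` abelian returns in `w`. -/
def AtLeastKAbReturns {α : Type*} [DecidableEq α] (w : ℕ → α) (u : List α) (k : ℕ) : Prop :=
  ∃ f : Fin k → List α,
    (∀ i j, AbEquiv (f i) (f j) → i = j) ∧
    (∀ i, ∃ r ∈ semiAbReturns w u, AbEquiv r (f i))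

/-- `u` has at least two semi-abelian returns in `w`. -/
def AtLeastTwoSemiAbReturns {α : Type*} [DecidableEq α] (w : ℕ → α) (u : List α) : Prop :=
  ∃ r₁ r₂, r₁ ∈ semiAbReturns w u ∧ r₂ ∈ semiAbReturns w u ∧ r₁ ≠ r₂

/-- The factor complexity of `w`. -/
noncomputable def complexityW {α : Type*} (w : ℕ → α) (n : ℕ) : ℕ :=
  {u : List α | u.length = n ∧ IsFactorW w u}.ncard

/-- A Sturmian word: aperiodic binary word with factor complexity `n + 1`. -/
def SturmianW (w : ℕ → Bool) : Prop :=
  ¬ UltPeriodicW w ∧ ∀ n, complexityW w n = n + 1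

/-- Right special factor of a binary word. -/
def RightSpecial (w : ℕ → Bool) (B : List Bool) : Prop :=
  IsFactorW w (B ++ [false]) ∧ IsFactorW w (B ++ [true])

/-- Left special factor of a binary word. -/
def LeftSpecial (w : ℕ → Bool) (B : List Bool) : Prop :=
  IsFactorW w (false :: B) ∧ IsFactorW w (true :: B)

/-- Bispecial factor of a binary word. -/
def Bispecial (w : ℕ → Bool) (B : List Bool) : Prop :=
  RightSpecial w B ∧ LeftSpecial w B

/-- `w` is `c`-balanced. -/
def CBalanced {α : Type*} [DecidableEq α] (w : ℕ → α) (c : ℕ) : Prop :=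
  ∀ u v : List α, IsFactorW w u → IsFactorW w v → u.length = v.length →
    ∀ a : α, |((u.count a : ℤ) - (v.count a : ℤ))| ≤ (c : ℤ)

/-- `i < j` are consecutive starting positions of windows of length `L` and weight `m`,
where `S` is the prefix-sum function of a bi-infinite binary word. -/
def AbRet (S : ℤ → ℤ) (L m i j : ℤ) : Prop :=
  i < j ∧ S (i + L) - S i = m ∧ S (j + L) - S j = m ∧
    ∀ k, i < k → k < j → S (k + L) - S k ≠ m

/-- `(l, s)` is the pair (length, weight) of an abelian return to the class `(L, m)`. -/
def RetPair (S : ℤ → ℤ) (L m l s : ℤ) : Prop :=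
  ∃ i j, AbRet S L m i j ∧ j - i = l ∧ S j - S i = s

/-- Prefix sums of bi-infinite recurrent binary words all of whose factors have two or three
abelian returns. -/
structure Good (S : ℤ → ℤ) : Prop where
  step : ∀ i, S (i + 1) = S i ∨ S (i + 1) = S i + 1
  rec_right : ∀ i n N, ∃ j, N ≤ j ∧ ∀ t, 0 ≤ t → t ≤ n → S (j + t) - S j = S (i + t) - S i
  rec_left : ∀ i n N, ∃ j, j ≤ N ∧ ∀ t, 0 ≤ t → t ≤ n → S (j + t) - S j = S (i + t) - S i
  four : ∀ L m l₁ s₁ l₂ s₂ l₃ s₃ l₄ s₄, 1 ≤ L → RetPair S L m l₁ s₁ → RetPair S L m l₂ s₂ →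
    RetPair S L m l₃ s₃ → RetPair S L m l₄ s₄ → (l₁ ≠ l₂ ∨ s₁ ≠ s₂) → (l₁ ≠ l₃ ∨ s₁ ≠ s₃) →
    (l₁ ≠ l₄ ∨ s₁ ≠ s₄) → (l₂ ≠ l₃ ∨ s₂ ≠ s₃) → (l₂ ≠ l₄ ∨ s₂ ≠ s₄) → (l₃ ≠ l₄ ∨ s₃ ≠ s₄) →
    False
  one : ∀ L m i l s, 1 ≤ L → S (i + L) - S i = m →
    (∀ l' s', RetPair S L m l' s' → l' = l ∧ s' = s) → False

/-- The prefix-sum function of the complementary word. -/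
def cpl (S : ℤ → ℤ) : ℤ → ℤ := fun i => i - S i

theorem AbRet.toCpl {S : ℤ → ℤ} {L m i j : ℤ} (h : AbRet S L m i j) :
    AbRet (cpl S) L (L - m) i j := by
  obtain ⟨h1, h2, h3, h4⟩ := h
  refine ⟨h1, ?_, ?_, fun k hk hk' => ?_⟩
  · simp only [cpl]; omega
  · simp only [cpl]; omega
  · have := h4 k hk hk'
    simp only [cpl]; omega

theorem cpl_cpl (S : ℤ → ℤ) : cpl (cpl S) = S := by
  funext i; simp [cpl]

theorem RetPair.toCpl {S : ℤ → ℤ} {L m l s : ℤ} (h : RetPair S L m l s) :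
    RetPair (cpl S) L (L - m) l (l - s) := by
  obtain ⟨i, j, h1, h2, h3⟩ := h
  refine ⟨i, j, h1.toCpl, h2, ?_⟩
  simp only [cpl]; omega

theorem RetPair.of_cpl {S : ℤ → ℤ} {L m l s : ℤ} (h : RetPair (cpl S) L m l s) :
    RetPair S L (L - m) l (l - s) := by
  have := h.toCpl
  rwa [cpl_cpl] at this

theorem Good.toCpl {S : ℤ → ℤ} (h : Good S) : Good (cpl S) where
  step i := by
    have := h.step i
    simp only [cpl]; omega
  rec_right i n N := by
    obtain ⟨j, h1, h2⟩ := h.rec_right i n N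
    refine ⟨j, h1, fun t ht ht' => ?_⟩
    have := h2 t ht ht'
    simp only [cpl]; omega
  rec_left i n N := by
    obtain ⟨j, h1, h2⟩ := h.rec_left i n N
    refine ⟨j, h1, fun t ht ht' => ?_⟩
    have := h2 t ht ht'
    simp only [cpl]; omega
  four L m l₁ s₁ l₂ s₂ l₃ s₃ l₄ s₄ hL h1 h2 h3 h4 := by
    intros
    exact h.four L (L - m) l₁ (l₁ - s₁) l₂ (l₂ - s₂) l₃ (l₃ - s₃) l₄ (l₄ - s₄) hL h1.of_cpl
      h2.of_cpl h3.of_cpl h4.of_cpl (by omega) (by omega) (by omega) (by omega) (by omega)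
      (by omega)
  one L m i l s hL hi hs := by
    refine h.one L (L - m) i l (l - s) hL ?_ fun l' s' h' => ?_
    · simp only [cpl] at hi; omega
    · have := hs _ _ (by simpa using h'.toCpl)
      omega

section basic

variable {S : ℤ → ℤ}

theorem Good.nxt (h : Good S) {L m i : ℤ} (hL : 0 ≤ L) (hi : S (i + L) - S i = m) :
    ∃ j, AbRet S L m i j := by
  classical
  obtain ⟨j, hj, hj'⟩ := h.rec_right i L (i + 1)
  have hjm : S (j + L) - S j = m := by rw [hj' L hL le_rfl]; exact hi
  have hex : ∃ d : ℕ, 0 < d ∧ S (i + d + L) - S (i + d) = m := by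
    refine ⟨(j - i).toNat, by omega, ?_⟩
    rw [Int.toNat_of_nonneg (by omega)]
    simpa using hjm
  refine ⟨i + Nat.find hex, by have := (Nat.find_spec hex).1; omega, hi, (Nat.find_spec hex).2, ?_⟩
  intro k hk hk' hkm
  refine Nat.find_min hex (m := (k - i).toNat) (by omega) ⟨by omega, ?_⟩
  rw [Int.toNat_of_nonneg (by omega)]
  simpa using hkm

theorem Good.two (h : Good S) {L m i : ℤ} (hL : 1 ≤ L) (hi : S (i + L) - S i = m) :
    ∃ l₁ s₁ l₂ s₂, RetPair S L m l₁ s₁ ∧ RetPair S L m l₂ s₂ ∧ (l₁ ≠ l₂ ∨ s₁ ≠ s₂) := by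
  obtain ⟨j, hj⟩ := h.nxt (by omega) hi
  by_contra hcon
  push Not at hcon
  refine h.one L m i (j - i) (S j - S i) hL hi fun l' s' h' => ?_
  exact hcon _ _ _ _ h' ⟨i, j, hj, rfl, rfl⟩

end basic

/-- A maximal run of `d` zeros starts at position `Q`. -/
def Run0 (S : ℤ → ℤ) (Q d : ℤ) : Prop :=
  1 ≤ d ∧ S (Q - 1) = S Q - 1 ∧ (∀ x, Q ≤ x → x ≤ Q + d → S x = S Q) ∧ S (Q + d + 1) = S Q + 1

/-- A maximal run of `d` ones starts at position `P`. -/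
def Run1 (S : ℤ → ℤ) (P d : ℤ) : Prop :=
  1 ≤ d ∧ S (P - 1) = S P ∧ (∀ x, P ≤ x → x ≤ P + d → S x = S P + (x - P)) ∧
    S (P + d + 1) = S P + d

theorem run0_cpl {S : ℤ → ℤ} {Q d : ℤ} : Run0 (cpl S) Q d ↔ Run1 S Q d := by
  simp only [Run0, Run1, cpl]
  constructor <;>
  · rintro ⟨h1, h2, h3, h4⟩
    refine ⟨h1, by omega, fun x hx hx' => ?_, by omega⟩
    have := h3 x hx hx'
    omega

theorem run1_cpl {S : ℤ → ℤ} {Q d : ℤ} : Run1 (cpl S) Q d ↔ Run0 S Q d := by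
  rw [← run0_cpl, cpl_cpl]

/-- A set of integers bounded below has a least element. -/
theorem int_least {p : ℤ → Prop} {b i : ℤ} (hb : b ≤ i) (hi : p i) :
    ∃ j, b ≤ j ∧ j ≤ i ∧ p j ∧ ∀ k, b ≤ k → k < j → ¬ p k := by
  classical
  have hex : ∃ d : ℕ, p (b + d) := ⟨(i - b).toNat, by
    rw [Int.toNat_of_nonneg (by omega)]; simpa using hi⟩
  refine ⟨b + Nat.find hex, by omega, ?_, Nat.find_spec hex, fun k hk hk' hpk => ?_⟩
  · have : Nat.find hex ≤ (i - b).toNat := Nat.find_min' hex (by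
      rw [Int.toNat_of_nonneg (by omega)]; simpa using hi)
    omega
  · refine Nat.find_min hex (m := (k - b).toNat) (by omega) ?_
    rw [Int.toNat_of_nonneg (by omega)]
    simpa using hpk

theorem int_greatest {p : ℤ → Prop} {b i : ℤ} (hb : i ≤ b) (hi : p i) :
    ∃ j, j ≤ b ∧ i ≤ j ∧ p j ∧ ∀ k, k ≤ b → j < k → ¬ p k := by
  obtain ⟨j, h1, h2, h3, h4⟩ := int_least (p := fun x => p (-x)) (b := -b) (i := -i) (by omega)
    (by simpa using hi)
  exact ⟨-j, by omega, by omega, h3, fun k hk hk' hpk => h4 (-k) (by omega) (by omega)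
    (by simpa using hpk)⟩

theorem const_of_steps {S : ℤ → ℤ} {a b : ℤ} (h : ∀ x, a ≤ x → x < b → S (x + 1) = S x) :
    ∀ x, a ≤ x → x ≤ b → S x = S a := by
  intro x hx
  induction x, hx using Int.leInduction with
  | base => simp
  | succ n hn ih => intro hb; rw [h n hn (by omega), ih (by omega)]

section basic

variable {S : ℤ → ℤ}

theorem Good.mono (h : Good S) {x y : ℤ} (hxy : x ≤ y) : S x ≤ S y ∧ S y ≤ S x + (y - x) := by
  induction y, hxy using Int.leInduction with
  | base => simp
  | succ n hn ih => have := h.step n; omega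

theorem Good.exists_zero (h : Good S) : ∃ i, S (i + 1) = S i := by
  by_contra hcon
  push Not at hcon
  have hst : ∀ i, S (i + 1) = S i + 1 := fun i => (h.step i).resolve_left (hcon i)
  refine h.one 1 1 0 1 1 le_rfl (by have := hst 0; simp at this ⊢; omega) fun l s hs => ?_
  obtain ⟨i, j, ⟨h1, h2, h3, h4⟩, h5, h6⟩ := hs
  have hj : j = i + 1 := by
    by_contra hne
    have := h4 (i + 1) (by omega) (by omega)
    have := hst (i + 1)
    omega
  subst hj
  have := hst i
  omega

theorem Good.zero_right (h : Good S) (N : ℤ) : ∃ i, N ≤ i ∧ S (i + 1) = S i := by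
  obtain ⟨i, hi⟩ := h.exists_zero
  obtain ⟨j, hj, hj'⟩ := h.rec_right i 1 N
  exact ⟨j, hj, by have := hj' 1 (by omega) le_rfl; omega⟩

theorem Good.zero_left (h : Good S) (N : ℤ) : ∃ i, i ≤ N ∧ S (i + 1) = S i := by
  obtain ⟨i, hi⟩ := h.exists_zero
  obtain ⟨j, hj, hj'⟩ := h.rec_left i 1 N
  exact ⟨j, hj, by have := hj' 1 (by omega) le_rfl; omega⟩

theorem Good.one_right (h : Good S) (N : ℤ) : ∃ i, N ≤ i ∧ S (i + 1) = S i + 1 := by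
  obtain ⟨i, h1, h2⟩ := h.toCpl.zero_right N
  exact ⟨i, h1, by simp only [cpl] at h2; omega⟩

theorem Good.one_left (h : Good S) (N : ℤ) : ∃ i, i ≤ N ∧ S (i + 1) = S i + 1 := by
  obtain ⟨i, h1, h2⟩ := h.toCpl.zero_left N
  exact ⟨i, h1, by simp only [cpl] at h2; omega⟩

theorem Good.cover0 (h : Good S) {c : ℤ} (hc : S (c + 1) = S c) :
    ∃ Q d, Run0 S Q d ∧ Q ≤ c ∧ c < Q + d := by
  obtain ⟨e, he, hee⟩ := h.one_right c
  obtain ⟨e, h1, -, h2, h3⟩ := int_least (p := fun x => S (x + 1) = S x + 1) he hee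
  obtain ⟨q, hq, hqq⟩ := h.one_left c
  obtain ⟨q, h4, -, h5, h6⟩ := int_greatest (p := fun x => S (x + 1) = S x + 1) hq hqq
  have hst : ∀ x, q + 1 ≤ x → x < e → S (x + 1) = S x := by
    intro x hx hx'
    refine (h.step x).resolve_right fun hx1 => ?_
    by_cases hxc : x ≤ c
    · exact h6 x hxc (by omega) hx1
    · exact h3 x (by omega) hx' hx1
  have hqc : q ≠ c := by rintro rfl; omega
  have hec : e ≠ c := by rintro rfl; omega
  have hcst := const_of_steps hst
  refine ⟨q + 1, e - (q + 1), ⟨by omega, ?_, ?_, ?_⟩, by omega, by omega⟩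
  · simp only [add_sub_cancel_right]; omega
  · intro x hx hx'; exact hcst x hx (by omega)
  · have e1 : q + 1 + (e - (q + 1)) + 1 = e + 1 := by ring
    rw [e1, h2, hcst e (by omega) le_rfl]

theorem Good.cover1 (h : Good S) {c : ℤ} (hc : S (c + 1) = S c + 1) :
    ∃ Q d, Run1 S Q d ∧ Q ≤ c ∧ c < Q + d := by
  obtain ⟨Q, d, h1, h2⟩ := h.toCpl.cover0 (c := c) (by simp only [cpl]; omega)
  exact ⟨Q, d, run0_cpl.1 h1, h2⟩

theorem Good.next1 (h : Good S) {Q d : ℤ} (hQ : Run0 S Q d) : ∃ d', Run1 S (Q + d) d' := by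
  obtain ⟨h1, h2, h3, h4⟩ := hQ
  have e1 := h3 (Q + d) (by omega) le_rfl
  obtain ⟨P, d', hP, h5, h6⟩ := h.cover1 (c := Q + d) (by omega)
  suffices P = Q + d from ⟨d', this ▸ hP⟩
  obtain ⟨g1, g2, g3, g4⟩ := hP
  by_contra hne
  have a1 := g3 (Q + d - 1) (by omega) (by omega)
  have a2 := g3 (Q + d) (by omega) (by omega)
  have a3 := h3 (Q + d - 1) (by omega) (by omega)
  omega

theorem Good.next0 (h : Good S) {Q d : ℤ} (hQ : Run1 S Q d) : ∃ d', Run0 S (Q + d) d' := by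
  obtain ⟨d', hd⟩ := h.toCpl.next1 (run0_cpl.2 hQ)
  exact ⟨d', run1_cpl.1 hd⟩

theorem Good.prev1 (h : Good S) {Q d : ℤ} (hQ : Run0 S Q d) : ∃ d', Run1 S (Q - d') d' := by
  obtain ⟨h1, h2, h3, h4⟩ := hQ
  obtain ⟨P, d', hP, h5, h6⟩ := h.cover1 (c := Q - 1) (by
    have e : Q - 1 + 1 = Q := by ring
    rw [e]; omega)
  suffices P = Q - d' from ⟨d', this ▸ hP⟩
  obtain ⟨g1, g2, g3, g4⟩ := hP
  by_contra hne
  have a1 := g3 (Q + 1) (by omega) (by omega)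
  have a2 := g3 Q (by omega) (by omega)
  have a3 := h3 (Q + 1) (by omega) (by omega)
  omega

theorem Good.prev0 (h : Good S) {Q d : ℤ} (hQ : Run1 S Q d) : ∃ d', Run0 S (Q - d') d' := by
  obtain ⟨d', hd⟩ := h.toCpl.prev1 (run0_cpl.2 hQ)
  exact ⟨d', run1_cpl.1 hd⟩

end basic

/-- `i < j` are consecutive elements of the set `A`. -/
def Consec (A : ℤ → Prop) (i j : ℤ) : Prop :=
  i < j ∧ A i ∧ A j ∧ ∀ k, i < k → k < j → ¬ A k

theorem Good.two_consec {S : ℤ → ℤ} (h : Good S) {A : ℤ → Prop} {o LA mA i₀ : ℤ} (hLA : 1 ≤ LA)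
    (hA : ∀ i, S (i + o + LA) - S (i + o) = mA ↔ A i) (hi₀ : A i₀)
    (ho : ∃ κ, ∀ i, A i → S (i + o) - S i = κ) :
    ∃ i j i' j', Consec A i j ∧ Consec A i' j' ∧ (j - i ≠ j' - i' ∨ S j - S i ≠ S j' - S i') := by
  obtain ⟨κ, hκ⟩ := ho
  obtain ⟨l₁, s₁, l₂, s₂, ⟨i, j, ⟨h1, h2, h3, h4⟩, h5, h6⟩,
    ⟨i', j', ⟨g1, g2, g3, g4⟩, g5, g6⟩, hd⟩ :=
    h.two hLA ((hA i₀).2 hi₀)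
  have hA' : ∀ i, S (i + LA) - S i = mA ↔ A (i - o) := fun i => by rw [← hA]; simp
  rw [hA'] at h2 h3 g2 g3
  have k1 := hκ _ h2
  have k2 := hκ _ h3
  have k3 := hκ _ g2
  have k4 := hκ _ g3
  simp only [sub_add_cancel] at k1 k2 k3 k4
  refine ⟨i - o, j - o, i' - o, j' - o, ⟨by omega, h2, h3, fun k hk hk' hAk => ?_⟩,
    ⟨by omega, g2, g3, fun k hk hk' hAk => ?_⟩, ?_⟩
  · exact h4 (k + o) (by omega) (by omega) ((hA k).2 hAk)
  · exact g4 (k + o) (by omega) (by omega) ((hA k).2 hAk)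
  · omega

theorem Good.not_two_clusters {S : ℤ → ℤ} (h : Good S) {A : ℤ → Prop}
    {i₀ o LA mA L m p q k e f κ₁ κ₂ : ℤ}
    (hLA : 1 ≤ LA) (hA : ∀ i, S (i + o + LA) - S (i + o) = mA ↔ A i) (hi₀ : A i₀)
    (ho : ∃ κ, ∀ i, A i → S (i + o) - S i = κ)
    (hL : 1 ≤ L) (hk : 1 ≤ k) (hpq : p + k < q)
    (hcl : ∀ c, S (c + L) - S c = m ↔
      ∃ i, A i ∧ ((i + p ≤ c ∧ c ≤ i + p + k) ∨ (i + q ≤ c ∧ c ≤ i + q + k)))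
    (hsep : ∀ i j, A i → A j → i < j → i + q + k < j + p)
    (he : ∀ i, A i → S (i + p + 1) - S (i + p) = e)
    (hf : ∀ i, A i → S (i + q) - S (i + p + k) = f)
    (hκ₁ : ∀ i, A i → S (i + q + k) - S i = κ₁)
    (hκ₂ : ∀ i, A i → S (i + p) - S i = κ₂)
    (hne : 1 ≠ q - p - k ∨ e ≠ f)
    (hdist : ∀ i j, Consec A i j →
      (1 ≠ j + p - (i + q + k) ∨ e ≠ S (j + p) - S (i + q + k)) ∧
      (q - p - k ≠ j + p - (i + q + k) ∨ f ≠ S (j + p) - S (i + q + k))) : False := by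
  obtain ⟨i, j, i', j', hij, hij', hd⟩ := h.two_consec hLA hA hi₀ ho
  have key : ∀ i j, Consec A i j →
      RetPair S L m (j + p - (i + q + k)) (S (j + p) - S (i + q + k)) := by
    intro i j ⟨h1, h2, h3, h4⟩
    have := hsep i j h2 h3 h1
    refine ⟨i + q + k, j + p, ⟨this, ?_, ?_, fun x hx hx' => ?_⟩, rfl, rfl⟩
    · exact (hcl _).2 ⟨i, h2, by omega⟩
    · exact (hcl _).2 ⟨j, h3, by omega⟩
    · rw [Ne, hcl]
      rintro ⟨y, hy, hyx⟩
      rcases lt_trichotomy y i with hyi | rfl | hyi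
      · have := hsep _ _ hy h2 hyi
        omega
      · omega
      rcases lt_trichotomy y j with hyj | rfl | hyj
      · exact h4 y hyi hyj hy
      · omega
      · have := hsep _ _ h3 hy hyj
        omega
  have r1 : RetPair S L m 1 e := by
    refine ⟨i₀ + p, i₀ + p + 1, ⟨by omega, ?_, ?_, fun x hx hx' => by omega⟩, by omega, he _ hi₀⟩
    · exact (hcl _).2 ⟨i₀, hi₀, by omega⟩
    · exact (hcl _).2 ⟨i₀, hi₀, by omega⟩
  have r2 : RetPair S L m (q - p - k) f := by
    refine ⟨i₀ + p + k, i₀ + q, ⟨by omega, ?_, ?_, fun x hx hx' => ?_⟩, by omega, hf _ hi₀⟩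
    · exact (hcl _).2 ⟨i₀, hi₀, by omega⟩
    · exact (hcl _).2 ⟨i₀, hi₀, by omega⟩
    · rw [Ne, hcl]
      rintro ⟨y, hy, hyx⟩
      rcases lt_trichotomy y i₀ with hyi | rfl | hyi
      · have := hsep _ _ hy hi₀ hyi
        omega
      · omega
      · have := hsep _ _ hi₀ hy hyi
        omega
  have d1 := hdist _ _ hij
  have d2 := hdist _ _ hij'
  have k1 := hκ₁ _ hij.2.1
  have k2 := hκ₂ _ hij.2.2.1
  have k3 := hκ₁ _ hij'.2.1
  have k4 := hκ₂ _ hij'.2.2.1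
  exact h.four L m _ _ _ _ _ _ _ _ hL r1 r2 (key _ _ hij) (key _ _ hij') hne d1.1 d2.1 d1.2 d2.2
    (by omega)

/-- All zero runs have length `r`; the one runs have lengths `a < b`. -/
structure TwoBlocks (S : ℤ → ℤ) (r a b : ℤ) : Prop where
  good : Good S
  hr : 1 ≤ r
  ha : 1 ≤ a
  hab : a < b
  zero : ∀ Q d, Run0 S Q d → d = r
  ones : ∀ P d, Run1 S P d → d = a ∨ d = b
  exa : ∃ P, Run1 S P a
  exb : ∃ P, Run1 S P b

namespace TwoBlocks

variable {S : ℤ → ℤ} {r a b : ℤ}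

theorem next0 (h : TwoBlocks S r a b) {P d : ℤ} (hP : Run1 S P d) : Run0 S (P + d) r := by
  obtain ⟨d', hd⟩ := h.good.next0 hP
  have := h.zero _ _ hd
  rwa [this] at hd

theorem prev0 (h : TwoBlocks S r a b) {P d : ℤ} (hP : Run1 S P d) : Run0 S (P - r) r := by
  obtain ⟨d', hd⟩ := h.good.prev0 hP
  have := h.zero _ _ hd
  rwa [this] at hd

theorem next1 (h : TwoBlocks S r a b) {Q : ℤ} (hQ : Run0 S Q r) :
    ∃ d, (d = a ∨ d = b) ∧ Run1 S (Q + r) d := by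
  obtain ⟨d', hd⟩ := h.good.next1 hQ
  exact ⟨d', h.ones _ _ hd, hd⟩

theorem prev1 (h : TwoBlocks S r a b) {Q : ℤ} (hQ : Run0 S Q r) :
    ∃ d, (d = a ∨ d = b) ∧ Run1 S (Q - d) d := by
  obtain ⟨d', hd⟩ := h.good.prev1 hQ
  exact ⟨d', h.ones _ _ hd, hd⟩

theorem cover (h : TwoBlocks S r a b) (c : ℤ) :
    ∃ Q d, (d = a ∨ d = b) ∧ Run0 S Q r ∧ Run1 S (Q + r) d ∧ Q ≤ c ∧ c < Q + r + d := by
  rcases h.good.step c with hc | hc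
  · obtain ⟨Q, d, hQ, h1, h2⟩ := h.good.cover0 hc
    obtain rfl := h.zero _ _ hQ
    obtain ⟨e, he, he'⟩ := h.next1 hQ
    exact ⟨Q, e, he, hQ, he', h1, by have := he'.1; omega⟩
  · obtain ⟨P, d, hP, h1, h2⟩ := h.good.cover1 hc
    refine ⟨P - r, d, h.ones _ _ hP, h.prev0 hP, ?_, ?_, by omega⟩
    · simpa using hP
    · have := h.hr; omega

theorem locate {Q d : ℤ} (h0 : Run0 S Q r) (h1 : Run1 S (Q + r) d) {x : ℤ} (hx : Q ≤ x) :
    (x < Q + r ∧ S x = S Q) ∨ (Q + r ≤ x ∧ x < Q + r + d ∧ S x = S Q + (x - Q - r)) ∨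
      Q + r + d ≤ x := by
  obtain ⟨a1, -, a2, -⟩ := h0
  obtain ⟨b1, -, b2, -⟩ := h1
  have := a2 (Q + r) (by omega) le_rfl
  rcases lt_or_ge x (Q + r) with hx1 | hx1
  · exact Or.inl ⟨hx1, a2 x hx hx1.le⟩
  · rcases lt_or_ge x (Q + r + d) with hx2 | hx2
    · have := b2 x hx1 hx2.le
      exact Or.inr (Or.inl ⟨hx1, hx2, by omega⟩)
    · exact Or.inr (Or.inr hx2)

theorem blockEnd {Q d : ℤ} (h0 : Run0 S Q r) (h1 : Run1 S (Q + r) d) :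
    S (Q + r + d) = S Q + d := by
  obtain ⟨a1, -, a2, -⟩ := h0
  obtain ⟨b1, -, b2, -⟩ := h1
  have := a2 (Q + r) (by omega) le_rfl
  have := b2 (Q + r + d) (by omega) le_rfl
  omega

/-- Three consecutive blocks, the first of which contains `c`, together with the
values of the prefix sums on them. -/
theorem cover3 (h : TwoBlocks S r a b) (c : ℤ) :
    ∃ Q Q₁ Q₂ Q₃ d₀ d₁ d₂, Q ≤ c ∧ c < Q₁ ∧ Q₁ = Q + r + d₀ ∧ Q₂ = Q₁ + r + d₁ ∧
      Q₃ = Q₂ + r + d₂ ∧ (d₀ = a ∨ d₀ = b) ∧ (d₁ = a ∨ d₁ = b) ∧ (d₂ = a ∨ d₂ = b) ∧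
      Run1 S (Q + r) d₀ ∧ Run1 S (Q₁ + r) d₁ ∧ Run1 S (Q₂ + r) d₂ ∧
      ((c < Q + r ∧ S c = S Q) ∨ (Q + r ≤ c ∧ S c = S Q + (c - Q - r))) ∧
      ∀ e, Q ≤ e → (e < Q + r ∧ S e = S Q) ∨ (Q + r ≤ e ∧ e < Q₁ ∧ S e = S Q + (e - Q - r)) ∨
        (Q₁ ≤ e ∧ e < Q₁ + r ∧ S e = S Q + d₀) ∨
        (Q₁ + r ≤ e ∧ e < Q₂ ∧ S e = S Q + d₀ + (e - Q₁ - r)) ∨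
        (Q₂ ≤ e ∧ e < Q₂ + r ∧ S e = S Q + d₀ + d₁) ∨
        (Q₂ + r ≤ e ∧ e < Q₃ ∧ S e = S Q + d₀ + d₁ + (e - Q₂ - r)) ∨
        (Q₃ ≤ e ∧ S Q + d₀ + d₁ + d₂ ≤ S e ∧ S e ≤ S Q + d₀ + d₁ + d₂ + (e - Q₃)) := by
  obtain ⟨Q, d₀, hd₀, hQ, hP, h1, h2⟩ := h.cover c
  have hQ₁ := h.next0 hP
  obtain ⟨d₁, hd₁, hP₁⟩ := h.next1 hQ₁
  have hQ₂ := h.next0 hP₁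
  obtain ⟨d₂, hd₂, hP₂⟩ := h.next1 hQ₂
  refine ⟨Q, _, _, _, d₀, d₁, d₂, h1, h2, rfl, rfl, rfl, hd₀, hd₁, hd₂, hP, hP₁, hP₂, ?_, ?_⟩
  · rcases locate hQ hP h1 with f | f | f <;> omega
  intro e he
  have b0 := blockEnd hQ hP
  have b1 := blockEnd hQ₁ hP₁
  have b2 := blockEnd hQ₂ hP₂
  rcases locate hQ hP he with ⟨f1, f2⟩ | ⟨f1, f2, f3⟩ | f1
  · omega
  · omega
  rcases locate hQ₁ hP₁ f1 with ⟨f1, f2⟩ | ⟨f1, f2, f3⟩ | f1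
  · omega
  · omega
  rcases locate hQ₂ hP₂ f1 with ⟨f1, f2⟩ | ⟨f1, f2, f3⟩ | f1
  · omega
  · omega
  have := h.good.mono f1
  omega

theorem run1_sep {P P' d d' : ℤ} (h1 : Run1 S P d) (h2 : Run1 S P' d') (hlt : P < P') :
    P + d < P' := by
  obtain ⟨a1, a2, a3, a4⟩ := h1
  obtain ⟨b1, b2, b3, b4⟩ := h2
  by_contra hcon
  have := a3 (P' - 1) (by omega) (by omega)
  have := a3 P' (by omega) (by omega)
  omega

theorem sep (h : TwoBlocks S r a b) {P P' d d' : ℤ} (h1 : Run1 S P d) (h2 : Run1 S P' d')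
    (hlt : P < P') : P + d + r ≤ P' := by
  have h3 := run1_sep h1 h2 hlt
  obtain ⟨a1, a2, a3, a4⟩ := h.next0 h1
  obtain ⟨b1, b2, b3, b4⟩ := h2
  by_contra hcon
  have := a3 (P' + 1) (by omega) (by omega)
  have := a3 P' (by omega) (by omega)
  have := b3 (P' + 1) (by omega) (by omega)
  omega

/-- If two runs of equal length `d` are never adjacent, they are far apart. -/
theorem sep' (h : TwoBlocks S r a b) {P P' d d' : ℤ} (hdd : (d = a ∧ d' = b) ∨ (d = b ∧ d' = a))
    (hn : ∀ P, Run1 S P d → ¬ Run1 S (P + d + r) d)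
    (h1 : Run1 S P d) (h2 : Run1 S P' d) (hlt : P < P') : P + d + r + d' + r ≤ P' := by
  have h3 := h.sep h1 h2 hlt
  obtain ⟨e, he, hP⟩ := h.next1 (h.next0 h1)
  have hne : e ≠ d := by rintro rfl; exact hn _ h1 hP
  have hed : e = d' := by omega
  subst hed
  rcases eq_or_lt_of_le h3 with h4 | h4
  · exact absurd (h4 ▸ h2) (hn _ h1)
  · exact h.sep hP h2 h4

theorem classB (h : TwoBlocks S r a b) {i : ℤ} : S (i + b) - S i = b ↔ Run1 S i b := by
  have ha := h.ha
  have hab := h.hab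
  constructor
  · intro hi
    have := h.good.mono (x := i + 1) (y := i + b) (by omega)
    have := h.good.step i
    obtain ⟨P, d, hP, h1, h2⟩ := h.good.cover1 (c := i) (by omega)
    have hd := h.ones _ _ hP
    obtain ⟨a1, a2, a3, a4⟩ := id hP
    have := a3 i (by omega) (by omega)
    have hend : i + b ≤ P + d := by
      by_contra hcon
      have := a3 (P + d) (by omega) le_rfl
      have := h.good.mono (x := P + d + 1) (y := i + b) (by omega)
      omega
    obtain rfl : P = i := by omega
    obtain rfl : d = b := by omega
    exact hP
  · rintro ⟨a1, a2, a3, a4⟩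
    have := a3 (i + b) (by omega) (by omega)
    omega

theorem classA (h : TwoBlocks S r a b) {i : ℤ} :
    S (i + (2 * r + a)) - S i = a ↔ Run1 S (i + r) a := by
  have ha := h.ha
  have hab := h.hab
  have hr := h.hr
  constructor
  · intro hi
    obtain ⟨Q, Q₁, Q₂, Q₃, d₀, d₁, d₂, h1, h2, h3, h4, h5, e0, e1, e2, p0, p1, p2, cl, loc⟩ :=
      h.cover3 i
    generalize he : i + (2 * r + a) = e at *
    have key : d₀ = a ∧ i = Q := by
      rcases cl with c1 | c1 <;>
      rcases loc e (by omega) with f1 | f1 | f1 | f1 | f1 | f1 | f1 <;> omega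
    rw [key.2, ← key.1]; exact p0
  · intro hP
    have z1 := h.prev0 hP
    have z2 := h.next0 hP
    obtain ⟨a1, a2, a3, a4⟩ := hP
    obtain ⟨-, -, z1, -⟩ := z1
    obtain ⟨-, -, z2, -⟩ := z2
    have := z1 i (by omega) (by omega)
    have := z1 (i + r) (by omega) (by omega)
    have := z2 (i + (2 * r + a)) (by omega) (by omega)
    have := a3 (i + r + a) (by omega) (by omega)
    omega

theorem not_adj {Q Q₁ d d₀ d₁ : ℤ} (hn : ∀ P, Run1 S P d → ¬ Run1 S (P + d + r) d)
    (h0 : Run1 S (Q + r) d₀) (h1 : Run1 S (Q₁ + r) d₁) (hQ : Q₁ = Q + r + d₀) :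
    ¬ (d₀ = d ∧ d₁ = d) := by
  rintro ⟨rfl, rfl⟩
  refine hn _ h0 ?_
  rw [hQ] at h1
  convert h1 using 1

/-- The blocks around an isolated one run. -/
theorem around (h : TwoBlocks S r a b) {P d d' : ℤ} (hdd : (d = a ∧ d' = b) ∨ (d = b ∧ d' = a))
    (hn : ∀ P, Run1 S P d → ¬ Run1 S (P + d + r) d) (hP : Run1 S P d) :
    (∀ x, P - 2 * r - d' ≤ x → x ≤ P - r - d' → S x = S P - d') ∧
    (∀ x, P - r - d' ≤ x → x ≤ P - r → S x = S P + (x - (P - r))) ∧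
    (∀ x, P - r ≤ x → x ≤ P → S x = S P) ∧
    (∀ x, P ≤ x → x ≤ P + d → S x = S P + (x - P)) ∧
    (∀ x, P + d ≤ x → x ≤ P + d + r → S x = S P + d) ∧
    (∀ x, P + d + r ≤ x → x ≤ P + d + r + d' → S x = S P + d + (x - (P + d + r))) ∧
    (∀ x, P + d + r + d' ≤ x → x ≤ P + d + r + d' + r → S x = S P + d + d') ∧
    S (P - 2 * r - d' - 1) = S P - d' - 1 ∧ S (P + d + r + d' + r + 1) = S P + d + d' + 1 := by
  have z1 := h.prev0 hP
  have z2 := h.next0 hP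
  obtain ⟨e, he, p1⟩ := h.prev1 z1
  obtain ⟨f, hf, p2⟩ := h.next1 z2
  have hr := h.hr
  have ha := h.ha
  have hab := h.hab
  have hed : e = d' := by
    have : e ≠ d := by
      rintro rfl
      exact hn _ p1 (by convert hP using 1; ring)
    omega
  have hfd : f = d' := by
    have : f ≠ d := by rintro rfl; exact hn _ hP p2
    omega
  subst hed
  subst hfd
  have z0 := h.prev0 p1
  have z3 := h.next0 p2
  obtain ⟨-, z0', z0, -⟩ := z0
  obtain ⟨-, -, z1, -⟩ := z1
  obtain ⟨-, -, z2, -⟩ := z2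
  obtain ⟨-, -, z3, z3'⟩ := z3
  obtain ⟨-, -, p1, -⟩ := p1
  obtain ⟨-, -, p2, -⟩ := p2
  obtain ⟨-, -, p3, -⟩ := hP
  have e1 := z0 (P - r - f) (by omega) (by omega)
  have e2 := p1 (P - r) (by omega) (by omega)
  have e3 := z1 P (by omega) (by omega)
  have e4 := p3 (P + d) (by omega) (by omega)
  have e5 := z2 (P + d + r) (by omega) (by omega)
  have e6 := p2 (P + d + r + f) (by omega) (by omega)
  refine ⟨fun x hx hx' => ?_, fun x hx hx' => ?_, fun x hx hx' => ?_, fun x hx hx' => ?_,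
    fun x hx hx' => ?_, fun x hx hx' => ?_, fun x hx hx' => ?_, ?_, ?_⟩
  · have := z0 x (by omega) (by omega); omega
  · have := p1 x (by omega) (by omega); omega
  · have := z1 x (by omega) (by omega); omega
  · have := p3 x (by omega) (by omega); omega
  · have := z2 x (by omega) (by omega); omega
  · have := p2 x (by omega) (by omega); omega
  · have := z3 x (by omega) (by omega); omega
  · rw [show P - 2 * r - f - 1 = P - r - f - r - 1 by ring, z0']
    have := z0 (P - r - f) (by omega) (by omega)
    omega
  · rw [z3']
    omega


set_option maxHeartbeats 1000000 in
theorem iff_isolatedB (h : TwoBlocks S r a b) (hr : 2 ≤ r)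
    (hYY : ∀ P, Run1 S P b → ¬ Run1 S (P + b + r) b) (c : ℤ) :
    S (c + (a + b + r + 1)) - S c = a + b ↔ ∃ P, Run1 S P b ∧
      ((P + (-a - r - 1) ≤ c ∧ c ≤ P + (-a - r - 1) + 1) ∨ (P + -1 ≤ c ∧ c ≤ P + -1 + 1)) := by
  have ha := h.ha
  have hab := h.hab
  have hr₁ := h.hr
  constructor
  · intro hc
    obtain ⟨Q, Q₁, Q₂, Q₃, d₀, d₁, d₂, h1, h2, h3, h4, h5, e0, e1, e2, p0, p1, p2, cl, loc⟩ :=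
      h.cover3 c
    generalize he : c + (a + b + r + 1) = e at *
    have hy0 := not_adj hYY p0 p1 h3
    have hy1 := not_adj hYY p1 p2 h4
    replace loc := loc e (by omega)
    rcases e0 with e0 | e0 <;> rcases e1 with e1 | e1 <;> rcases e2 with e2 | e2 <;>
    first
    | (exfalso; apply hy0; constructor <;> assumption)
    | (exfalso; apply hy1; constructor <;> assumption)
    | subst e0 e1 e2
      clear hy0 hy1
      rcases cl with ⟨c1, c2⟩ | ⟨c1, c2⟩ <;>
      rcases loc with f1 | f1 | f1 | f1 | f1 | f1 | f1 <;>
      first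
      | (exfalso; omega)
      | exact ⟨_, p0, Or.inl ⟨by omega, by omega⟩⟩
      | exact ⟨_, p0, Or.inr ⟨by omega, by omega⟩⟩
      | exact ⟨_, p1, Or.inl ⟨by omega, by omega⟩⟩
  · rintro ⟨P, hP, hk⟩
    obtain ⟨n0, n1, n2, n3, n4, n5, n6, n7, n8⟩ := h.around (d' := a) (by simp) hYY hP
    have hk' : c = P - a - r - 1 ∨ c = P - a - r ∨ c = P - 1 ∨ c = P := by omega
    rcases hk' with rfl | rfl | rfl | hk'
    · have := n0 (P - a - r - 1) (by omega) (by omega)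
      have := n3 (P - a - r - 1 + (a + b + r + 1)) (by omega) (by omega)
      omega
    · have := n1 (P - a - r) (by omega) (by omega)
      have := n4 (P - a - r + (a + b + r + 1)) (by omega) (by omega)
      omega
    · have := n2 (P - 1) (by omega) (by omega)
      have := n5 (P - 1 + (a + b + r + 1)) (by omega) (by omega)
      omega
    · subst hk'
      have := n6 (c + (a + b + r + 1)) (by omega) (by omega)
      omega

set_option maxHeartbeats 1000000 in
theorem iff_isolatedB_one (h : TwoBlocks S r a b) (hr : r = 1) (hb : a + 2 ≤ b)
    (hYY : ∀ P, Run1 S P b → ¬ Run1 S (P + b + r) b) (c : ℤ) :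
    S (c + (a + b)) - S c = a + b - 1 ↔ ∃ P, Run1 S P b ∧
      ((P + (-a - 1) ≤ c ∧ c ≤ P + (-a - 1) + 1) ∨ (P + 0 ≤ c ∧ c ≤ P + 0 + 1)) := by
  have ha := h.ha
  have hab := h.hab
  have hr₁ := h.hr
  constructor
  · intro hc
    obtain ⟨Q, Q₁, Q₂, Q₃, d₀, d₁, d₂, h1, h2, h3, h4, h5, e0, e1, e2, p0, p1, p2, cl, loc⟩ :=
      h.cover3 c
    generalize he : c + (a + b) = e at *
    have hy0 := not_adj hYY p0 p1 h3
    have hy1 := not_adj hYY p1 p2 h4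
    replace loc := loc e (by omega)
    rcases e0 with e0 | e0 <;> rcases e1 with e1 | e1 <;> rcases e2 with e2 | e2 <;>
    first
    | (exfalso; apply hy0; constructor <;> assumption)
    | (exfalso; apply hy1; constructor <;> assumption)
    | subst e0 e1 e2
      clear hy0 hy1
      rcases cl with ⟨c1, c2⟩ | ⟨c1, c2⟩ <;>
      rcases loc with f1 | f1 | f1 | f1 | f1 | f1 | f1 <;>
      first
      | (exfalso; omega)
      | exact ⟨_, p0, Or.inl ⟨by omega, by omega⟩⟩
      | exact ⟨_, p0, Or.inr ⟨by omega, by omega⟩⟩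
      | exact ⟨_, p1, Or.inl ⟨by omega, by omega⟩⟩
  · rintro ⟨P, hP, hk⟩
    obtain ⟨n0, n1, n2, n3, n4, n5, n6, n7, n8⟩ := h.around (d' := a) (by simp) hYY hP
    subst hr
    have hk' : c = P - a - 1 ∨ c = P - a ∨ c = P + 1 ∨ c = P := by omega
    rcases hk' with rfl | rfl | rfl | hk'
    · have := n1 (P - a - 1) (by omega) (by omega)
      have := n3 (P - a - 1 + (a + b)) (by omega) (by omega)
      omega
    · have := n1 (P - a) (by omega) (by omega)
      have := n3 (P - a + (a + b)) (by omega) (by omega)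
      omega
    · have := n3 (P + 1) (by omega) (by omega)
      have := n6 (P + 1 + (a + b)) (by omega) (by omega)
      omega
    · have := n5 (c + (a + b)) (by omega) (by omega)
      have := n3 c (by omega) (by omega)
      omega

set_option maxHeartbeats 1000000 in
theorem iff_isolatedA (h : TwoBlocks S r a b) (hr : 2 ≤ r)
    (hXX : ∀ P, Run1 S P a → ¬ Run1 S (P + a + r) a) (c : ℤ) :
    S (c + (a + b + 2 * r + 1)) - S c = a + b ↔ ∃ P, Run1 S P a ∧
      ((P + (-(2 * r) - b) ≤ c ∧ c ≤ P + (-(2 * r) - b) + (r - 1)) ∨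
        (P + -r ≤ c ∧ c ≤ P + -r + (r - 1))) := by
  have ha := h.ha
  have hab := h.hab
  have hr₁ := h.hr
  constructor
  · intro hc
    obtain ⟨Q, Q₁, Q₂, Q₃, d₀, d₁, d₂, h1, h2, h3, h4, h5, e0, e1, e2, p0, p1, p2, cl, loc⟩ :=
      h.cover3 c
    generalize he : c + (a + b + 2 * r + 1) = e at *
    have hy0 := not_adj hXX p0 p1 h3
    have hy1 := not_adj hXX p1 p2 h4
    replace loc := loc e (by omega)
    rcases e0 with e0 | e0 <;> rcases e1 with e1 | e1 <;> rcases e2 with e2 | e2 <;>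
    first
    | (exfalso; apply hy0; constructor <;> assumption)
    | (exfalso; apply hy1; constructor <;> assumption)
    | subst e0 e1 e2
      clear hy0 hy1
      rcases cl with ⟨c1, c2⟩ | ⟨c1, c2⟩ <;>
      rcases loc with f1 | f1 | f1 | f1 | f1 | f1 | f1 <;>
      first
      | (exfalso; omega)
      | exact ⟨_, p0, Or.inl ⟨by omega, by omega⟩⟩
      | exact ⟨_, p0, Or.inr ⟨by omega, by omega⟩⟩
      | exact ⟨_, p1, Or.inl ⟨by omega, by omega⟩⟩
  · rintro ⟨P, hP, hk⟩
    obtain ⟨n0, n1, n2, n3, n4, n5, n6, n7, n8⟩ := h.around (d' := b) (by simp) hXX hP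
    rcases hk with hk | hk
    · have := n0 c (by omega) (by omega)
      have := n4 (c + (a + b + 2 * r + 1)) (by omega) (by omega)
      omega
    · have := n2 c (by omega) (by omega)
      have := n6 (c + (a + b + 2 * r + 1)) (by omega) (by omega)
      omega

set_option maxHeartbeats 1000000 in
theorem iff_isolatedA_one (h : TwoBlocks S r a b) (hr : r = 1) (hb : a + 2 ≤ b)
    (hXX : ∀ P, Run1 S P a → ¬ Run1 S (P + a + r) a) (c : ℤ) :
    S (c + (a + b + 4)) - S c = a + b + 1 ↔ ∃ P, Run1 S P a ∧
      ((P + (-b - 3) ≤ c ∧ c ≤ P + (-b - 3) + 1) ∨ (P + -2 ≤ c ∧ c ≤ P + -2 + 1)) := by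
  have ha := h.ha
  have hab := h.hab
  have hr₁ := h.hr
  constructor
  · intro hc
    obtain ⟨Q, Q₁, Q₂, Q₃, d₀, d₁, d₂, h1, h2, h3, h4, h5, e0, e1, e2, p0, p1, p2, cl, loc⟩ :=
      h.cover3 c
    generalize he : c + (a + b + 4) = e at *
    have hy0 := not_adj hXX p0 p1 h3
    have hy1 := not_adj hXX p1 p2 h4
    replace loc := loc e (by omega)
    rcases e0 with e0 | e0 <;> rcases e1 with e1 | e1 <;> rcases e2 with e2 | e2 <;>
    first
    | (exfalso; apply hy0; constructor <;> assumption)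
    | (exfalso; apply hy1; constructor <;> assumption)
    | subst e0 e1 e2
      clear hy0 hy1
      rcases cl with ⟨c1, c2⟩ | ⟨c1, c2⟩ <;>
      rcases loc with f1 | f1 | f1 | f1 | f1 | f1 | f1 <;>
      first
      | (exfalso; omega)
      | exact ⟨_, p0, Or.inl ⟨by omega, by omega⟩⟩
      | exact ⟨_, p0, Or.inr ⟨by omega, by omega⟩⟩
      | exact ⟨_, p1, Or.inl ⟨by omega, by omega⟩⟩
      | exact ⟨_, p1, Or.inr ⟨by omega, by omega⟩⟩
      | exact ⟨_, p2, Or.inl ⟨by omega, by omega⟩⟩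
  · rintro ⟨P, hP, hk⟩
    obtain ⟨n0, n1, n2, n3, n4, n5, n6, n7, n8⟩ := h.around (d' := b) (by simp) hXX hP
    subst hr
    have hk' : c = P - b - 3 ∨ c = P - b - 2 ∨ c = P - 2 ∨ c = P - 1 := by omega
    rcases hk' with rfl | rfl | rfl | hk'
    · have := n4 (P - b - 3 + (a + b + 4)) (by omega) (by omega)
      rw [show P - 2 * 1 - b - 1 = P - b - 3 by ring] at n7
      omega
    · have := n0 (P - b - 2) (by omega) (by omega)
      have := n5 (P - b - 2 + (a + b + 4)) (by omega) (by omega)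
      omega
    · have := n1 (P - 2) (by omega) (by omega)
      have := n6 (P - 2 + (a + b + 4)) (by omega) (by omega)
      omega
    · have := n2 c (by omega) (by omega)
      rw [show P + a + 1 + b + 1 + 1 = c + (a + b + 4) by omega] at n8
      omega


/-- Long runs cannot all be isolated. -/
theorem exists_adjacentB (h : TwoBlocks S r a b) (hrb : 2 ≤ r ∨ a + 2 ≤ b) :
    ∃ P, Run1 S P b ∧ Run1 S (P + b + r) b := by
  have ha := h.ha
  have hab := h.hab
  have hr := h.hr
  by_contra hcon
  have hYY : ∀ P, Run1 S P b → ¬ Run1 S (P + b + r) b := fun P h1 h2 => hcon ⟨P, h1, h2⟩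
  have hsep : ∀ i j, Run1 S i b → Run1 S j b → i < j → i + b + r + a + r ≤ j := fun i j hi hj hij =>
    h.sep' (by simp) hYY hi hj hij
  have har := fun {P} => h.around (P := P) (d := b) (d' := a) (by simp) hYY
  obtain ⟨P, hP⟩ := h.exb
  rcases hr.lt_or_eq with hr2 | hr1
  · refine h.good.not_two_clusters (A := fun P => Run1 S P b) (o := 0) (LA := b) (mA := b)
      (p := -a - r - 1) (q := -1) (k := 1) (e := 0) (f := a) (κ₁ := 0) (κ₂ := -a) (by omega)
      (fun i => by rw [add_zero]; exact h.classB) hP ⟨0, fun i _ => by simp⟩ (by omega) le_rfl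
      (by omega) (h.iff_isolatedB hr2 hYY) (fun i j hi hj hij => ?_) (fun i hi => ?_)
      (fun i hi => ?_) (fun i hi => ?_) (fun i hi => ?_) (by omega) (fun i j hij => ?_)
    · have := hsep i j hi hj hij
      omega
    · obtain ⟨n0, n1, n2, n3, n4, n5, n6, -, -⟩ := har hi
      have := n0 (i + (-a - r - 1)) (by omega) (by omega)
      have := n0 (i + (-a - r - 1) + 1) (by omega) (by omega)
      omega
    · obtain ⟨n0, n1, n2, n3, n4, n5, n6, -, -⟩ := har hi
      have := n2 (i + -1) (by omega) (by omega)
      have := n1 (i + (-a - r - 1) + 1) (by omega) (by omega)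
      omega
    · simp
    · obtain ⟨n0, n1, n2, n3, n4, n5, n6, -, -⟩ := har hi
      have := n0 (i + (-a - r - 1)) (by omega) (by omega)
      omega
    · have := hsep i j hij.2.1 hij.2.2.1 hij.1
      omega
  · subst hr1
    refine h.good.not_two_clusters (A := fun P => Run1 S P b) (o := 0) (LA := b) (mA := b)
      (p := -a - 1) (q := 0) (k := 1) (e := 1) (f := a - 1) (κ₁ := 1) (κ₂ := -a) (by omega)
      (fun i => by rw [add_zero]; exact h.classB) hP ⟨0, fun i _ => by simp⟩ (by omega) le_rfl
      (by omega) (h.iff_isolatedB_one rfl (by omega) hYY) (fun i j hi hj hij => ?_)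
      (fun i hi => ?_) (fun i hi => ?_) (fun i hi => ?_) (fun i hi => ?_) (by omega)
      (fun i j hij => ?_)
    · have := hsep i j hi hj hij
      omega
    · obtain ⟨n0, n1, n2, n3, n4, n5, n6, -, -⟩ := har hi
      have := n1 (i + (-a - 1)) (by omega) (by omega)
      have := n1 (i + (-a - 1) + 1) (by omega) (by omega)
      omega
    · obtain ⟨n0, n1, n2, n3, n4, n5, n6, -, -⟩ := har hi
      have := n3 (i + 0) (by omega) (by omega)
      have := n1 (i + (-a - 1) + 1) (by omega) (by omega)
      omega
    · obtain ⟨n0, n1, n2, n3, n4, n5, n6, -, -⟩ := har hi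
      have := n3 (i + 0 + 1) (by omega) (by omega)
      omega
    · obtain ⟨n0, n1, n2, n3, n4, n5, n6, -, -⟩ := har hi
      have := n1 (i + (-a - 1)) (by omega) (by omega)
      omega
    · have := hsep i j hij.2.1 hij.2.2.1 hij.1
      omega

/-- Short runs cannot all be isolated. -/
theorem exists_adjacentA (h : TwoBlocks S r a b) (hrb : 2 ≤ r ∨ a + 2 ≤ b) :
    ∃ P, Run1 S P a ∧ Run1 S (P + a + r) a := by
  have ha := h.ha
  have hab := h.hab
  have hr := h.hr
  by_contra hcon
  have hXX : ∀ P, Run1 S P a → ¬ Run1 S (P + a + r) a := fun P h1 h2 => hcon ⟨P, h1, h2⟩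
  have hsep : ∀ i j, Run1 S i a → Run1 S j a → i < j → i + a + r + b + r ≤ j := fun i j hi hj hij =>
    h.sep' (by simp) hXX hi hj hij
  have hcons : ∀ i j, Consec (fun P => Run1 S P a) i j →
      j = i + a + r + b + r ∨ i + a + r + b + r + b + r ≤ j := by
    rintro i j ⟨h1, h2, h3, h4⟩
    obtain ⟨d, hd, h5⟩ := h.next1 (h.next0 h2)
    have hdb : d = b := by
      rcases hd with rfl | rfl
      · exact absurd h5 (hXX _ h2)
      · rfl
    subst hdb
    obtain ⟨e, he, h6⟩ := h.next1 (h.next0 h5)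
    have := hsep i j h2 h3 h1
    rcases eq_or_lt_of_le this with h7 | h7
    · exact Or.inl h7.symm
    · rcases he with rfl | rfl
      · exact absurd h6 (h4 _ (by omega) h7)
      · exact Or.inr (h.sep h6 h3 h7)
  have har := fun {P} => h.around (P := P) (d := a) (d' := b) (by simp) hXX
  have hcl : ∀ i, S (i + -r + (2 * r + a)) - S (i + -r) = a ↔ Run1 S i a := fun i => by
    rw [h.classA, neg_add_cancel_right]
  have hκ : ∃ κ, ∀ i, Run1 S i a → S (i + -r) - S i = κ := by
    refine ⟨0, fun i hi => ?_⟩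
    obtain ⟨n0, n1, n2, n3, n4, n5, n6, -, -⟩ := har hi
    have := n2 (i + -r) (by omega) (by omega)
    omega
  obtain ⟨P, hP⟩ := h.exa
  rcases hr.lt_or_eq with hr2 | hr1
  · refine h.good.not_two_clusters (A := fun P => Run1 S P a) (o := -r) (LA := 2 * r + a) (mA := a)
      (p := -(2 * r) - b) (q := -r) (k := r - 1) (e := 0) (f := b) (κ₁ := 0) (κ₂ := -b) (by omega)
      hcl hP hκ (by omega) (by omega)
      (by omega) (h.iff_isolatedA hr2 hXX) (fun i j hi hj hij => ?_) (fun i hi => ?_)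
      (fun i hi => ?_) (fun i hi => ?_) (fun i hi => ?_) (by omega) (fun i j hij => ?_)
    · have := hsep i j hi hj hij
      omega
    · obtain ⟨n0, n1, n2, n3, n4, n5, n6, -, -⟩ := har hi
      have := n0 (i + (-(2 * r) - b)) (by omega) (by omega)
      have := n0 (i + (-(2 * r) - b) + 1) (by omega) (by omega)
      omega
    · obtain ⟨n0, n1, n2, n3, n4, n5, n6, -, -⟩ := har hi
      have := n2 (i + -r) (by omega) (by omega)
      have := n0 (i + (-(2 * r) - b) + (r - 1)) (by omega) (by omega)
      omega
    · obtain ⟨n0, n1, n2, n3, n4, n5, n6, -, -⟩ := har hi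
      have := n2 (i + -r + (r - 1)) (by omega) (by omega)
      omega
    · obtain ⟨n0, n1, n2, n3, n4, n5, n6, -, -⟩ := har hi
      have := n0 (i + (-(2 * r) - b)) (by omega) (by omega)
      omega
    · have := hcons i j hij
      omega
  · subst hr1
    refine h.good.not_two_clusters (A := fun P => Run1 S P a) (o := -1) (LA := 2 * 1 + a) (mA := a)
      (p := -b - 3) (q := -2) (k := 1) (e := 1) (f := b - 1) (κ₁ := 0) (κ₂ := -b - 1) (by omega)
      hcl hP hκ (by omega) le_rfl
      (by omega) (h.iff_isolatedA_one rfl (by omega) hXX) (fun i j hi hj hij => ?_)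
      (fun i hi => ?_) (fun i hi => ?_) (fun i hi => ?_) (fun i hi => ?_) (by omega)
      (fun i j hij => ?_)
    · have := hsep i j hi hj hij
      omega
    · obtain ⟨n0, n1, n2, n3, n4, n5, n6, n7, -⟩ := har hi
      have := n0 (i + (-b - 3) + 1) (by omega) (by omega)
      rw [show i - 2 * 1 - b - 1 = i + (-b - 3) by ring] at n7
      omega
    · obtain ⟨n0, n1, n2, n3, n4, n5, n6, -, -⟩ := har hi
      have := n1 (i + -2) (by omega) (by omega)
      have := n0 (i + (-b - 3) + 1) (by omega) (by omega)
      omega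
    · obtain ⟨n0, n1, n2, n3, n4, n5, n6, -, -⟩ := har hi
      have := n2 (i + -2 + 1) (by omega) (by omega)
      omega
    · obtain ⟨n0, n1, n2, n3, n4, n5, n6, n7, -⟩ := har hi
      rw [show i - 2 * 1 - b - 1 = i + (-b - 3) by ring] at n7
      omega
    · have hc := hcons i j hij
      obtain ⟨n0, n1, n2, n3, n4, n5, n6, -, -⟩ := har hij.2.1
      have := n2 (i + -2 + 1) (by omega) (by omega)
      rcases hc with rfl | hc
      · have := n3 (i + a + 1 + b + 1 + (-b - 3)) (by omega) (by omega)
        omega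
      · omega

end TwoBlocks

theorem Good.gap_unique {S : ℤ → ℤ} (h : Good S) {A : ℤ → Prop} {L m k e d κ i₀ : ℤ} (hL : 1 ≤ L)
    (hcl : ∀ c, S (c + L) - S c = m ↔ A (c + k) ∨ A (c + k + 1))
    (he : ∀ i, A i → S (i - k) - S (i - k - 1) = e) (hκ : ∀ i, A i → S (i - k) - S i = κ)
    (hsep : ∀ i j, A i → A j → i < j → i + 2 ≤ j ∧ (j = i + 2 → S j - S i ≠ 2 * e))
    (hadj : Consec A i₀ (i₀ + d))
    {i j i' j' : ℤ} (h1 : Consec A i j) (h2 : Consec A i' j') (hij : j ≠ i + d)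
    (hij' : j' ≠ i' + d) : j - i = j' - i' ∧ S j - S i = S j' - S i' := by
  have key : ∀ i j, Consec A i j → RetPair S L m (j - i - 1) (S j - S i - e) := by
    intro i j ⟨h1, h2, h3, h4⟩
    have := hsep i j h2 h3 h1
    refine ⟨i - k, j - k - 1, ⟨by omega, ?_, ?_, fun x hx hx' => ?_⟩, by omega, ?_⟩
    · exact (hcl _).2 (Or.inl (by simpa using h2))
    · exact (hcl _).2 (Or.inr (by rwa [show j - k - 1 + k + 1 = j by ring]))
    · rw [Ne, hcl, not_or]
      exact ⟨h4 _ (by omega) (by omega), h4 _ (by omega) (by omega)⟩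
    · have := he j h3
      have := hκ j h3
      have := hκ i h2
      omega
  have r1 : RetPair S L m 1 e := by
    have hA := hadj.2.1
    refine ⟨i₀ - k - 1, i₀ - k, ⟨by omega, ?_, ?_, fun x hx hx' => by omega⟩, by omega, he _ hA⟩
    · exact (hcl _).2 (Or.inr (by rwa [show i₀ - k - 1 + k + 1 = i₀ by ring]))
    · exact (hcl _).2 (Or.inl (by simpa using hA))
  have s1 := hsep _ _ h1.2.1 h1.2.2.1 h1.1
  have s2 := hsep _ _ h2.2.1 h2.2.2.1 h2.1
  have s3 := hsep _ _ hadj.2.1 hadj.2.2.1 hadj.1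
  by_contra hcon
  exact h.four L m _ _ _ _ _ _ _ _ hL r1 (key _ _ h1) (key _ _ h2) (key _ _ hadj) (by omega)
    (by omega) (by omega) (by omega) (by omega) (by omega)

namespace TwoBlocks

variable {S : ℤ → ℤ} {r a b : ℤ}

set_option maxHeartbeats 1000000 in
theorem iff_near_B_of_gap (h : TwoBlocks S r a b) (hb : a + 2 ≤ b) (c : ℤ) :
    S (c + (b - 1)) - S c = b - 1 ↔ Run1 S (c + -1) b ∨ Run1 S (c + -1 + 1) b := by
  have ha := h.ha
  have hab := h.hab
  have hr₁ := h.hr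
  constructor
  · intro hc
    obtain ⟨Q, Q₁, Q₂, Q₃, d₀, d₁, d₂, h1, h2, h3, h4, h5, e0, e1, e2, p0, p1, p2, cl, loc⟩ :=
      h.cover3 c
    generalize he : c + (b - 1) = e at *
    replace loc := loc e (by omega)
    rcases e0 with e0 | e0 <;> rcases e1 with e1 | e1 <;> rcases e2 with e2 | e2 <;>
    · subst e0 e1 e2
      rcases cl with ⟨c1, c2⟩ | ⟨c1, c2⟩ <;>
      rcases loc with f1 | f1 | f1 | f1 | f1 | f1 | f1 <;>
      first
      | (exfalso; omega)
      | (have hk : c + -1 = Q + r := by omega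
         rw [hk]; exact Or.inl p0)
      | (have hk : c + -1 + 1 = Q + r := by omega
         rw [hk]; exact Or.inr p0)
  · rintro (hP | hP)
    all_goals
      have z1 := h.prev0 hP
      have z2 := h.next0 hP
      obtain ⟨-, p1, p2, p3⟩ := hP
      obtain ⟨-, y1, y2, y3⟩ := z1
      obtain ⟨-, z1, z2, z3⟩ := z2
    · have := p2 c (by omega) (by omega)
      have := p2 (c + (b - 1)) (by omega) (by omega)
      omega
    · have := p2 c (by omega) (by omega)
      have := p2 (c + (b - 1)) (by omega) (by omega)
      omega

set_option maxHeartbeats 1000000 in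
theorem iff_near_B (h : TwoBlocks S r a b) (hr : 2 ≤ r) (c : ℤ) :
    S (c + (b + 1)) - S c = b ↔ Run1 S (c + 0) b ∨ Run1 S (c + 0 + 1) b := by
  have ha := h.ha
  have hab := h.hab
  have hr₁ := h.hr
  constructor
  · intro hc
    obtain ⟨Q, Q₁, Q₂, Q₃, d₀, d₁, d₂, h1, h2, h3, h4, h5, e0, e1, e2, p0, p1, p2, cl, loc⟩ :=
      h.cover3 c
    generalize he : c + (b + 1) = e at *
    replace loc := loc e (by omega)
    rcases e0 with e0 | e0 <;> rcases e1 with e1 | e1 <;> rcases e2 with e2 | e2 <;>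
    · subst e0 e1 e2
      rcases cl with ⟨c1, c2⟩ | ⟨c1, c2⟩ <;>
      rcases loc with f1 | f1 | f1 | f1 | f1 | f1 | f1 <;>
      first
      | (exfalso; omega)
      | (have hk : c + 0 = Q + r := by omega
         rw [hk]; exact Or.inl p0)
      | (have hk : c + 0 + 1 = Q + r := by omega
         rw [hk]; exact Or.inr p0)
  · rintro (hP | hP)
    all_goals
      have z1 := h.prev0 hP
      have z2 := h.next0 hP
      obtain ⟨-, p1, p2, p3⟩ := hP
      obtain ⟨-, y1, y2, y3⟩ := z1
      obtain ⟨-, z1, z2, z3⟩ := z2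
    · have := p2 c (by omega) (by omega)
      have := z2 (c + (b + 1)) (by omega) (by omega)
      have := z2 (c + 0 + b) (by omega) (by omega)
      have := p2 (c + 0 + b) (by omega) (by omega)
      have := p2 (c + 0) (by omega) (by omega)
      omega
    · have := y2 c (by omega) (by omega)
      have := y2 (c + 0 + 1) (by omega) (by omega)
      have := p2 (c + (b + 1)) (by omega) (by omega)
      omega

set_option maxHeartbeats 1000000 in
theorem iff_near_A_of_gap (h : TwoBlocks S r a b) (hr : r = 1) (hb : a + 2 ≤ b) (c : ℤ) :
    S (c + (2 * r + a + 1)) - S c = a + 1 ↔ Run1 S (c + r) a ∨ Run1 S (c + r + 1) a := by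
  have ha := h.ha
  have hab := h.hab
  have hr₁ := h.hr
  constructor
  · intro hc
    obtain ⟨Q, Q₁, Q₂, Q₃, d₀, d₁, d₂, h1, h2, h3, h4, h5, e0, e1, e2, p0, p1, p2, cl, loc⟩ :=
      h.cover3 c
    generalize he : c + (2 * r + a + 1) = e at *
    replace loc := loc e (by omega)
    rcases e0 with e0 | e0 <;> rcases e1 with e1 | e1 <;> rcases e2 with e2 | e2 <;>
    · subst e0 e1 e2
      rcases cl with ⟨c1, c2⟩ | ⟨c1, c2⟩ <;>
      rcases loc with f1 | f1 | f1 | f1 | f1 | f1 | f1 <;>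
      first
      | (exfalso; omega)
      | (have hk : c + r = Q + r := by omega
         rw [hk]; exact Or.inl p0)
      | (have hk : c + r + 1 = Q₁ + r := by omega
         rw [hk]; exact Or.inr p1)
  · rintro (hP | hP)
    all_goals
      have z1 := h.prev0 hP
      have z2 := h.next0 hP
      obtain ⟨-, p1, p2, p3⟩ := hP
      obtain ⟨-, y1, y2, y3⟩ := z1
      obtain ⟨-, z1, z2, z3⟩ := z2
    · have := y2 c (by omega) (by omega)
      have := y2 (c + r) (by omega) (by omega)
      rw [show c + r + a + r + 1 = c + (2 * r + a + 1) by ring] at z3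
      have := p2 (c + r + a) (by omega) (by omega)
      omega
    · rw [show c + r + 1 - r - 1 = c by ring] at y1
      have := y2 (c + r + 1) (by omega) (by omega)
      have := z2 (c + (2 * r + a + 1)) (by omega) (by omega)
      have := p2 (c + r + 1 + a) (by omega) (by omega)
      omega

set_option maxHeartbeats 1000000 in
theorem iff_near_A (h : TwoBlocks S r a b) (hr : 2 ≤ r) (c : ℤ) :
    S (c + (2 * r + a - 1)) - S c = a ↔ Run1 S (c + (r - 1)) a ∨ Run1 S (c + (r - 1) + 1) a := by
  have ha := h.ha
  have hab := h.hab
  have hr₁ := h.hr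
  constructor
  · intro hc
    obtain ⟨Q, Q₁, Q₂, Q₃, d₀, d₁, d₂, h1, h2, h3, h4, h5, e0, e1, e2, p0, p1, p2, cl, loc⟩ :=
      h.cover3 c
    generalize he : c + (2 * r + a - 1) = e at *
    replace loc := loc e (by omega)
    rcases e0 with e0 | e0 <;> rcases e1 with e1 | e1 <;> rcases e2 with e2 | e2 <;>
    · subst e0 e1 e2
      rcases cl with ⟨c1, c2⟩ | ⟨c1, c2⟩ <;>
      rcases loc with f1 | f1 | f1 | f1 | f1 | f1 | f1 <;>
      first
      | (exfalso; omega)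
      | (have hk : c + (r - 1) = Q + r := by omega
         rw [hk]; exact Or.inl p0)
      | (have hk : c + (r - 1) + 1 = Q + r := by omega
         rw [hk]; exact Or.inr p0)
  · rintro (hP | hP)
    all_goals
      have z1 := h.prev0 hP
      have z2 := h.next0 hP
      obtain ⟨-, p1, p2, p3⟩ := hP
      obtain ⟨-, y1, y2, y3⟩ := z1
      obtain ⟨-, z1, z2, z3⟩ := z2
    · have := y2 c (by omega) (by omega)
      have := y2 (c + (r - 1)) (by omega) (by omega)
      have := z2 (c + (2 * r + a - 1)) (by omega) (by omega)
      have := p2 (c + (r - 1) + a) (by omega) (by omega)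
      omega
    · have := y2 c (by omega) (by omega)
      have := y2 (c + (r - 1) + 1) (by omega) (by omega)
      have := z2 (c + (2 * r + a - 1)) (by omega) (by omega)
      have := p2 (c + (r - 1) + 1 + a) (by omega) (by omega)
      omega

end TwoBlocks

/-- If all zero runs have length at least `σ` and all one runs length at most `ℓ`, the potential
`(ℓ + σ) S x - ℓ x` grows by at most `σ ℓ`, with equality only along chains of runs of length `ℓ`
separated by zero runs of length `σ`. -/
theorem Good.chain_of_pot {S : ℤ → ℤ} (h : Good S) {σ ℓ : ℤ} (hσ : 1 ≤ σ) (hℓ : 1 ≤ ℓ)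
    (h0 : ∀ Q d, Run0 S Q d → σ ≤ d) (h1 : ∀ P d, Run1 S P d → d ≤ ℓ) (n : ℕ) :
    ∀ i j : ℤ, i ≤ j → j ≤ i + n → σ * ℓ ≤ (ℓ + σ) * (S j - S i) - ℓ * (j - i) →
      (ℓ + σ) * (S j - S i) - ℓ * (j - i) = σ * ℓ ∧
      ∃ k : ℕ, j = i + k * (ℓ + σ) + ℓ ∧ ∀ t : ℕ, t ≤ k → Run1 S (i + t * (ℓ + σ)) ℓ := by
  have hσℓ : 1 ≤ σ * ℓ := by nlinarith
  induction n with
  | zero =>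
    intro i j hij hij' hφ
    obtain rfl : j = i := by push_cast at hij'; omega
    simp at hφ
    omega
  | succ n ih =>
    intro i j hij hij' hφ
    push_cast at hij'
    have hlt : i < j := by
      rcases eq_or_lt_of_le hij with rfl | hlt
      · simp at hφ
        omega
      · exact hlt
    have hst := h.step (j - 1)
    rw [sub_add_cancel] at hst
    rcases hst with hst | hst
    · exfalso
      have := (ih i (j - 1) (by omega) (by omega) (by rw [← hst]; nlinarith)).1
      rw [← hst] at this
      nlinarith
    · obtain ⟨P, d, hP, hP1, hP2⟩ := h.cover1 (c := j - 1) (by rw [sub_add_cancel]; exact hst)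
      have hd := h1 _ _ hP
      obtain ⟨-, -, hPS, -⟩ := id hP
      have hj := hPS j (by omega) (by omega)
      rcases le_or_gt P i with hPi | hPi
      · have hi := hPS i (by omega) (by omega)
        have e : S j - S i = j - i := by omega
        rw [e] at hφ ⊢
        have : ℓ ≤ j - i := by nlinarith
        obtain rfl : P = i := by omega
        obtain rfl : d = ℓ := by omega
        obtain rfl : j = P + d := by omega
        refine ⟨by ring, 0, by simp, fun t ht => ?_⟩
        obtain rfl : t = 0 := by omega
        simpa using hP
      · obtain ⟨e, he⟩ := h.prev0 hP
        have heσ := h0 _ _ he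
        obtain ⟨-, -, hQ, -⟩ := he
        have hQP := hQ P (by omega) (by omega)
        rcases le_or_gt (P - e) i with hei | hei
        · exfalso
          have := hQ i hei (by omega)
          have e : S j - S i = j - P := by omega
          rw [e] at hφ
          nlinarith
        · have hQσ := hQ (P - σ) (by omega) (by omega)
          have e1 : S j = S (P - σ) + (j - P) := by omega
          have hjP : j - P ≤ ℓ := by omega
          rw [e1] at hφ ⊢
          obtain ⟨i1, k, i2, i3⟩ := ih i (P - σ) (by omega) (by omega) (by nlinarith)
          have : ℓ ≤ j - P := by nlinarith
          obtain rfl : d = ℓ := by omega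
          obtain rfl : j = P + d := by omega
          refine ⟨by nlinarith, k + 1, by push_cast; linarith, fun t ht => ?_⟩
          rcases Nat.lt_or_ge k t with htk | htk
          · obtain rfl : t = k + 1 := by omega
            convert hP using 1
            push_cast
            linarith
          · exact i3 t htk

theorem Good.run1_sep {S : ℤ → ℤ} (h : Good S) {P P' d d' : ℤ} {σ : ℤ}
    (h0 : ∀ Q d, Run0 S Q d → σ ≤ d) (h1 : Run1 S P d) (h2 : Run1 S P' d') (hlt : P < P') :
    P + d + σ ≤ P' := by
  have h3 := TwoBlocks.run1_sep h1 h2 hlt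
  obtain ⟨e, he⟩ := h.next0 h1
  have := h0 _ _ he
  obtain ⟨a1, a2, a3, a4⟩ := he
  obtain ⟨b1, b2, b3, b4⟩ := h2
  by_contra hcon
  have := a3 (P' + 1) (by omega) (by omega)
  have := a3 P' (by omega) (by omega)
  have := b3 (P' + 1) (by omega) (by omega)
  omega

theorem Run1.congr {S : ℤ → ℤ} {i j d n o : ℤ} (h : Run1 S (i + o) d)
    (ho : 1 ≤ o) (hn : o + d + 1 ≤ n)
    (hj : ∀ t, 0 ≤ t → t ≤ n → S (j + t) - S j = S (i + t) - S i) : Run1 S (j + o) d := by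
  obtain ⟨h1, h2, h3, h4⟩ := h
  have e := hj o (by omega) (by omega)
  refine ⟨h1, ?_, fun x hx hx' => ?_, ?_⟩
  · have := hj (o - 1) (by omega) (by omega)
    rw [show j + o - 1 = j + (o - 1) by ring]
    rw [show i + o - 1 = i + (o - 1) by ring] at h2
    omega
  · have e1 := hj (x - j) (by omega) (by omega)
    have e2 := h3 (i + (x - j)) (by omega) (by omega)
    rw [show j + (x - j) = x by ring] at e1
    omega
  · have := hj (o + d + 1) (by omega) (by omega)
    rw [show j + o + d + 1 = j + (o + d + 1) by ring]
    rw [show i + o + d + 1 = i + (o + d + 1) by ring] at h4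
    omega

/-- The pattern of a shifted window determines the runs inside it. -/
theorem Run1.congr_iff {S : ℤ → ℤ} {i j d n o : ℤ} (ho : 1 ≤ o) (hn : o + d + 1 ≤ n)
    (hj : ∀ t, 0 ≤ t → t ≤ n → S (j + t) - S j = S (i + t) - S i) :
    Run1 S (j + o) d ↔ Run1 S (i + o) d :=
  ⟨fun h => h.congr ho hn fun t ht ht' => (hj t ht ht').symm, fun h => h.congr ho hn hj⟩

/-- Chain beginnings recur to the left. -/
theorem Good.chainStart_left {S : ℤ → ℤ} (h : Good S) {ℓ e P : ℤ} (he : 1 ≤ e) (hP : Run1 S P ℓ)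
    (hP' : ¬ Run1 S (P - e) ℓ) (N : ℤ) : ∃ x, x ≤ N ∧ Run1 S x ℓ ∧ ¬ Run1 S (x - e) ℓ := by
  obtain ⟨j, hj, hj'⟩ := h.rec_left (P - e - 1) (e + 1 + ℓ + 1) (N - e - 1)
  have hℓ := hP.1
  refine ⟨j + (e + 1), by omega, ?_, ?_⟩
  · rw [Run1.congr_iff (by omega) (by omega) hj']
    convert hP using 1; ring
  · rw [show j + (e + 1) - e = j + 1 by ring, Run1.congr_iff (by omega) (by omega) hj']
    convert hP' using 2; ring

theorem chain_descend {S : ℤ → ℤ} (h : Good S) {σ ℓ : ℤ} (hσ : 1 ≤ σ) (hℓ : 1 ≤ ℓ)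
    (h0 : ∀ Q d, Run0 S Q d → σ ≤ d) {x : ℤ} (hx : Run1 S x ℓ) (n : ℕ) :
    ∀ c : ℤ, x ≤ c → c ≤ x + n → Run1 S c ℓ →
      (∀ y, x < y → y ≤ c → Run1 S y ℓ → Run1 S (y - (ℓ + σ)) ℓ) →
      ∃ k : ℕ, c = x + k * (ℓ + σ) ∧ ∀ t : ℕ, t ≤ k → Run1 S (x + t * (ℓ + σ)) ℓ := by
  induction n with
  | zero =>
    intro c h1 h2 h3 h4
    obtain rfl : c = x := by push_cast at h2; omega
    refine ⟨0, by simp, fun t ht => ?_⟩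
    obtain rfl : t = 0 := by omega
    simpa using hx
  | succ n ih =>
    intro c h1 h2 h3 h4
    push_cast at h2
    rcases eq_or_lt_of_le h1 with rfl | h5
    · exact ih x le_rfl (by omega) h3 fun y hy hy' => by omega
    · have h6 := h4 c h5 le_rfl h3
      have h7 := h.run1_sep h0 hx h3 h5
      obtain ⟨k, hk, hk'⟩ := ih (c - (ℓ + σ)) (by omega) (by omega) h6 fun y hy hy' =>
        h4 y hy (by omega)
      refine ⟨k + 1, by push_cast; linarith, fun t ht => ?_⟩
      rcases Nat.lt_or_ge k t with htk | htk
      · obtain rfl : t = k + 1 := by omega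
        convert h3 using 1
        push_cast
        linarith
      · exact hk' t htk

/-- The maximal chains cannot all have the same length and be followed by the same gap. -/
theorem Good.chain_contra {S : ℤ → ℤ} (h : Good S) {σ ℓ G s P₀ : ℤ} {k : ℕ} (hσ : 1 ≤ σ)
    (hℓ : 1 ≤ ℓ) (h0 : ∀ Q d, Run0 S Q d → σ ≤ d) (h1 : ∀ P d, Run1 S P d → d ≤ ℓ)
    (hP₀ : Run1 S P₀ ℓ) (hP₀' : ¬ Run1 S (P₀ - (ℓ + σ)) ℓ)
    (hk : ∀ P, Run1 S P ℓ → ¬ Run1 S (P - (ℓ + σ)) ℓ →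
      (∀ t : ℕ, t ≤ k → Run1 S (P + t * (ℓ + σ)) ℓ) ∧ ¬ Run1 S (P + (k + 1 : ℕ) * (ℓ + σ)) ℓ)
    (hG : ∀ P P', Consec (fun P => Run1 S P ℓ) P P' → P' ≠ P + (ℓ + σ) →
      P' - P = G ∧ S P' - S P = s) : False := by
  have hweight : ∀ (n : ℕ) c, (∀ t : ℕ, t ≤ n → Run1 S (c + t * (ℓ + σ)) ℓ) →
      S (c + (n * (ℓ + σ) + ℓ)) - S c = (n + 1) * ℓ := by
    intro n
    induction n with
    | zero =>
      intro c hc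
      have := (hc 0 le_rfl).2.2.1 (c + ℓ) (by push_cast; omega) (by push_cast; omega)
      simp at this ⊢
      omega
    | succ n ih =>
      intro c hc
      have e1 := ih c fun t ht => hc t (by omega)
      have hr := hc (n + 1) le_rfl
      obtain ⟨e, he⟩ := h.prev0 hr
      have heσ := h0 _ _ he
      have hz := he.2.2.1 (c + (n + 1 : ℕ) * (ℓ + σ)) (by omega) (by omega)
      have hz' := he.2.2.1 (c + (n + 1 : ℕ) * (ℓ + σ) - σ) (by omega) (by omega)
      have := hr.2.2.1 (c + (n + 1 : ℕ) * (ℓ + σ) + ℓ) (by omega) le_rfl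
      have e2 : c + (n + 1 : ℕ) * (ℓ + σ) - σ = c + (n * (ℓ + σ) + ℓ) := by push_cast; ring
      rw [e2] at hz'
      rw [← add_assoc]
      push_cast at *
      linarith
  have hcl : ∀ c, S (c + (k * (ℓ + σ) + ℓ)) - S c = (k + 1) * ℓ ↔
      Run1 S c ℓ ∧ ¬ Run1 S (c - (ℓ + σ)) ℓ := by
    intro c
    constructor
    · intro hc
      have hkn : 0 ≤ k * (ℓ + σ) := by positivity
      obtain ⟨-, k', hk1, hk2⟩ := h.chain_of_pot hσ hℓ h0 h1 (k * (ℓ + σ) + ℓ).toNat c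
        (c + (k * (ℓ + σ) + ℓ)) (by omega) (by omega) (by rw [hc]; apply le_of_eq; ring)
      have hkk : k' = k := by
        have e : (k : ℤ) * (ℓ + σ) = k' * (ℓ + σ) := by linarith
        have := mul_right_cancel₀ (by omega) e
        omega
      subst hkk
      have hc0 : Run1 S c ℓ := by simpa using hk2 0 (by omega)
      refine ⟨hc0, fun hbad => ?_⟩
      obtain ⟨x₀, hx₀, hx₀'⟩ := h.chainStart_left (by omega) hP₀ hP₀' c
      obtain ⟨x, hx1, hx2, hx3, hx4⟩ :=
        int_greatest (p := fun x => Run1 S x ℓ ∧ ¬ Run1 S (x - (ℓ + σ)) ℓ) hx₀ hx₀'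
      obtain ⟨n, hn1, hn2⟩ := chain_descend h hσ hℓ h0 hx3.1 (c - x).toNat c (by omega) (by omega)
        hc0 fun y hy hy' hyr => by
          by_contra hcon
          exact hx4 y hy' hy ⟨hyr, hcon⟩
      refine (hk x hx3.1 hx3.2).2 ?_
      rcases Nat.lt_or_ge n (k' + 1) with hnk | hnk
      · rcases Nat.eq_zero_or_pos n with rfl | hn
        · simp at hn1
          subst hn1
          exact absurd hbad hx3.2
        · convert hk2 (k' + 1 - n) (by omega) using 1
          rw [hn1, Nat.cast_sub (by omega)]
          ring
      · exact hn2 _ hnk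
    · rintro ⟨hc1, hc2⟩
      exact hweight k c (hk c hc1 hc2).1
  have hkn : 0 ≤ k * (ℓ + σ) := by positivity
  refine h.one (k * (ℓ + σ) + ℓ) ((k + 1) * ℓ) P₀ (k * (ℓ + σ) + G) (k * ℓ + s) (by omega)
    ((hcl _).2 ⟨hP₀, hP₀'⟩) ?_
  rintro l' s' ⟨c, c', ⟨h2, h3, h4, h5⟩, rfl, rfl⟩
  have hw := h3
  rw [hcl] at h3 h4
  obtain ⟨hc1, hc2⟩ := hk c h3.1 h3.2
  have hPk := hc1 k le_rfl
  have hlt : c + k * (ℓ + σ) < c' := by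
    by_contra hcon
    have e1 := Int.mul_ediv_add_emod (c' - c) (ℓ + σ)
    have e2 := Int.emod_nonneg (c' - c) (b := ℓ + σ) (by omega)
    have e3 := Int.emod_lt_of_pos (c' - c) (b := ℓ + σ) (by omega)
    generalize (c' - c) / (ℓ + σ) = q at *
    generalize (c' - c) % (ℓ + σ) = m at *
    have hq0 : 0 ≤ q := by nlinarith
    have hqk : q ≤ k := by nlinarith
    obtain ⟨q, rfl⟩ := Int.eq_ofNat_of_zero_le hq0
    have hq := hc1 q (by omega)
    rcases eq_or_lt_of_le e2 with e4 | e4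
    · rcases Nat.eq_zero_or_pos q with rfl | hqp
      · simp at e1
        omega
      · apply h4.2
        convert hc1 (q - 1) (by omega) using 1
        rw [Nat.cast_sub (by omega)]
        push_cast
        linarith
    · have := h.run1_sep h0 hq h4.1 (by linarith)
      linarith
  obtain ⟨P', g1, g2, g3, g4⟩ := int_least (p := fun x => Run1 S x ℓ)
    (b := c + k * (ℓ + σ) + 1) (by omega) h4.1
  have hcons : Consec (fun P => Run1 S P ℓ) (c + k * (ℓ + σ)) P' :=
    ⟨by omega, hPk, g3, fun y hy hy' => g4 y (by omega) hy'⟩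
  have hne : P' ≠ c + k * (ℓ + σ) + (ℓ + σ) := by
    rintro rfl
    apply hc2
    convert g3 using 1
    push_cast
    ring
  have hsep := h.run1_sep h0 hPk g3 (by omega)
  have hP' : P' = c' := by
    by_contra hcon
    refine h5 P' (by omega) (by omega) ((hcl _).2 ⟨g3, fun hb => ?_⟩)
    exact g4 _ (by omega) (by omega) hb
  subst hP'
  obtain ⟨q1, q2⟩ := hG _ _ hcons hne
  refine ⟨by omega, ?_⟩
  have e1 := hPk.2.2.1 (c + k * (ℓ + σ) + ℓ) (by omega) le_rfl
  rw [← add_assoc] at hw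
  linarith

theorem Run1.unique {S : ℤ → ℤ} {P d d' : ℤ} (h : Run1 S P d) (h' : Run1 S P d') : d = d' := by
  obtain ⟨h1, h2, h3, h4⟩ := h
  obtain ⟨g1, g2, g3, g4⟩ := h'
  rcases lt_trichotomy d d' with hlt | rfl | hlt
  · have := g3 (P + d + 1) (by omega) (by omega)
    omega
  · rfl
  · have := h3 (P + d' + 1) (by omega) (by omega)
    omega

theorem Good.run1_right {S : ℤ → ℤ} (h : Good S) {P d : ℤ} (hP : Run1 S P d) (N : ℤ) :
    ∃ x, N ≤ x ∧ Run1 S x d := by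
  obtain ⟨j, hj, hj'⟩ := h.rec_right (P - 1) (d + 2) N
  have := hP.1
  refine ⟨j + 1, by omega, ?_⟩
  rw [Run1.congr_iff (by omega) (by omega) hj']
  simpa using hP

theorem Good.run1_left {S : ℤ → ℤ} (h : Good S) {P d : ℤ} (hP : Run1 S P d) (N : ℤ) :
    ∃ x, x ≤ N ∧ Run1 S x d := by
  obtain ⟨j, hj, hj'⟩ := h.rec_left (P - 1) (d + 2) (N - 1)
  have := hP.1
  refine ⟨j + 1, by omega, ?_⟩
  rw [Run1.congr_iff (by omega) (by omega) hj']
  simpa using hP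

namespace TwoBlocks

variable {S : ℤ → ℤ} {r a b : ℤ}

theorem consec_add (h : TwoBlocks S r a b) {P d : ℤ} (hP : Run1 S P d)
    (hP' : Run1 S (P + d + r) d) : Consec (fun P => Run1 S P d) P (P + (d + r)) := by
  rw [add_assoc] at hP'
  have := hP.1
  have := h.hr
  refine ⟨by omega, hP, hP', fun x hx hx' hxr => ?_⟩
  have := h.sep hP hxr hx
  omega

theorem fill (h : TwoBlocks S r a b) {X : ℤ} (hX : Run1 S X a) (n : ℕ) :
    ∀ Z d : ℤ, Z ≤ X → X ≤ Z + n → Run1 S Z d → (∀ x, Z ≤ x → x < X → ¬ Run1 S x a) →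
      ∃ k : ℕ, X = Z + k * (b + r) ∧ ∀ t : ℕ, t < k → Run1 S (Z + t * (b + r)) b := by
  have hr := h.hr
  have ha := h.ha
  have hab := h.hab
  induction n with
  | zero =>
    intro Z d h1 h2 h3 h4
    exact ⟨0, by push_cast at *; omega, fun t ht => by omega⟩
  | succ n ih =>
    intro Z d h1 h2 h3 h4
    rcases eq_or_lt_of_le h1 with rfl | h5
    · exact ⟨0, by simp, fun t ht => by omega⟩
    · push_cast at h2
      rcases h.ones _ _ h3 with rfl | rfl
      · exact absurd h3 (h4 _ le_rfl h5)
      obtain ⟨e, he, hZ'⟩ := h.next1 (h.next0 h3)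
      obtain ⟨k, hk1, hk2⟩ := ih _ e (h.sep h3 hX h5) (by omega) hZ' fun x hx hx' =>
        h4 x (by omega) hx'
      refine ⟨k + 1, by push_cast; linarith, fun t ht => ?_⟩
      rcases Nat.eq_zero_or_pos t with rfl | ht0
      · simpa using h3
      · convert hk2 (t - 1) (by omega) using 1
        rw [Nat.cast_sub (by omega)]
        push_cast
        ring

theorem gapB_unique (h : TwoBlocks S r a b) (hrb : 2 ≤ r ∨ a + 2 ≤ b) {i j i' j' : ℤ}
    (h1 : Consec (fun P => Run1 S P b) i j) (h2 : Consec (fun P => Run1 S P b) i' j')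
    (hij : j ≠ i + (b + r)) (hij' : j' ≠ i' + (b + r)) :
    j - i = j' - i' ∧ S j - S i = S j' - S i' := by
  have hr := h.hr
  have ha := h.ha
  have hab := h.hab
  obtain ⟨P, hP, hP'⟩ := h.exists_adjacentB hrb
  have hsep (e : ℤ) : ∀ i j, Run1 S i b → Run1 S j b → i < j →
      i + 2 ≤ j ∧ (j = i + 2 → S j - S i ≠ 2 * e) := fun i j hi hj hij => by
    have := h.sep hi hj hij
    omega
  by_cases hr2 : 2 ≤ r
  · refine h.good.gap_unique (e := 0) (κ := 0) (by omega) (h.iff_near_B hr2) (fun i hi => ?_)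
      (fun i hi => by simp) (hsep 0) (h.consec_add hP hP') h1 h2 hij hij'
    have := hi.2.1
    simp only [sub_zero]
    omega
  · refine h.good.gap_unique (e := 1) (κ := 1) (by omega) (h.iff_near_B_of_gap (by omega))
      (fun i hi => ?_) (fun i hi => ?_) (hsep 1) (h.consec_add hP hP') h1 h2 hij hij'
    · have := hi.2.2.1 (i - -1) (by omega) (by omega)
      rw [show i - -1 - 1 = i by ring]
      omega
    · have := hi.2.2.1 (i - -1) (by omega) (by omega)
      omega

theorem gapA_unique (h : TwoBlocks S r a b) (hrb : 2 ≤ r ∨ a + 2 ≤ b) {i j i' j' : ℤ}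
    (h1 : Consec (fun P => Run1 S P a) i j) (h2 : Consec (fun P => Run1 S P a) i' j')
    (hij : j ≠ i + (a + r)) (hij' : j' ≠ i' + (a + r)) :
    j - i = j' - i' ∧ S j - S i = S j' - S i' := by
  have hr := h.hr
  have ha := h.ha
  have hab := h.hab
  obtain ⟨P, hP, hP'⟩ := h.exists_adjacentA hrb
  by_cases hr2 : 2 ≤ r
  · have hsep : ∀ i j, Run1 S i a → Run1 S j a → i < j →
        i + 2 ≤ j ∧ (j = i + 2 → S j - S i ≠ 2 * 0) := fun i j hi hj hij => by
      have := h.sep hi hj hij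
      omega
    refine h.good.gap_unique (e := 0) (κ := 0) (by omega) (h.iff_near_A hr2) (fun i hi => ?_)
      (fun i hi => ?_) hsep (h.consec_add hP hP') h1 h2 hij hij'
    all_goals
      have z := (h.prev0 hi).2.2.1
      have := z i (by omega) (by omega)
      have := z (i - (r - 1)) (by omega) (by omega)
      have := z (i - (r - 1) - 1) (by omega) (by omega)
      omega
  · obtain rfl : r = 1 := by omega
    refine h.good.gap_unique (e := 1) (κ := 0) (by omega) (h.iff_near_A_of_gap rfl (by omega))
      (fun i hi => ?_) (fun i hi => ?_) (fun i j hi hj hij => ?_) (h.consec_add hP hP') h1 h2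
      hij hij'
    · have z := h.prev0 hi
      have := z.2.1
      have := z.2.2.1 (i - 1) (by omega) (by omega)
      omega
    · have z := h.prev0 hi
      have := z.2.2.1 i (by omega) (by omega)
      omega
    · have := h.sep hi hj hij
      refine ⟨by omega, ?_⟩
      rintro rfl
      obtain rfl : a = 1 := by omega
      have := (h.next0 hi).2.2.1 (i + 2) (by omega) (by omega)
      have := hi.2.2.1 (i + 1) (by omega) (by omega)
      omega

/-- Two block lengths that are not Sturmian-like cannot occur. -/
theorem contra (h : TwoBlocks S r a b) (hrb : 2 ≤ r ∨ a + 2 ≤ b) : False := by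
  have hr := h.hr
  have ha := h.ha
  have hab := h.hab
  obtain ⟨X, hX⟩ := h.exa
  have key : ∀ P, Run1 S P b → ¬ Run1 S (P - (b + r)) b → ∃ k : ℕ, 1 ≤ k ∧
      (∀ t : ℕ, t < k → Run1 S (P + t * (b + r)) b) ∧
      Consec (fun P => Run1 S P a) (P - r - a) (P + k * (b + r)) := by
    intro P hP hP'
    obtain ⟨d, hd, hQ⟩ := h.prev1 (h.prev0 hP)
    obtain rfl : d = a := by
      rcases hd with rfl | rfl
      · rfl
      · exact absurd (by convert hQ using 1; ring) hP'
    obtain ⟨x, hx, hxX⟩ := h.good.run1_right hX P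
    obtain ⟨x, h1, -, h2, h3⟩ := int_least (p := fun x => Run1 S x d) hx hxX
    obtain ⟨k, hk, hk'⟩ := h.fill h2 (x - P).toNat P b h1 (by omega) hP h3
    refine ⟨k, ?_, hk', by omega, hQ, hk ▸ h2, fun y hy hy' hya => ?_⟩
    · by_contra hk0
      obtain rfl : k = 0 := by omega
      simp at hk
      subst hk
      have := h2.unique hP
      omega
    · have := h.sep hQ hya hy
      exact h3 y (by omega) (by omega) hya
  obtain ⟨Y, hY⟩ := h.exb
  obtain ⟨P₀, hP₀, hP₀'⟩ : ∃ P, Run1 S P b ∧ ¬ Run1 S (P - (b + r)) b := by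
    by_contra hcon
    push Not at hcon
    obtain ⟨x, hx, hxX⟩ := h.good.run1_left hX Y
    have hall : ∀ n : ℕ, Run1 S (Y - n * (b + r)) b := by
      intro n
      induction n with
      | zero => simpa using hY
      | succ n ih =>
        convert hcon _ ih using 1
        push_cast
        ring
    obtain ⟨y, h1, h2, h3, h4⟩ := int_least (p := fun y => Run1 S y b) (b := x) hx hY
    have h5 := hcon y h3
    rcases eq_or_lt_of_le h1 with rfl | h6
    · have := hxX.unique h3
      omega
    · have := h.sep hxX h3 h6
      refine h4 _ ?_ (by omega) h5
      by_contra hlt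
      have := h.sep h5 hxX (by omega)
      omega
  obtain ⟨K, hK, hK1, hK2⟩ := key P₀ hP₀ hP₀'
  have hh : 0 < b + r := by omega
  have hne : ∀ P, ∀ k : ℕ, 1 ≤ k → P + k * (b + r) ≠ P - r - a + (a + r) := by
    intro P k hk h
    have : (1 : ℤ) ≤ k := by exact_mod_cast hk
    nlinarith
  have hk : ∀ P, Run1 S P b → ¬ Run1 S (P - (b + r)) b →
      (∀ t : ℕ, t ≤ K - 1 → Run1 S (P + t * (b + r)) b) ∧
        ¬ Run1 S (P + (K - 1 + 1 : ℕ) * (b + r)) b := by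
    intro P hP hP'
    obtain ⟨k, hk, hk1, hk2⟩ := key P hP hP'
    have e := (h.gapA_unique hrb hK2 hk2 (hne _ _ hK) (hne _ _ hk)).1
    have e' : (K : ℤ) * (b + r) = k * (b + r) := by linarith
    have e'' := mul_right_cancel₀ hh.ne' e'
    obtain rfl : K = k := by omega
    refine ⟨fun t ht => hk1 t (by omega), fun hb => ?_⟩
    rw [Nat.sub_add_cancel hk] at hb
    have := hb.unique hk2.2.2.1
    omega
  by_cases hex : ∃ P P', Consec (fun P => Run1 S P b) P P' ∧ P' ≠ P + (b + r)
  · obtain ⟨Q, Q', hQ, hQ'⟩ := hex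
    exact h.good.chain_contra hr (by omega) (fun Q d hQ => (h.zero Q d hQ).ge)
      (fun P d hP => by have := h.ones P d hP; omega) hP₀ hP₀' hk
      fun P P' hP hP' => h.gapB_unique hrb hP hQ hP' hQ'
  · push Not at hex
    exact h.good.chain_contra (G := 0) (s := 0) hr (by omega) (fun Q d hQ => (h.zero Q d hQ).ge)
      (fun P d hP => by have := h.ones P d hP; omega) hP₀ hP₀' hk
      fun P P' hP hP' => absurd (hex P P' hP) hP'

end TwoBlocks

/-- All zero runs have length `σ` or `2σ`, all one runs length `τ` or `2τ`, where `σ, τ ≤ 2`. -/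
structure FourRuns (S : ℤ → ℤ) (σ τ : ℤ) : Prop where
  good : Good S
  hσ : σ = 1 ∨ σ = 2
  hτ : τ = 1 ∨ τ = 2
  zeros : ∀ Q d, Run0 S Q d → d = σ ∨ d = 2 * σ
  ones : ∀ P d, Run1 S P d → d = τ ∨ d = 2 * τ
  exσ : ∃ Q, Run0 S Q σ
  exσσ : ∃ Q, Run0 S Q (2 * σ)
  exτ : ∃ P, Run1 S P τ
  exττ : ∃ P, Run1 S P (2 * τ)

namespace FourRuns

variable {S : ℤ → ℤ} {σ τ : ℤ}

theorem toCpl (h : FourRuns S σ τ) : FourRuns (cpl S) τ σ where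
  good := h.good.toCpl
  hσ := h.hτ
  hτ := h.hσ
  zeros Q d hQ := h.ones Q d (run0_cpl.1 hQ)
  ones Q d hQ := h.zeros Q d (run1_cpl.1 hQ)
  exσ := h.exτ.imp fun _ => run0_cpl.2
  exσσ := h.exττ.imp fun _ => run0_cpl.2
  exτ := h.exσ.imp fun _ => run1_cpl.2
  exττ := h.exσσ.imp fun _ => run1_cpl.2

theorem next0 (h : FourRuns S σ τ) {P d : ℤ} (hP : Run1 S P d) :
    Run0 S (P + d) σ ∨ Run0 S (P + d) (2 * σ) := by
  obtain ⟨e, he⟩ := h.good.next0 hP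
  rcases h.zeros _ _ he with rfl | rfl <;> simp [he]

theorem next1 (h : FourRuns S σ τ) {P d : ℤ} (hP : Run0 S P d) :
    Run1 S (P + d) τ ∨ Run1 S (P + d) (2 * τ) := by
  obtain ⟨e, he⟩ := h.good.next1 hP
  rcases h.ones _ _ he with rfl | rfl <;> simp [he]

theorem prev0 (h : FourRuns S σ τ) {P d : ℤ} (hP : Run1 S P d) :
    Run0 S (P - σ) σ ∨ Run0 S (P - 2 * σ) (2 * σ) := by
  obtain ⟨e, he⟩ := h.good.prev0 hP
  rcases h.zeros _ _ he with rfl | rfl <;> simp [he]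

theorem prev1 (h : FourRuns S σ τ) {P d : ℤ} (hP : Run0 S P d) :
    Run1 S (P - τ) τ ∨ Run1 S (P - 2 * τ) (2 * τ) := by
  obtain ⟨e, he⟩ := h.good.prev1 hP
  rcases h.ones _ _ he with rfl | rfl <;> simp [he]

/-- At least `σ` zeros follow a run of ones. -/
theorem zeros_after (h : FourRuns S σ τ) {P d : ℤ} (hP : Run1 S P d) {x : ℤ} (hx : P + d ≤ x)
    (hx' : x ≤ P + d + σ) : S x = S P + d := by
  have hd := hP.1
  have := h.hσ
  have e := hP.2.2.1 (P + d) (by omega) (by omega)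
  rcases h.next0 hP with h0 | h0 <;>
  · have := h0.2.2.1 x (by omega) (by omega)
    omega

theorem zeros_before (h : FourRuns S σ τ) {P d : ℤ} (hP : Run1 S P d) {x : ℤ} (hx : P - σ ≤ x)
    (hx' : x ≤ P) : S x = S P := by
  have := h.hσ
  rcases h.prev0 hP with h0 | h0 <;>
  · have := h0.2.2.1 x (by omega) (by omega)
    have := h0.2.2.1 P (by omega) (by omega)
    omega

theorem ones_after (h : FourRuns S σ τ) {Q d : ℤ} (hQ : Run0 S Q d) {x : ℤ} (hx : Q + d ≤ x)
    (hx' : x ≤ Q + d + τ) : S x = S Q + (x - Q - d) := by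
  have := h.toCpl.zeros_after (run1_cpl.2 hQ) hx hx'
  simp only [cpl] at this
  omega

theorem ones_before (h : FourRuns S σ τ) {Q d : ℤ} (hQ : Run0 S Q d) {x : ℤ} (hx : Q - τ ≤ x)
    (hx' : x ≤ Q) : S x = S Q + (x - Q) := by
  have := h.toCpl.zeros_before (run1_cpl.2 hQ) hx hx'
  simp only [cpl] at this
  omega

theorem mem_of_ones (h : FourRuns S σ τ) {P x : ℤ} (hP : Run1 S P (2 * τ)) (hx : P - σ ≤ x)
    (hx' : x ≤ P) : S (x + (2 * τ + σ)) - S x = 2 * τ := by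
  rw [h.zeros_before hP hx hx', h.zeros_after hP (by omega) (by omega)]
  ring

theorem mem_of_zeros (h : FourRuns S σ τ) {Q : ℤ} (hQ : Run0 S Q σ) :
    S (Q - τ + (2 * τ + σ)) - S (Q - τ) = 2 * τ := by
  have := h.hτ
  rw [h.ones_before hQ le_rfl (by omega), h.ones_after hQ (by omega) (by omega)]
  ring

theorem not_mem_zeros (h : FourRuns S σ τ) {Q x : ℤ} (hQ : Run0 S Q (2 * σ)) (hx : Q - 2 * τ < x)
    (hx' : x < Q + σ) : S (x + (2 * τ + σ)) - S x ≠ 2 * τ := by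
  have hσ := h.hσ
  have hτ := h.hτ
  obtain ⟨-, -, h2, -⟩ := hQ
  rcases le_or_gt (x + (2 * τ + σ)) (Q + 2 * σ) with h1 | h1
  · rcases le_or_gt Q x with h3 | h3
    · have := h2 (x + (2 * τ + σ)) (by omega) h1
      have := h2 x (by omega) (by omega)
      omega
    · have := h2 (x + (2 * τ + σ)) (by omega) h1
      have := (h.good.mono h3.le).2
      omega
  · have := h2 (Q + 2 * σ) (by omega) (by omega)
    have := (h.good.mono h1.le).2
    rcases le_or_gt Q x with h3 | h3
    · have := h2 x (by omega) (by omega)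
      omega
    · have := (h.good.mono h3.le).2
      omega

theorem not_mem_ones (h : FourRuns S σ τ) {P x : ℤ} (hP : Run1 S P τ) (hx : P - σ - τ < x)
    (hx' : x < P) : S (x + (2 * τ + σ)) - S x ≠ 2 * τ := by
  have hσ := h.hσ
  have hτ := h.hτ
  have h1 : S P ≤ S x + (P - σ - x) ∨ S x = S P := by
    rcases le_or_gt (P - σ) x with h3 | h3
    · exact Or.inr (h.zeros_before hP h3 hx'.le)
    · have := (h.good.mono h3.le).2
      have := h.zeros_before hP le_rfl (by omega)
      omega
  rcases le_or_gt (x + (2 * τ + σ)) (P + τ + σ) with h3 | h3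
  · have := h.zeros_after hP (by omega) h3
    omega
  · have := h.zeros_after hP (x := P + τ + σ) (by omega) (by omega)
    have := (h.good.mono h3.le).2
    omega

theorem ret10 (h : FourRuns S σ τ) : RetPair S (2 * τ + σ) (2 * τ) 1 0 := by
  obtain ⟨P, hP⟩ := h.exττ
  have hσ := h.hσ
  refine ⟨P - 1, P, ⟨by omega, h.mem_of_ones hP (by omega) (by omega),
    h.mem_of_ones hP (by omega) (by omega), fun k _ _ => by omega⟩, by omega, ?_⟩
  rw [h.zeros_before hP (x := P - 1) (by omega) (by omega)]
  ring

theorem ret11 (h : FourRuns S σ τ) {Q : ℤ} (hQ : Run0 S Q σ)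
    (hQ' : Run1 S (Q + σ) (2 * τ) ∨ Run1 S (Q - 2 * τ) (2 * τ)) :
    RetPair S (2 * τ + σ) (2 * τ) 1 1 := by
  have hσ := h.hσ
  have hτ := h.hτ
  have e1 := h.mem_of_zeros hQ
  have e4 := hQ.2.2.1 (Q + σ) (by omega) le_rfl
  have e5 := h.ones_before hQ (x := Q - τ) (by omega) (by omega)
  rcases hQ' with h1 | h1
  · have e2 := h1.2.2.1 (Q - τ + 1 + (2 * τ + σ)) (by omega) (by omega)
    have e3 := h.ones_before hQ (x := Q - τ + 1) (by omega) (by omega)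
    exact ⟨Q - τ, Q - τ + 1, ⟨by omega, e1, by omega, fun k _ _ => by omega⟩, by omega, by omega⟩
  · have e6 := h1.2.2.1 Q (by omega) (by omega)
    have e2 := h1.2.2.1 (Q - τ - 1) (by omega) (by omega)
    have e3 := h.ones_after hQ (x := Q - τ - 1 + (2 * τ + σ)) (by omega) (by omega)
    exact ⟨Q - τ - 1, Q - τ, ⟨by omega, by omega, e1, fun k _ _ => by omega⟩, by omega, by omega⟩

/-- The maximal stretch of runs `0^{2σ}` and `1^τ` starting with a given run `0^{2σ}`. -/
theorem stretch (h : FourRuns S σ τ) {X : ℤ} (hX : Run1 S X (2 * τ)) (n : ℕ) :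
    ∀ Q, Q ≤ X → X ≤ Q + n → Run0 S Q (2 * σ) →
      ∃ m : ℕ, (∀ t : ℕ, t ≤ m → Run0 S (Q + t * (2 * σ + τ)) (2 * σ)) ∧
        (∀ x, Q - 2 * τ < x → x < Q + m * (2 * σ + τ) + σ →
          S (x + (2 * τ + σ)) - S x ≠ 2 * τ) ∧
        (S (Q + m * (2 * σ + τ) + 2 * σ) = S Q + m * τ) ∧
        (∀ x, Q ≤ x → x < Q + m * (2 * σ + τ) + 2 * σ → ¬ Run1 S x (2 * τ)) ∧
        (Run1 S (Q + m * (2 * σ + τ) + 2 * σ) (2 * τ) ∨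
          Run1 S (Q + m * (2 * σ + τ) + 2 * σ) τ ∧
            Run0 S (Q + m * (2 * σ + τ) + (2 * σ + τ)) σ) := by
  have hσ := h.hσ
  have hτ := h.hτ
  have hno : ∀ Q, Run0 S Q (2 * σ) → ∀ x, Q ≤ x → x < Q + 2 * σ → ¬ Run1 S x (2 * τ) := by
    intro Q hQ x hx hx' hxr
    have := hQ.2.2.1 x (by omega) (by omega)
    have := hQ.2.2.1 (x + 1) (by omega) (by omega)
    have := hxr.2.2.1 (x + 1) (by omega) (by omega)
    omega
  have hbase : ∀ Q, Run0 S Q (2 * σ) → S (Q + 2 * σ) = S Q := fun Q hQ =>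
    hQ.2.2.1 _ (by omega) le_rfl
  induction n with
  | zero =>
    intro Q h1 h2 hQ
    obtain rfl : X = Q := by push_cast at h2; omega
    exact absurd hX (hno X hQ X le_rfl (by omega))
  | succ n ih =>
    intro Q h1 h2 hQ
    push_cast at h2
    rcases h.next1 hQ with h3 | h3
    · rcases h.next0 h3 with h4 | h4
      · refine ⟨0, fun t ht => ?_, fun x hx hx' => ?_, ?_, fun x hx hx' => ?_, Or.inr ⟨?_, ?_⟩⟩
        · obtain rfl : t = 0 := by omega
          simpa using hQ
        · exact h.not_mem_zeros hQ hx (by simpa using hx')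
        · simpa using hbase Q hQ
        · exact hno Q hQ x hx (by simpa using hx')
        · simpa using h3
        · simpa [add_assoc] using h4
      · have hle : Q + (2 * σ + τ) ≤ X := by
          by_contra hcon
          have h5 : Q + 2 * σ ≤ X := by
            by_contra hcon
            exact hno Q hQ X h1 (by omega) hX
          rcases eq_or_lt_of_le h5 with h6 | h6
          · rw [h6] at h3
            have := h3.unique hX
            omega
          · have := TwoBlocks.run1_sep h3 hX h6
            omega
        rw [add_assoc] at h4
        obtain ⟨m, m1, m2, m3, m4, m5⟩ := ih (Q + (2 * σ + τ)) hle (by omega) h4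
        have e : ∀ a : ℤ, Q + (2 * σ + τ) + m * (2 * σ + τ) + a =
            Q + (m + 1 : ℕ) * (2 * σ + τ) + a := fun a => by push_cast; ring
        rw [e] at m3 m5
        rw [e] at m5
        have hS : S (Q + (2 * σ + τ)) = S Q + τ := by
          have := h.ones_after hQ (x := Q + (2 * σ + τ)) (by omega) (by omega)
          omega
        refine ⟨m + 1, fun t ht => ?_, fun x hx hx' => ?_, ?_, fun x hx hx' => ?_, m5⟩
        · rcases Nat.eq_zero_or_pos t with rfl | ht0
          · simpa using hQ
          · convert m1 (t - 1) (by omega) using 1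
            rw [Nat.cast_sub (by omega)]
            push_cast
            ring
        · rcases lt_or_ge x (Q + σ) with hxa | hxa
          · exact h.not_mem_zeros hQ hx hxa
          rcases lt_or_ge x (Q + 2 * σ) with hxb | hxb
          · exact h.not_mem_ones h3 (by omega) hxb
          · exact m2 x (by omega) (by rw [e]; exact hx')
        · rw [m3, hS]
          push_cast
          ring
        · rcases lt_or_ge x (Q + 2 * σ) with hxb | hxb
          · exact hno Q hQ x hx hxb
          rcases lt_or_ge x (Q + (2 * σ + τ)) with hxa | hxa
          · intro hxr
            rcases eq_or_lt_of_le hxb with h6 | h6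
            · rw [← h6] at hxr
              have := h3.unique hxr
              omega
            · have := TwoBlocks.run1_sep h3 hxr h6
              omega
          · exact m4 x hxa (by rw [e]; exact hx')
    · refine ⟨0, fun t ht => ?_, fun x hx hx' => ?_, ?_, fun x hx hx' => ?_, Or.inl ?_⟩
      · obtain rfl : t = 0 := by omega
        simpa using hQ
      · exact h.not_mem_zeros hQ hx (by simpa using hx')
      · simpa using hbase Q hQ
      · exact hno Q hQ x hx (by simpa using hx')
      · simpa using h3


theorem sep (h : FourRuns S σ τ) {P P' d d' : ℤ} (h1 : Run1 S P d) (h2 : Run1 S P' d')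
    (hlt : P < P') : P + d + σ ≤ P' := by
  have hσ := h.hσ
  refine h.good.run1_sep (fun Q e hQ => ?_) h1 h2 hlt
  have := h.zeros _ _ hQ
  omega

theorem sep_of_ne (h : FourRuns S σ τ) {P P' d d' : ℤ} (h1 : Run1 S P d) (h2 : Run1 S P' d')
    (hne : d ≠ d') (hle : P ≤ P') : P + d + σ ≤ P' := by
  rcases eq_or_lt_of_le hle with rfl | hlt
  · exact absurd (h1.unique h2) hne
  · exact h.sep h1 h2 hlt

/-- Jump over a single run `1^τ`. -/
theorem ret_single (h : FourRuns S σ τ) {P : ℤ} (h1 : Run0 S (P - σ) σ) (h2 : Run1 S P τ)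
    (h3 : Run0 S (P + τ) σ) : RetPair S (2 * τ + σ) (2 * τ) (σ + τ) τ := by
  have hσ := h.hσ
  have hτ := h.hτ
  refine ⟨P - σ - τ, P, ⟨by omega, h.mem_of_zeros h1, ?_, fun x hx hx' => h.not_mem_ones h2 hx hx'⟩,
    by omega, ?_⟩
  · simpa using h.mem_of_zeros h3
  · have := h.ones_before h1 (x := P - σ - τ) (by omega) (by omega)
    have := h.zeros_before h2 (x := P - σ) (by omega) (by omega)
    omega

/-- Jump over a single run `0^{2σ}`. -/
theorem ret_single_zeros (h : FourRuns S σ τ) {Q : ℤ} (h1 : Run1 S (Q - 2 * τ) (2 * τ))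
    (h2 : Run0 S Q (2 * σ)) (h3 : Run1 S (Q + 2 * σ) (2 * τ)) :
    RetPair S (2 * τ + σ) (2 * τ) (2 * τ + σ) (2 * τ) := by
  have hσ := h.hσ
  have hτ := h.hτ
  refine ⟨Q - 2 * τ, Q + σ, ⟨by omega, h.mem_of_ones h1 (by omega) (by omega),
    h.mem_of_ones h3 (by omega) (by omega), fun x hx hx' => h.not_mem_zeros h2 hx hx'⟩,
    by omega, ?_⟩
  have := h2.2.2.1 (Q + σ) (by omega) (by omega)
  have := h1.2.2.1 Q (by omega) (by omega)
  omega

/-- Jump over a maximal stretch of runs `0^{2σ}` and `1^τ` containing some run `0^{2σ}`. -/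
theorem ret_stretch (h : FourRuns S σ τ) {Q c : ℤ} (hQ : Run0 S Q (2 * σ))
    (hc : c = 0 ∧ Run1 S (Q - 2 * τ) (2 * τ) ∨
      c = 1 ∧ Run1 S (Q - τ) τ ∧ Run0 S (Q - τ - σ) σ) :
    ∃ (m : ℕ) (c' : ℤ), (∀ t : ℕ, t ≤ m → Run0 S (Q + t * (2 * σ + τ)) (2 * σ)) ∧
      (∀ x, Q ≤ x → x < Q + m * (2 * σ + τ) + 2 * σ → ¬ Run1 S x (2 * τ)) ∧
      (S (Q + m * (2 * σ + τ) + 2 * σ) = S Q + m * τ) ∧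
      (c' = 0 ∧ Run1 S (Q + m * (2 * σ + τ) + 2 * σ) (2 * τ) ∨
          c' = 1 ∧ Run1 S (Q + m * (2 * σ + τ) + 2 * σ) τ ∧
            Run0 S (Q + m * (2 * σ + τ) + (2 * σ + τ)) σ) ∧
      RetPair S (2 * τ + σ) (2 * τ) (m * (2 * σ + τ) + 2 * τ + σ + (c + c') * σ) ((m + 2) * τ) := by
  have hσ := h.hσ
  have hτ := h.hτ
  obtain ⟨Y, hY⟩ := h.exττ
  obtain ⟨X, hX, hXr⟩ := h.good.run1_right hY Q
  obtain ⟨m, m1, m2, m3, m4, m5⟩ := h.stretch hXr (X - Q).toNat Q hX (by omega) hQ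
  have hm : 0 ≤ (m : ℤ) * (2 * σ + τ) := by
    have : 0 ≤ 2 * σ + τ := by omega
    positivity
  obtain ⟨e, he, heS, hep, hen⟩ : ∃ e, S (e + (2 * τ + σ)) - S e = 2 * τ ∧ S e = S Q - 2 * τ ∧
      e = Q - 2 * τ - c * σ ∧ ∀ x, e < x → x < Q + σ → S (x + (2 * τ + σ)) - S x ≠ 2 * τ := by
    rcases hc with ⟨rfl, h1⟩ | ⟨rfl, h1, h2⟩
    · refine ⟨Q - 2 * τ, h.mem_of_ones h1 (by omega) (by omega), ?_, by ring,
        fun x hx hx' => h.not_mem_zeros hQ hx hx'⟩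
      have := h1.2.2.1 Q (by omega) (by omega)
      omega
    · refine ⟨Q - τ - σ - τ, h.mem_of_zeros h2, ?_, by ring, fun x hx hx' => ?_⟩
      · have := h.ones_before h2 (x := Q - τ - σ - τ) (by omega) (by omega)
        have := h.zeros_before h1 (x := Q - τ - σ) (by omega) (by omega)
        have := h1.2.2.1 Q (by omega) (by omega)
        omega
      · rcases lt_or_ge x (Q - τ) with hxa | hxa
        · exact h.not_mem_ones h1 (by omega) hxa
        · exact h.not_mem_zeros hQ (by omega) hx'
  obtain ⟨c', e', he', heS', hep', hen', hc'⟩ : ∃ c' e', S (e' + (2 * τ + σ)) - S e' = 2 * τ ∧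
      S e' = S Q + m * τ ∧ e' = Q + m * (2 * σ + τ) + σ + c' * σ ∧
      (∀ x, Q + m * (2 * σ + τ) + σ ≤ x → x < e' → S (x + (2 * τ + σ)) - S x ≠ 2 * τ) ∧
      (c' = 0 ∧ Run1 S (Q + m * (2 * σ + τ) + 2 * σ) (2 * τ) ∨
          c' = 1 ∧ Run1 S (Q + m * (2 * σ + τ) + 2 * σ) τ ∧
            Run0 S (Q + m * (2 * σ + τ) + (2 * σ + τ)) σ) := by
    rcases m5 with h1 | ⟨h1, h2⟩
    · refine ⟨0, Q + m * (2 * σ + τ) + σ, h.mem_of_ones h1 (by omega) (by omega), ?_, by ring,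
        fun x hx hx' => by omega, Or.inl ⟨rfl, h1⟩⟩
      rw [← m3, h.zeros_before h1 (x := Q + m * (2 * σ + τ) + σ) (by omega) (by omega)]
    · refine ⟨1, Q + m * (2 * σ + τ) + 2 * σ, ?_, m3, by ring,
        fun x hx hx' => h.not_mem_ones h1 (by omega) hx', Or.inr ⟨rfl, h1, h2⟩⟩
      have := h.mem_of_zeros h2
      rwa [show Q + m * (2 * σ + τ) + (2 * σ + τ) - τ = Q + m * (2 * σ + τ) + 2 * σ by ring] at this
  have hc0 : 0 ≤ c * σ := by rcases hc with ⟨rfl, -⟩ | ⟨rfl, -⟩ <;> omega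
  have hc0' : 0 ≤ c' * σ := by rcases hc' with ⟨rfl, -⟩ | ⟨rfl, -⟩ <;> omega
  refine ⟨m, c', m1, m4, m3, hc', e, e', ⟨by omega, he, he', fun x hx hx' => ?_⟩, ?_, ?_⟩
  · rcases lt_or_ge x (Q + σ) with hxa | hxa
    · exact hen x hx hxa
    rcases lt_or_ge x (Q + m * (2 * σ + τ) + σ) with hxb | hxb
    · exact m2 x (by omega) hxb
    · exact hen' x hxb hx'
  · rw [hep, hep']
    ring
  · rw [heS, heS']
    ring

theorem exists_adjacent (h : FourRuns S σ τ) : ∃ Q, Run0 S Q σ ∧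
    (Run1 S (Q + σ) (2 * τ) ∨ Run1 S (Q - 2 * τ) (2 * τ)) := by
  by_contra hcon
  push Not at hcon
  have hσ := h.hσ
  have hτ := h.hτ
  obtain ⟨P, hP⟩ := h.exττ
  obtain ⟨Q, hQ⟩ := h.exσ
  have hprev : ∀ {P}, Run1 S P (2 * τ) → Run0 S (P - 2 * σ) (2 * σ) := fun {P} hP =>
    (h.prev0 hP).resolve_left fun h1 => (hcon _ h1).1 (by simpa using hP)
  have hnext : ∀ {P}, Run1 S P (2 * τ) → Run0 S (P + 2 * τ) (2 * σ) := fun {P} hP =>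
    (h.next0 hP).resolve_left fun h1 => (hcon _ h1).2 (by simpa using hP)
  have hprevQ : ∀ {Q}, Run0 S Q σ → Run1 S (Q - τ) τ := fun {Q} hQ =>
    (h.prev1 hQ).resolve_right (hcon _ hQ).2
  have r1 := h.toCpl.ret10
  have r2 := h.toCpl.ret_single_zeros (run1_cpl.2 (hprev hP)) (run0_cpl.2 hP)
    (run1_cpl.2 (hnext hP))
  have r3 := h.toCpl.ret_single (run0_cpl.2 (hprevQ hQ)) (run1_cpl.2 hQ)
    (run0_cpl.2 ((h.next1 hQ).resolve_right (hcon _ hQ).1))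
  have hno : ∀ X, Run1 S X τ → ¬ Run0 S (X - 2 * σ) (2 * σ) := fun X hX hX' =>
    h.toCpl.good.four _ _ _ _ _ _ _ _ _ _ (by omega) r1 r2 r3
      (h.toCpl.ret11 (run0_cpl.2 hX) (Or.inr (run1_cpl.2 hX'))) (by omega) (by omega) (by omega)
      (by omega) (by omega) (by omega)
  obtain ⟨X, hX⟩ := h.exτ
  obtain ⟨x, hx, hxX⟩ := h.good.run1_right hX P
  obtain ⟨x, h1, -, h2, h3⟩ := int_least (p := fun x => Run1 S x τ) hx hxX
  have h5 := (h.prev0 h2).resolve_right (hno _ h2)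
  have h6 := hprevQ h5
  have h7 := h.sep_of_ne hP h2 (by omega) h1
  refine h3 _ ?_ (by omega) h6
  by_contra hlt
  have := h.sep_of_ne h6 hP (by omega) (by omega)
  omega

theorem jump_unique (h : FourRuns S σ τ) {l s l' s' : ℤ}
    (h1 : RetPair S (2 * τ + σ) (2 * τ) l s) (h2 : RetPair S (2 * τ + σ) (2 * τ) l' s')
    (hl : 2 ≤ l) (hl' : 2 ≤ l') : l = l' ∧ s = s' := by
  have hσ := h.hσ
  have hτ := h.hτ
  obtain ⟨Q, hQ, hQ'⟩ := h.exists_adjacent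
  by_contra hne
  exact h.good.four _ _ _ _ _ _ _ _ _ _ (by omega) h.ret10 (h.ret11 hQ hQ') h1 h2 (by omega)
    (by omega) (by omega) (by omega) (by omega) (by omega)

/-- The chain of runs `1^{2τ}` separated by `0^σ` starting at a given chain start. -/
theorem chain (h : FourRuns S σ τ) {P : ℤ} (hP : Run1 S P (2 * τ))
    (hP' : ¬ Run1 S (P - (2 * τ + σ)) (2 * τ)) : ∃ m : ℕ,
      (∀ t : ℕ, t ≤ m → Run1 S (P + t * (2 * τ + σ)) (2 * τ)) ∧
      ¬ Run1 S (P + (m + 1 : ℕ) * (2 * τ + σ)) (2 * τ) ∧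
      ∃ l, 2 ≤ l ∧ RetPair (cpl S) (2 * σ + τ) (2 * σ) l ((m + 2) * σ) := by
  have hσ := h.hσ
  have hτ := h.hτ
  obtain ⟨c, hc0, hc⟩ : ∃ c : ℤ, 0 ≤ c ∧ (c = 0 ∧ Run1 (cpl S) (P - 2 * σ) (2 * σ) ∨
      c = 1 ∧ Run1 (cpl S) (P - σ) σ ∧ Run0 (cpl S) (P - σ - τ) τ) := by
    simp only [run0_cpl, run1_cpl]
    rcases h.prev0 hP with h1 | h1
    · refine ⟨1, by omega, Or.inr ⟨rfl, h1, (h.prev1 h1).resolve_right fun h2 => hP' ?_⟩⟩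
      convert h2 using 1
      ring
    · exact ⟨0, le_rfl, Or.inl ⟨rfl, h1⟩⟩
  obtain ⟨m, c', m1, -, -, m3, m4⟩ := h.toCpl.ret_stretch (run0_cpl.2 hP) hc
  have hm : 0 ≤ (m : ℤ) * (2 * τ + σ) := by
    have : 0 ≤ 2 * τ + σ := by omega
    positivity
  simp only [run0_cpl, run1_cpl] at m1 m3
  refine ⟨m, m1, fun hbad => ?_, _, ?_, m4⟩
  · have e : P + (m + 1 : ℕ) * (2 * τ + σ) = P + m * (2 * τ + σ) + (2 * τ + σ) := by
      push_cast; ring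
    rw [e] at hbad
    rcases m3 with ⟨-, h1⟩ | ⟨-, -, h1⟩
    · have := h1.2.2.1 (P + m * (2 * τ + σ) + (2 * τ + σ)) (by omega) (by omega)
      have := h1.2.2.1 (P + m * (2 * τ + σ) + (2 * τ + σ) + 1) (by omega) (by omega)
      have := hbad.2.2.1 (P + m * (2 * τ + σ) + (2 * τ + σ) + 1) (by omega) (by omega)
      omega
    · have := hbad.unique h1
      omega
  · have : 0 ≤ (c + c') * τ := by
      have : 0 ≤ c + c' := by omega
      have : 0 ≤ τ := by omega
      positivity
    omega

theorem exists_chain_start (h : FourRuns S σ τ) :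
    ∃ P, Run1 S P (2 * τ) ∧ ¬ Run1 S (P - (2 * τ + σ)) (2 * τ) := by
  have hσ := h.hσ
  have hτ := h.hτ
  by_contra hcon
  push Not at hcon
  obtain ⟨X, hX⟩ := h.exτ
  obtain ⟨Y, hY⟩ := h.exττ
  obtain ⟨x, hx, hxX⟩ := h.good.run1_left hX Y
  obtain ⟨y, h1, h2, h3, h4⟩ := int_least (p := fun y => Run1 S y (2 * τ)) (b := x) hx hY
  have h5 := hcon y h3
  have h6 := h.sep_of_ne hxX h3 (by omega) h1
  refine h4 _ ?_ (by omega) h5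
  by_contra hlt
  have := h.sep h5 hxX (by omega)
  omega

theorem no_lone (h : FourRuns S σ τ) {Q : ℤ} (h1 : Run1 S (Q - τ) τ) (h2 : Run0 S Q σ)
    (h3 : Run1 S (Q + σ) τ) : False := by
  have hσ := h.hσ
  have hτ := h.hτ
  obtain ⟨P, hP, hP'⟩ := h.exists_chain_start
  obtain ⟨m, -, -, l, hl, hr⟩ := h.chain hP hP'
  have := (h.toCpl.jump_unique hr
    (h.toCpl.ret_single (run0_cpl.2 h1) (run1_cpl.2 h2) (run0_cpl.2 h3)) hl (by omega)).2
  have : (0 : ℤ) ≤ m * σ := by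
    have : 0 ≤ σ := by omega
    positivity
  rcases hσ with rfl | rfl <;> rcases hτ with rfl | rfl <;> omega

theorem gap (h : FourRuns S σ τ) {P P' : ℤ} (hP : Consec (fun P => Run1 S P (2 * τ)) P P')
    (hne : P' ≠ P + (2 * τ + σ)) : ∃ M c l : ℤ, RetPair S (2 * τ + σ) (2 * τ) l (M * τ) ∧ 2 ≤ l ∧
      l = (2 * σ + τ) * M - (3 - c) * σ ∧ P' - P = l + σ + τ * c ∧ S P' - S P = M * τ + τ * c := by
  have hσ := h.hσ
  have hτ := h.hτ
  obtain ⟨hlt, hY, hY', hbet⟩ := hP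
  have hsep := h.sep hY hY' hlt
  have heq : ∀ X, P < X → Run1 S X (2 * τ) → ¬ P' < X → P' = X := fun X h1 h2 h3 => by
    by_contra h4
    exact hbet X h1 (by omega) h2
  have hSP := hY.2.2.1 (P + 2 * τ) (by omega) (by omega)
  -- the stretch after a run `0^{2σ}`
  have main : ∀ Q c, Run0 S Q (2 * σ) → (c = 0 ∧ Run1 S (Q - 2 * τ) (2 * τ) ∨
      c = 1 ∧ Run1 S (Q - τ) τ ∧ Run0 S (Q - τ - σ) σ) → Q ≤ P' →
      Q = P + 2 * τ + c * (σ + τ) → S Q = S P + 2 * τ + c * τ →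
      ∃ M c l : ℤ, RetPair S (2 * τ + σ) (2 * τ) l (M * τ) ∧ 2 ≤ l ∧
      l = (2 * σ + τ) * M - (3 - c) * σ ∧ P' - P = l + σ + τ * c ∧
      S P' - S P = M * τ + τ * c := by
    intro Q c hQ hc hQP hQe hQS
    obtain ⟨m, c', -, m2, mS, m3, m4⟩ := h.ret_stretch hQ hc
    have hm : 0 ≤ (m : ℤ) * (2 * σ + τ) := by
      have : 0 ≤ 2 * σ + τ := by omega
      positivity
    have hP'1 : Q + m * (2 * σ + τ) + 2 * σ ≤ P' := by
      by_contra hcon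
      exact m2 P' hQP (by omega) hY'
    have hcσ : 0 ≤ c * (σ + τ) := by rcases hc with ⟨rfl, -⟩ | ⟨rfl, -⟩ <;> omega
    have hcc : 0 ≤ (c + c') * σ := by
      rcases hc with ⟨rfl, -⟩ | ⟨rfl, -⟩ <;> rcases m3 with ⟨rfl, -⟩ | ⟨rfl, -⟩ <;> omega
    refine ⟨m + 2, c + c', _, m4, by omega, by ring, ?_⟩
    rcases m3 with ⟨rfl, h1⟩ | ⟨rfl, h1, h2⟩
    · obtain rfl := heq _ (by omega) h1 (by omega)
      rw [mS, hQS, hQe]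
      constructor <;> ring
    · rcases h.next1 h2 with h3 | h3
      · exact (h.no_lone (by convert h1 using 1; ring) h2 h3).elim
      · have := h.sep_of_ne h1 hY' (by omega) hP'1
        obtain rfl := heq _ (by omega) h3 (by omega)
        rw [h.zeros_after h1 (x := Q + m * (2 * σ + τ) + (2 * σ + τ) + σ) (by omega) (by omega),
          mS, hQS, hQe]
        constructor <;> ring
  rcases h.next0 hY with h0 | h0
  · rcases h.next1 h0 with h1 | h1
    · have hS1 := h.zeros_after hY (x := P + 2 * τ + σ) (by omega) (by omega)
      have hS2 := h1.2.2.1 (P + 2 * τ + σ + τ) (by omega) (by omega)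
      have hsep' := h.sep_of_ne h1 hY' (by omega) (by omega)
      rcases h.next0 h1 with h2 | h2
      · rcases h.next1 h2 with h3 | h3
        · exact (h.no_lone (by simpa using h1) h2 h3).elim
        · obtain rfl := heq _ (by omega) h3 (by omega)
          have := h.zeros_after h1 (x := P + 2 * τ + σ + τ + σ) (by omega) (by omega)
          refine ⟨1, 2, σ + τ, ?_, ?_, ?_, ?_, ?_⟩
          · simpa using h.ret_single (by simpa using h0) h1 h2
          · omega
          · ring
          · ring
          · omega
      · exact main _ 1 h2 (Or.inr ⟨rfl, by simpa using h1, by convert h0 using 1; ring⟩) (by omega)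
          (by ring) (by omega)
    · exact absurd (heq _ (by omega) h1 (by omega)) (by omega)
  · exact main _ 0 h0 (Or.inl ⟨rfl, by simpa using hY⟩) (by omega) (by ring) (by omega)

theorem contra (h : FourRuns S σ τ) : False := by
  have hσ := h.hσ
  have hτ := h.hτ
  obtain ⟨P₀, hP₀, hP₀'⟩ := h.exists_chain_start
  obtain ⟨k, -, -, l, hl, hr⟩ := h.chain hP₀ hP₀'
  have hk : ∀ P, Run1 S P (2 * τ) → ¬ Run1 S (P - (2 * τ + σ)) (2 * τ) →
      (∀ t : ℕ, t ≤ k → Run1 S (P + t * (2 * τ + σ)) (2 * τ)) ∧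
      ¬ Run1 S (P + (k + 1 : ℕ) * (2 * τ + σ)) (2 * τ) := by
    intro P hP hP'
    obtain ⟨m, m1, m2, l', hl', hr'⟩ := h.chain hP hP'
    have e := (h.toCpl.jump_unique hr hr' hl hl').2
    have e' := mul_right_cancel₀ (by omega) e
    obtain rfl : m = k := by omega
    exact ⟨m1, m2⟩
  have hz : ∀ Q d, Run0 S Q d → σ ≤ d := fun Q d hQ => by have := h.zeros _ _ hQ; omega
  have ho : ∀ P d, Run1 S P d → d ≤ 2 * τ := fun P d hP => by have := h.ones _ _ hP; omega
  by_cases hex : ∃ P P', Consec (fun P => Run1 S P (2 * τ)) P P' ∧ P' ≠ P + (2 * τ + σ)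
  · obtain ⟨Q, Q', hQ, hQ'⟩ := hex
    refine h.good.chain_contra (by omega) (by omega) hz ho hP₀ hP₀' hk
      (G := Q' - Q) (s := S Q' - S Q) fun P P' hP hP' => ?_
    obtain ⟨M, c, l, h1, h2, h3, h4, h5⟩ := h.gap hQ hQ'
    obtain ⟨M', c', l', g1, g2, g3, g4, g5⟩ := h.gap hP hP'
    obtain ⟨e1, e2⟩ := h.jump_unique h1 g1 h2 g2
    obtain rfl := mul_right_cancel₀ (by omega) e2
    have e3 : (3 - c) * σ = (3 - c') * σ := by linarith
    have e4 := mul_right_cancel₀ (by omega) e3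
    obtain rfl : c = c' := by omega
    subst e1
    omega
  · push Not at hex
    exact h.good.chain_contra (G := 0) (s := 0) (by omega) (by omega) hz ho hP₀ hP₀' hk
      fun P P' hP hP' => absurd (hex P P' hP) hP'

end FourRuns

section shortRuns

variable {S : ℤ → ℤ}

theorem Run1.mid {P d x : ℤ} (h : Run1 S P d) (hx : P ≤ x) (hx' : x ≤ P + d) :
    S x = S P + (x - P) := h.2.2.1 x hx hx'

theorem Run0.mid {P d x : ℤ} (h : Run0 S P d) (hx : P ≤ x) (hx' : x ≤ P + d) :
    S x = S P := h.2.2.1 x hx hx'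

theorem Good.exists_run1 (h : Good S) : ∃ P d, Run1 S P d := by
  obtain ⟨i, -, hi⟩ := h.one_right 0
  obtain ⟨P, d, hP, -⟩ := h.cover1 hi
  exact ⟨P, d, hP⟩

theorem Good.exists_run0 (h : Good S) : ∃ P d, Run0 S P d := by
  obtain ⟨P, d, hP⟩ := h.toCpl.exists_run1
  exact ⟨P, d, run1_cpl.1 hP⟩

/-- If `00` occurs, there are at most two lengths of one runs. -/
theorem Good.runs_le_two (h : Good S) {i P₁ d₁ P₂ d₂ P₃ d₃ : ℤ} (hi : S (i + 2) = S i)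
    (h1 : Run1 S P₁ d₁) (h2 : Run1 S P₂ d₂) (h3 : Run1 S P₃ d₃) (h12 : d₁ ≠ d₂) (h13 : d₁ ≠ d₃)
    (h23 : d₂ ≠ d₃) : False := by
  have r0 : RetPair S 1 0 1 0 := by
    have := h.mono (x := i) (y := i + 1) (by omega)
    have := h.mono (x := i + 1) (y := i + 2) (by omega)
    refine ⟨i, i + 1, ⟨by omega, by omega, ?_, fun k hk hk' => by omega⟩, by omega, by omega⟩
    rw [show i + 1 + 1 = i + 2 by ring]
    omega
  have r : ∀ P d, Run1 S P d → RetPair S 1 0 (d + 1) d := by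
    intro P d hP
    have e1 := hP.1
    have e2 := hP.2.1
    have e3 := hP.2.2.2
    have e4 := hP.mid (x := P + d) (by omega) le_rfl
    refine ⟨P - 1, P + d, ⟨by omega, ?_, by omega, fun k hk hk' => ?_⟩, by omega, by omega⟩
    · rw [sub_add_cancel]; omega
    · have := hP.mid (x := k) (by omega) (by omega)
      have := hP.mid (x := k + 1) (by omega) (by omega)
      omega
  have := h1.1
  have := h2.1
  have := h3.1
  exact h.four 1 0 _ _ _ _ _ _ _ _ le_rfl r0 (r _ _ h1) (r _ _ h2) (r _ _ h3) (by omega)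
    (by omega) (by omega) (by omega) (by omega) (by omega)

theorem Good.runs_cases (h : Good S)
    (h3 : ∀ P₁ d₁ P₂ d₂ P₃ d₃, Run1 S P₁ d₁ → Run1 S P₂ d₂ → Run1 S P₃ d₃ → d₁ ≠ d₂ → d₁ ≠ d₃ →
      d₂ ≠ d₃ → False) :
    (∃ a, ∀ P d, Run1 S P d → d = a) ∨ ∃ a b, a < b ∧ (∃ P, Run1 S P a) ∧ (∃ P, Run1 S P b) ∧
      ∀ P d, Run1 S P d → d = a ∨ d = b := by
  obtain ⟨P, a, hP⟩ := h.exists_run1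
  by_cases hc : ∀ P d, Run1 S P d → d = a
  · exact Or.inl ⟨a, hc⟩
  push Not at hc
  obtain ⟨P', b, hP', hne⟩ := hc
  have hall : ∀ P d, Run1 S P d → d = a ∨ d = b := fun P'' d hd => by
    by_contra hcon
    push Not at hcon
    exact h3 _ _ _ _ _ _ hP hP' hd (Ne.symm hne) hcon.1.symm hcon.2.symm
  rcases lt_or_gt_of_ne hne with hlt | hlt
  · exact Or.inr ⟨b, a, hlt, ⟨P', hP'⟩, ⟨P, hP⟩, fun P d hd => (hall P d hd).symm⟩
  · exact Or.inr ⟨a, b, hlt, ⟨P, hP⟩, ⟨P', hP'⟩, hall⟩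

theorem Good.not_constant_runs (h : Good S) {r a : ℤ} (h0 : ∀ Q d, Run0 S Q d → d = r)
    (h1 : ∀ P d, Run1 S P d → d = a) : False := by
  have start : ∀ i, S (i + r) - S i = 0 → 1 ≤ r → Run0 S i r := by
    intro i hi hr
    have := h.mono (x := i + 1) (y := i + r) (by omega)
    have := h.mono (x := i) (y := i + 1) (by omega)
    obtain ⟨Q, d, hQ, hQ1, hQ2⟩ := h.cover0 (c := i) (by omega)
    obtain rfl := h0 _ _ hQ
    suffices Q = i from this ▸ hQ
    by_contra hne
    have e1 := hQ.2.2.2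
    have := h.mono (x := Q + d + 1) (y := i + d) (by omega)
    have := hQ.mid (x := i) (by omega) (by omega)
    omega
  obtain ⟨Q, d, hQ⟩ := h.exists_run0
  obtain rfl := h0 _ _ hQ
  have hr := hQ.1
  have e := hQ.mid (x := Q + d) (by omega) le_rfl
  refine h.one d 0 Q (d + a) a hr (by omega) ?_
  rintro l s ⟨i, j, ⟨hij, hi, hj, hk⟩, rfl, rfl⟩
  have hi' := start i hi hr
  have hj' := start j hj hr
  obtain ⟨b, hb⟩ := h.next1 hi'
  obtain rfl := h1 _ _ hb
  obtain ⟨c, hc⟩ := h.next0 hb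
  obtain rfl := h0 _ _ hc
  have hb1 := hb.1
  have e1 := hi'.mid (x := i + c) (by omega) le_rfl
  have e2 := hb.mid (x := i + c + b) (by omega) (by omega)
  have e3 := hc.mid (x := i + c + b + c) (by omega) (by omega)
  suffices j = i + c + b by subst this; omega
  rcases lt_trichotomy j (i + c + b) with hlt | heq | hgt
  · exfalso
    rcases lt_or_ge j (i + c) with hlt' | hge
    · have := hj'.2.1
      have := hi'.mid (x := j) (by omega) (by omega)
      have := hi'.mid (x := j - 1) (by omega) (by omega)
      omega
    · have := hj'.mid (x := j + 1) (by omega) (by omega)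
      have := hb.mid (x := j) (by omega) (by omega)
      have := hb.mid (x := j + 1) (by omega) (by omega)
      omega
  · exact heq
  · exact absurd (by omega) (hk (i + c + b) (by omega) hgt)

theorem Good.common_two (h : Good S) {P₁ P₂ Q₁ Q₂ d₁ d₂ c₁ c₂ : ℤ} (hP₁ : Run1 S P₁ d₁)
    (hP₂ : Run1 S P₂ d₂) (hQ₁ : Run0 S Q₁ c₁) (hQ₂ : Run0 S Q₂ c₂) (hd : d₁ ≠ d₂) (hc : c₁ ≠ c₂) :
    (d₁ = 2 ∨ d₂ = 2) ∧ (c₁ = 2 ∨ c₂ = 2) := by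
  by_contra hcon
  have r1 : ∀ P d, Run1 S P d → RetPair S 2 1 d (d - 1) := by
    intro P d hP
    have e1 := hP.1
    have e2 := hP.2.1
    have e3 := hP.2.2.2
    have e4 := hP.mid (x := P + d - 1) (by omega) (by omega)
    have e5 := hP.mid (x := P + 1) (by omega) (by omega)
    refine ⟨P - 1, P + d - 1, ⟨by omega, ?_, ?_, fun k hk hk' => ?_⟩, by omega, by omega⟩
    · rw [show P - 1 + 2 = P + 1 by ring]; omega
    · rw [show P + d - 1 + 2 = P + d + 1 by ring]; omega
    · have := hP.mid (x := k) (by omega) (by omega)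
      have := hP.mid (x := k + 2) (by omega) (by omega)
      omega
  have r0 : ∀ Q c, Run0 S Q c → RetPair S 2 1 c 1 := by
    intro Q c hQ
    have e1 := hQ.1
    have e2 := hQ.2.1
    have e3 := hQ.2.2.2
    have e4 := hQ.mid (x := Q + c - 1) (by omega) (by omega)
    have e5 := hQ.mid (x := Q + 1) (by omega) (by omega)
    refine ⟨Q - 1, Q + c - 1, ⟨by omega, ?_, ?_, fun k hk hk' => ?_⟩, by omega, by omega⟩
    · rw [show Q - 1 + 2 = Q + 1 by ring]; omega
    · rw [show Q + c - 1 + 2 = Q + c + 1 by ring]; omega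
    · have := hQ.mid (x := k) (by omega) (by omega)
      have := hQ.mid (x := k + 2) (by omega) (by omega)
      omega
  exact h.four 2 1 _ _ _ _ _ _ _ _ (by omega) (r1 _ _ hP₁) (r1 _ _ hP₂) (r0 _ _ hQ₁) (r0 _ _ hQ₂)
    (by omega) (by omega) (by omega) (by omega) (by omega) (by omega)

theorem Good.four_of_two (h : Good S) {c d : ℤ} (hd2 : ∃ P, Run1 S P 2) (hd : ∃ P, Run1 S P d)
    (hc2 : ∃ Q, Run0 S Q 2) (hc : ∃ Q, Run0 S Q c) (hd1 : d ≠ 2) (hc1 : c ≠ 2)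
    (hones : ∀ P e, Run1 S P e → e = 2 ∨ e = d) : d = 1 ∨ d = 4 := by
  by_contra hcon
  obtain ⟨A, hA⟩ := hd2
  obtain ⟨P, hP⟩ := hd
  obtain ⟨B, hB⟩ := hc2
  obtain ⟨Q, hQ⟩ := hc
  have hd0 := hP.1
  have hc0 := hQ.1
  have r1 : RetPair S 3 2 1 0 := by
    have := hA.2.1
    have := hA.2.2.2
    have := hA.mid (x := A + 2) (by omega) (by omega)
    refine ⟨A - 1, A, ⟨by omega, ?_, ?_, fun k hk hk' => by omega⟩, by omega, by omega⟩
    · rw [show A - 1 + 3 = A + 2 by ring]; omega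
    · rw [show A + 3 = A + 2 + 1 by ring]; omega
  have r2 : RetPair S 3 2 (d - 1) (d - 2) := by
    have := hP.2.1
    have := hP.2.2.2
    have := hP.mid (x := P + 2) (by omega) (by omega)
    have := hP.mid (x := P + d - 2) (by omega) (by omega)
    refine ⟨P - 1, P + d - 2, ⟨by omega, ?_, ?_, fun k hk hk' => ?_⟩, by omega, by omega⟩
    · rw [show P - 1 + 3 = P + 2 by ring]; omega
    · rw [show P + d - 2 + 3 = P + d + 1 by ring]; omega
    · have := hP.mid (x := k) (by omega) (by omega)
      have := hP.mid (x := k + 3) (by omega) (by omega)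
      omega
  have around : ∀ Q c, Run0 S Q c → S (Q - 2) = S Q - 2 ∧ S (Q + c + 2) = S Q + 2 := by
    intro Q c hQ
    obtain ⟨e, he⟩ := h.prev1 hQ
    obtain ⟨f, hf⟩ := h.next1 hQ
    have := hones _ _ he
    have := hones _ _ hf
    have := hQ.1
    have := he.mid (x := Q - 2) (by omega) (by omega)
    have := he.mid (x := Q) (by omega) (by omega)
    have := hf.mid (x := Q + c + 2) (by omega) (by omega)
    have := hQ.mid (x := Q + c) (by omega) (by omega)
    omega
  have r3 : ∀ Q c, Run0 S Q c → 2 ≤ c → RetPair S 3 2 (c + 1) 2 := by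
    intro Q c hQ hc
    have e1 := around _ _ hQ
    have e2 := hQ.2.1
    have := hQ.mid (x := Q + 1) (by omega) (by omega)
    have := hQ.mid (x := Q + c - 1) (by omega) (by omega)
    refine ⟨Q - 2, Q + c - 1, ⟨by omega, ?_, ?_, fun k hk hk' => ?_⟩, by omega, by omega⟩
    · rw [show Q - 2 + 3 = Q + 1 by ring]; omega
    · rw [show Q + c - 1 + 3 = Q + c + 2 by ring]; omega
    · rcases eq_or_lt_of_le (show Q - 1 ≤ k by omega) with rfl | hlt
      · rw [show Q - 1 + 3 = Q + 2 by ring]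
        have := hQ.mid (x := Q + 2) (by omega) (by omega)
        omega
      · have := hQ.mid (x := k) (by omega) (by omega)
        have := hQ.mid (x := k + 2) (by omega) (by omega)
        have := h.step (k + 2)
        rw [show k + 2 + 1 = k + 3 by ring] at this
        omega
  have r4 : ∃ l s, RetPair S 3 2 l s ∧ (l = c + 1 ∧ s = 2 ∧ 3 ≤ c ∨ l = 1 ∧ s = 1) := by
    rcases lt_or_ge c 2 with hlt | hge
    · obtain rfl : c = 1 := by omega
      refine ⟨1, 1, ?_, Or.inr ⟨rfl, rfl⟩⟩
      have e1 := around _ _ hQ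
      have e2 := hQ.2.1
      have e3 := hQ.mid (x := Q + 1) (by omega) (by omega)
      have e4 := hQ.2.2.2
      refine ⟨Q - 2, Q - 1, ⟨by omega, ?_, ?_, fun k hk hk' => by omega⟩, by omega, by omega⟩
      · rw [show Q - 2 + 3 = Q + 1 by ring]; omega
      · rw [show Q - 1 + 3 = Q + 1 + 1 by ring]; omega
    · exact ⟨c + 1, 2, r3 _ _ hQ hge, Or.inl ⟨rfl, rfl, by omega⟩⟩
  obtain ⟨l, s, hls, hls'⟩ := r4
  exact h.four 3 2 _ _ _ _ _ _ _ _ (by omega) r1 r2 (r3 _ _ hB le_rfl) hls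
    (by omega) (by omega) (by omega) (by omega) (by omega) (by omega)

/-- The words `00` and `11` do not both occur. -/
theorem Good.not_double (h : Good S) {i j : ℤ} (hi : S (i + 2) = S i) (hj : S (j + 2) = S j + 2) :
    False := by
  have hc := h.toCpl
  have hi1 := h.mono (x := i) (y := i + 1) (by omega)
  have hi2 := h.mono (x := i + 1) (y := i + 2) (by omega)
  have hj1 := h.mono (x := j) (y := j + 1) (by omega)
  have hj2 := h.mono (x := j + 1) (y := j + 2) (by omega)
  have C1 := h.runs_cases fun _ _ _ _ _ _ h1 h2 h3 => h.runs_le_two hi h1 h2 h3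
  have C0 := hc.runs_cases fun _ _ _ _ _ _ h1 h2 h3 =>
    hc.runs_le_two (i := j) (by simp only [cpl]; omega) h1 h2 h3
  obtain ⟨Q, c, hQ, hQ1, hQ2⟩ := h.cover0 (c := i) (by omega)
  obtain ⟨P, d, hP, hP1, hP2⟩ := h.cover1 (c := j) (by omega)
  have hc2 : 2 ≤ c := by
    by_contra hcon
    have := hQ.1
    obtain rfl : c = 1 := by omega
    obtain rfl : i = Q := by omega
    have := hQ.2.2.2
    rw [show i + 1 + 1 = i + 2 by ring] at this
    omega
  have hd2 : 2 ≤ d := by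
    by_contra hcon
    have := hP.1
    obtain rfl : d = 1 := by omega
    obtain rfl : j = P := by omega
    have := hP.2.2.2
    rw [show j + 1 + 1 = j + 2 by ring] at this
    omega
  simp only [run1_cpl] at C0
  rcases C0 with ⟨r, hr⟩ | ⟨c₁, c₂, hlt, ⟨Q₁, hQ₁⟩, ⟨Q₂, hQ₂⟩, hall⟩
  · obtain rfl := hr _ _ hQ
    rcases C1 with ⟨a, ha⟩ | ⟨a, b, hab, ⟨P₁, hP₁⟩, ⟨P₂, hP₂⟩, hall⟩
    · exact h.not_constant_runs hr ha
    · exact TwoBlocks.contra ⟨h, by omega, hP₁.1, hab, hr, hall, ⟨_, hP₁⟩, ⟨_, hP₂⟩⟩ (Or.inl hc2)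
  · rcases C1 with ⟨a, ha⟩ | ⟨d₁, d₂, hlt', ⟨P₁, hP₁⟩, ⟨P₂, hP₂⟩, hall'⟩
    · obtain rfl := ha _ _ hP
      exact TwoBlocks.contra (S := cpl S) ⟨hc, by omega, hQ₁.1, hlt,
        fun _ _ h0 => ha _ _ (run0_cpl.1 h0), fun _ _ h1 => hall _ _ (run1_cpl.1 h1),
        ⟨_, run1_cpl.2 hQ₁⟩, ⟨_, run1_cpl.2 hQ₂⟩⟩ (Or.inl hd2)
    have key := h.common_two hP₁ hP₂ hQ₁ hQ₂ (by omega) (by omega)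
    have hp1 := hP₁.1
    have hq1 := hQ₁.1
    obtain ⟨d, hd, ⟨P, hP2⟩, ⟨P', hPd⟩, hones⟩ : ∃ d, d ≠ 2 ∧ (∃ P, Run1 S P 2) ∧
        (∃ P, Run1 S P d) ∧
        ∀ P e, Run1 S P e → e = 2 ∨ e = d := by
      rcases key.1 with rfl | rfl
      · exact ⟨d₂, by omega, ⟨_, hP₁⟩, ⟨_, hP₂⟩, hall'⟩
      · exact ⟨d₁, by omega, ⟨_, hP₂⟩, ⟨_, hP₁⟩, fun P e he => (hall' P e he).symm⟩
    obtain ⟨c, hc', ⟨Q, hQ2⟩, ⟨Q', hQc⟩, hzeros⟩ : ∃ d, d ≠ 2 ∧ (∃ P, Run0 S P 2) ∧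
        (∃ P, Run0 S P d) ∧ ∀ P e, Run0 S P e → e = 2 ∨ e = d := by
      rcases key.2 with rfl | rfl
      · exact ⟨c₂, by omega, ⟨_, hQ₁⟩, ⟨_, hQ₂⟩, hall⟩
      · exact ⟨c₁, by omega, ⟨_, hQ₂⟩, ⟨_, hQ₁⟩, fun P e he => (hall P e he).symm⟩
    have k1 := h.four_of_two ⟨_, hP2⟩ ⟨_, hPd⟩ ⟨_, hQ2⟩ ⟨_, hQc⟩ hd hc' hones
    have k2 := hc.four_of_two ⟨_, run1_cpl.2 hQ2⟩ ⟨_, run1_cpl.2 hQc⟩ ⟨_, run0_cpl.2 hP2⟩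
      ⟨_, run0_cpl.2 hPd⟩ hc' hd fun P e he => hzeros P e (run1_cpl.1 he)
    obtain ⟨σ, hσ, z1, z2, z3⟩ : ∃ σ, (σ = 1 ∨ σ = 2) ∧ (∃ Q, Run0 S Q σ) ∧
        (∃ Q, Run0 S Q (2 * σ)) ∧ ∀ Q d, Run0 S Q d → d = σ ∨ d = 2 * σ := by
      rcases k2 with rfl | rfl
      · exact ⟨1, Or.inl rfl, ⟨_, hQc⟩, ⟨_, hQ2⟩, fun Q d h' => (hzeros Q d h').symm⟩
      · exact ⟨2, Or.inr rfl, ⟨_, hQ2⟩, ⟨_, hQc⟩, fun Q d h' => hzeros Q d h'⟩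
    obtain ⟨τ, hτ, o1, o2, o3⟩ : ∃ σ, (σ = 1 ∨ σ = 2) ∧ (∃ Q, Run1 S Q σ) ∧
        (∃ Q, Run1 S Q (2 * σ)) ∧ ∀ Q d, Run1 S Q d → d = σ ∨ d = 2 * σ := by
      rcases k1 with rfl | rfl
      · exact ⟨1, Or.inl rfl, ⟨_, hPd⟩, ⟨_, hP2⟩, fun Q d h' => (hones Q d h').symm⟩
      · exact ⟨2, Or.inr rfl, ⟨_, hP2⟩, ⟨_, hPd⟩, fun Q d h' => hones Q d h'⟩
    exact FourRuns.contra ⟨h, hσ, hτ, z3, o3, z1, z2, o1, o2⟩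

end shortRuns

/-- The words `0B0` and `1B1` occur at positions `i` and `j`, where `B` has length `n`. -/
def Unb (S : ℤ → ℤ) (n i j : ℤ) : Prop :=
  S (i + 1) = S i ∧ S (i + n + 2) = S (i + n + 1) ∧ S (j + 1) = S j + 1 ∧
    S (j + n + 2) = S (j + n + 1) + 1 ∧
    ∀ t, 0 ≤ t → t ≤ n → S (i + 1 + t) - S (i + 1) = S (j + 1 + t) - S (j + 1)

theorem exists_unb {S : ℤ → ℤ} (hs : ∀ i, S (i + 1) = S i ∨ S (i + 1) = S i + 1) {L i j : ℤ}
    (hL : 0 ≤ L) (hd : S (i + L) - S i + 2 ≤ S (j + L) - S j) :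
    ∃ m a, 0 ≤ a ∧ 0 ≤ m ∧ m + a + 2 ≤ L ∧ Unb S m (i + a) (j + a) := by
  obtain ⟨t₁, h0, hle, h1, hmin⟩ := int_least (b := 0) (i := L)
    (p := fun t => S (i + t) - S i + 2 ≤ S (j + t) - S j) hL hd
  have hpos : 0 < t₁ := by
    rcases eq_or_lt_of_le h0 with rfl | h
    · simp at h1
    · exact h
  obtain ⟨t₀, h2, h3, h4, hmax⟩ := int_greatest (b := t₁) (i := 0)
    (p := fun t => S (j + t) - S j ≤ S (i + t) - S i) h0 (by simp)
  have st : ∀ x t, S (x + (t + 1)) = S (x + t) ∨ S (x + (t + 1)) = S (x + t) + 1 := fun x t => by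
    rw [← add_assoc]; exact hs _
  have hlt : t₀ < t₁ := by
    rcases eq_or_lt_of_le h2 with rfl | h
    · omega
    · exact h
  have mid : ∀ t, t₀ < t → t < t₁ → S (j + t) - S j = S (i + t) - S i + 1 := fun t ht ht' => by
    have := hmin t (by omega) ht'
    have := hmax t (by omega) ht
    omega
  have a1 := st i t₀
  have a2 := st j t₀
  have a3 := hmax (t₀ + 1) (by omega) (by omega)
  have b1 := st i (t₁ - 1)
  have b2 := st j (t₁ - 1)
  have b3 := hmin (t₁ - 1) (by omega) (by omega)
  rw [sub_add_cancel] at b1 b2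
  have hlt' : t₀ + 2 ≤ t₁ := by
    by_contra hcon
    obtain rfl : t₁ = t₀ + 1 := by omega
    omega
  have c1 := mid (t₀ + 1) (by omega) (by omega)
  have c2 := mid (t₁ - 1) (by omega) (by omega)
  refine ⟨t₁ - t₀ - 2, t₀, h3, by omega, by omega, ?_, ?_, ?_, ?_, fun t ht ht' => ?_⟩
  · rw [add_assoc]; omega
  · rw [show i + t₀ + (t₁ - t₀ - 2) + 2 = i + t₁ by ring,
      show i + t₀ + (t₁ - t₀ - 2) + 1 = i + (t₁ - 1) by ring]; omega
  · rw [add_assoc]; omega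
  · rw [show j + t₀ + (t₁ - t₀ - 2) + 2 = j + t₁ by ring,
      show j + t₀ + (t₁ - t₀ - 2) + 1 = j + (t₁ - 1) by ring]; omega
  · have := mid (t₀ + 1 + t) (by omega) (by omega)
    rw [show i + t₀ + 1 + t = i + (t₀ + 1 + t) by ring,
      show j + t₀ + 1 + t = j + (t₀ + 1 + t) by ring, add_assoc i t₀ 1, add_assoc j t₀ 1]
    omega

/-- The words `0B0` and `1B1` occur, where `B` is of minimal length `n` and has weight `c`. -/
structure MinUnb (S : ℤ → ℤ) (n c : ℤ) : Prop where
  good : Good S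
  hn : 0 ≤ n
  light : ∃ i, S (i + n + 2) - S i = c
  heavy : ∃ j, S (j + n + 2) - S j = c + 2
  bal : ∀ x, S (x + n + 1) - S x = c ∨ S (x + n + 1) - S x = c + 1
  inner : ∀ i j, S (i + n + 2) - S i = c → S (j + n + 2) - S j = c + 2 →
    ∀ t, 0 ≤ t → t ≤ n → S (i + 1 + t) - S (i + 1) = S (j + 1 + t) - S (j + 1)
  min : ∀ m i j, 0 ≤ m → m < n → ¬ Unb S m i j

namespace MinUnb

variable {S : ℤ → ℤ} {n c : ℤ}

theorem toCpl (h : MinUnb S n c) : MinUnb (cpl S) n (n - c) where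
  good := h.good.toCpl
  hn := h.hn
  light := h.heavy.imp fun j hj => by simp only [cpl]; omega
  heavy := h.light.imp fun j hj => by simp only [cpl]; omega
  bal x := by have := h.bal x; simp only [cpl]; omega
  inner i j hi hj t ht ht' := by
    simp only [cpl] at hi hj ⊢
    have := h.inner j i (by omega) (by omega) t ht ht'
    omega
  min m i j h0 hm hu := by
    obtain ⟨h1, h2, h3, h4, h5⟩ := hu
    simp only [cpl] at *
    refine h.min m j i h0 hm ⟨by omega, by omega, by omega, by omega, fun t ht ht' => ?_⟩
    have := h5 t ht ht'
    omega

theorem of_unb (h : Good S) {n i j : ℤ} (hn : 0 ≤ n) (hu : Unb S n i j)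
    (hmin : ∀ m i j, 0 ≤ m → m < n → ¬ Unb S m i j) : MinUnb S n (S (i + n + 2) - S i) := by
  obtain ⟨h1, h2, h3, h4, h5⟩ := hu
  have hF : S (j + n + 2) - S j = S (i + n + 2) - S i + 2 := by
    have := h5 n hn le_rfl
    rw [show i + 1 + n = i + n + 1 by ring, show j + 1 + n = j + n + 1 by ring] at this
    omega
  have close : ∀ x y, S (y + n + 1) - S y ≤ S (x + n + 1) - S x + 1 := by
    intro x y
    by_contra hcon
    obtain ⟨m, a, h6, h7, h8, h9⟩ := exists_unb h.step (L := n + 1) (i := x) (j := y) (by omega)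
      (by rw [← add_assoc, ← add_assoc]; omega)
    exact hmin m _ _ h7 (by omega) h9
  refine ⟨h, hn, ⟨i, rfl⟩, ⟨j, hF⟩, fun x => ?_, fun i' j' hi hj t ht ht' => ?_, hmin⟩
  · have := close x j
    have := close i x
    omega
  · obtain ⟨m, a, h6, h7, h8, h9⟩ := exists_unb h.step (L := n + 2) (i := i') (j := j') (by omega)
      (by rw [← add_assoc, ← add_assoc]; omega)
    obtain rfl : m = n := by
      by_contra hne
      exact hmin m _ _ h7 (by omega) h9
    obtain rfl : a = 0 := by omega
    simpa using h9.2.2.2.2 t ht ht'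

theorem light_ends (h : MinUnb S n c) {i : ℤ} (hi : S (i + n + 2) - S i = c) :
    S (i + 1) = S i ∧ S (i + n + 1) - S i = c ∧ S (i + n + 2) = S (i + n + 1) := by
  have h1 := h.bal i
  have h2 := h.bal (i + 1)
  have h3 := h.good.step i
  have h4 := h.good.step (i + n + 1)
  rw [show i + 1 + n + 1 = i + n + 2 by ring] at h2
  rw [show i + n + 1 + 1 = i + n + 2 by ring] at h4
  omega

theorem heavy_ends (h : MinUnb S n c) {i : ℤ} (hi : S (i + n + 2) - S i = c + 2) :
    S (i + 1) = S i + 1 ∧ S (i + n + 1) - S i = c + 1 ∧ S (i + n + 2) = S (i + n + 1) + 1 := by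
  have h1 := h.bal i
  have h2 := h.bal (i + 1)
  have h3 := h.good.step i
  have h4 := h.good.step (i + n + 1)
  rw [show i + 1 + n + 1 = i + n + 2 by ring] at h2
  rw [show i + n + 1 + 1 = i + n + 2 by ring] at h4
  omega

theorem not_ones (h : MinUnb S n c) (h00 : ∀ i, S (i + 2) ≠ S i) (hcn : c = n) : False := by
  have hn := h.hn
  obtain ⟨i, hi⟩ := h.light
  obtain ⟨j, hj⟩ := h.heavy
  subst hcn
  obtain ⟨i1, i2, i3⟩ := h.light_ends hi
  have hc1 : 1 ≤ c := by
    by_contra hcon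
    obtain rfl : c = 0 := by omega
    exact h00 i (by simp only [add_zero] at hi; omega)
  have hr0 : ∀ Q d, Run0 S Q d → d = 1 := by
    intro Q d hQ
    have := hQ.1
    by_contra hne
    exact h00 Q (hQ.mid (by omega) (by omega))
  have hr1 : ∀ P d, Run1 S P d → c ≤ d := by
    intro P d hP
    by_contra hcon
    have e1 := hP.2.1
    have e2 := hP.2.2.2
    have := h.bal (P - 1)
    have := h.good.mono (x := P + d + 1) (y := P - 1 + c + 1) (by omega)
    omega
  obtain ⟨P, hP⟩ : ∃ P, Run1 S P c := by
    refine ⟨i + 1, hc1, by simpa using i1.symm, fun x hx hx' => ?_, ?_⟩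
    · have := h.good.mono (x := i + 1) (y := x) (by omega)
      have := h.good.mono (x := x) (y := i + c + 2) (by omega)
      have := h.good.mono (x := x) (y := i + c + 1) (by omega)
      omega
    · rw [show i + 1 + c + 1 = i + c + 2 by ring]; omega
  obtain ⟨P', d', hP', hd'⟩ : ∃ P d, Run1 S P d ∧ c + 2 ≤ d := by
    obtain ⟨P, d, hP, h1, h2⟩ := h.good.cover1 (h.heavy_ends hj).1
    refine ⟨P, d, hP, ?_⟩
    by_contra hcon
    have e1 := hP.2.2.2
    have e2 := hP.mid (x := P + d) (by have := hP.1; omega) (by omega)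
    have := h.good.mono (x := j) (y := P + d) (by omega)
    have := h.good.mono (x := P + d + 1) (y := j + c + 2) (by omega)
    omega
  have r : ∀ P d, Run1 S P d → RetPair S (c + 1) c (d + 1 - c) (d - c) := by
    intro P d hP
    have e0 := hr1 _ _ hP
    have e1 := hP.2.1
    have e2 := hP.2.2.2
    have e3 := hP.mid (x := P + c) (by omega) (by omega)
    have e4 := hP.mid (x := P + d - c) (by omega) (by omega)
    refine ⟨P - 1, P + d - c, ⟨by omega, ?_, ?_, fun k hk hk' => ?_⟩, by ring, by omega⟩
    · rw [show P - 1 + (c + 1) = P + c by ring]; omega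
    · rw [show P + d - c + (c + 1) = P + d + 1 by ring]; omega
    · have := hP.mid (x := k) (by omega) (by omega)
      have := hP.mid (x := k + (c + 1)) (by omega) (by omega)
      omega
  have r1 : RetPair S (c + 1) c 1 1 := by
    have e3 := hP.mid (x := P + c) (by omega) (by omega)
    have e4 := hP.mid (x := P + 1) (by omega) (by omega)
    have e2 := hP.2.2.2
    obtain ⟨e, he⟩ := h.good.next0 hP
    obtain rfl := hr0 _ _ he
    have e5 := he.2.2.2
    refine ⟨P, P + 1, ⟨by omega, ?_, ?_, fun k hk hk' => by omega⟩, by ring, by omega⟩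
    · rw [← add_assoc]; omega
    · rw [show P + 1 + (c + 1) = P + c + 1 + 1 by ring]; omega
  rcases h.good.runs_cases fun P₁ d₁ P₂ d₂ P₃ d₃ h1 h2 h3 h12 h13 h23 =>
      h.good.four (c + 1) c _ _ _ _ _ _ _ _ (by omega) r1 (r _ _ h1) (r _ _ h2) (r _ _ h3)
        (by omega) (by omega) (by omega) (by omega) (by omega) (by omega)
    with ⟨a, ha⟩ | ⟨a, b, hab, ⟨A, hA⟩, ⟨B, hB⟩, hall⟩
  · have := ha _ _ hP
    have := ha _ _ hP'
    omega
  · have := hall _ _ hP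
    have := hall _ _ hP'
    have := hr1 _ _ hA
    exact TwoBlocks.contra ⟨h.good, le_rfl, by omega, hab, hr0, hall, ⟨_, hA⟩, ⟨_, hB⟩⟩
      (Or.inr (by omega))


theorem not_mixed (h : MinUnb S n c) (h11 : ∀ i, S (i + 2) ≠ S i + 2) (hc : c ≠ 0) : False := by
  have hn := h.hn
  have hst := h.good.step
  obtain ⟨a₀, ha₀⟩ := h.light
  obtain ⟨j₀, hj₀⟩ := h.heavy
  obtain ⟨j1, j2, j3⟩ := h.heavy_ends hj₀
  have hc0 : 1 ≤ c := by
    have := h.good.mono (x := a₀) (y := a₀ + n + 2) (by omega)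
    omega
  obtain ⟨B, hB⟩ : ∃ B : ℤ → ℤ, B = fun t => S (j₀ + 1 + t) - S (j₀ + 1) := ⟨_, rfl⟩
  have hBt : ∀ t, S (j₀ + 1 + t) = S (j₀ + 1) + B t := fun t => by rw [hB]; ring
  have hBs : ∀ t, B (t + 1) = B t ∨ B (t + 1) = B t + 1 := fun t => by
    have := hst (j₀ + 1 + t)
    rw [add_assoc (j₀ + 1), hBt, hBt] at this
    omega
  have B0 : B 0 = 0 := by simp [hB]
  have Bn : B n = c := by
    have := hBt n
    rw [show j₀ + 1 + n = j₀ + n + 1 by ring] at this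
    omega
  have hLB : ∀ a, S (a + n + 2) - S a = c → ∀ t, 0 ≤ t → t ≤ n →
      S (a + 1 + t) = S (a + 1) + B t := by
    intro a ha t ht ht'
    have := h.inner a j₀ ha hj₀ t ht ht'
    have := hBt t
    omega
  have hHB : ∀ a, S (a + n + 2) - S a = c + 2 → ∀ t, 0 ≤ t → t ≤ n →
      S (a + 1 + t) = S (a + 1) + B t := by
    intro a ha t ht ht'
    have := h.inner a₀ a ha₀ ha t ht ht'
    have := hLB a₀ ha₀ t ht ht'
    omega
  have hex : ∃ t, 0 ≤ t ∧ t ≤ n - 1 ∧ B (t + 1) = B t + 1 := by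
    by_contra hcon
    push Not at hcon
    have := const_of_steps (S := B) (a := 0) (b := n) (fun x hx hx' =>
      (hBs x).resolve_right (hcon x hx (by omega))) n hn le_rfl
    omega
  obtain ⟨e, he0, hen, he⟩ := hex
  obtain ⟨k, hk0, hke, hk1, hk2⟩ := int_least (p := fun t => B (t + 1) = B t + 1) he0 he
  obtain ⟨l', hln, hel, hl1, hl2⟩ := int_greatest (p := fun t => B (t + 1) = B t + 1) hen he
  obtain ⟨l, rfl⟩ : ∃ l, l' = n - l - 1 := ⟨n - 1 - l', by ring⟩
  rw [sub_add_cancel] at hl1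
  have Bk : ∀ t, 0 ≤ t → t ≤ k → B t = 0 := by
    intro t ht ht'
    rw [← B0]
    exact const_of_steps (fun x hx hx' => (hBs x).resolve_right (hk2 x hx hx')) t ht ht'
  have Bl' : ∀ t, n - l ≤ t → t ≤ n → B t = B (n - l) := by
    intro t ht ht'
    exact const_of_steps (fun x hx hx' => (hBs x).resolve_right (hl2 x (by omega) (by omega))) t
      ht ht'
  have Bl : ∀ t, n - l ≤ t → t ≤ n → B t = c := by
    intro t ht ht'
    rw [Bl' t ht ht', ← Bl' n (by omega) le_rfl, Bn]
  have Bk1 : B (k + 1) = 1 := by rw [hk1, Bk k hk0 le_rfl]; rfl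
  have Bl1 : B (n - l - 1) = c - 1 := by
    have := Bl (n - l) le_rfl (by omega)
    omega
  -- `1 0^k 1` and `1 0^l 1` occur
  have unbk : ∀ x, (∀ t, 0 ≤ t → t ≤ k + 2 → S (x + t) = S x) → Unb S k x j₀ := by
    intro x hx
    refine ⟨hx 1 (by omega) (by omega), ?_, j1, ?_, fun t ht ht' => ?_⟩
    · rw [add_assoc, add_assoc, hx _ (by omega) (by omega), hx _ (by omega) (by omega)]
    · have g1 := hBt k
      have g2 := hBt (k + 1)
      have := Bk k hk0 le_rfl
      rw [show j₀ + 1 + k = j₀ + k + 1 by ring] at g1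
      rw [show j₀ + 1 + (k + 1) = j₀ + k + 2 by ring] at g2
      omega
    · rw [add_assoc, hx _ (by omega) (by omega), hx _ (by omega) (by omega), hBt, Bk t ht ht']
      ring
  have unbl : ∀ x, (∀ t, 0 ≤ t → t ≤ l + 2 → S (x + t) = S x) → Unb S l x (j₀ + n - l) := by
    intro x hx
    have g1 := hBt (n - l)
    have g2 := hBt (n - l - 1)
    have g3 := hBt n
    have := Bl (n - l) (by omega) (by omega)
    rw [show j₀ + 1 + (n - l) = j₀ + n - l + 1 by ring] at g1
    rw [show j₀ + 1 + (n - l - 1) = j₀ + n - l by ring] at g2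
    rw [show j₀ + 1 + n = j₀ + n + 1 by ring] at g3
    refine ⟨hx 1 (by omega) (by omega), ?_, ?_, ?_, fun t ht ht' => ?_⟩
    · rw [add_assoc, add_assoc, hx _ (by omega) (by omega), hx _ (by omega) (by omega)]
    · omega
    · rw [show j₀ + n - l + l + 2 = j₀ + n + 2 by ring,
        show j₀ + n - l + l + 1 = j₀ + n + 1 by ring]
      omega
    · have g4 := hBt (n - l + t)
      have := Bl (n - l + t) (by omega) (by omega)
      rw [show j₀ + 1 + (n - l + t) = j₀ + n - l + 1 + t by ring] at g4
      rw [add_assoc, hx _ (by omega) (by omega), hx _ (by omega) (by omega)]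
      omega
  have hk_pos : 1 ≤ k := by
    by_contra hcon
    obtain rfl : k = 0 := by omega
    have := hBt 1
    rw [show j₀ + 1 + 1 = j₀ + 2 by ring] at this
    rw [zero_add] at Bk1
    exact h11 j₀ (by omega)
  have headz : ∀ a, S (a + n + 2) - S a = c → ∀ t, 0 ≤ t → t ≤ k + 1 → S (a + t) = S a := by
    intro a ha t ht ht'
    obtain ⟨a1, a2, a3⟩ := h.light_ends ha
    rcases eq_or_lt_of_le ht with rfl | hpos
    · simp
    · have := hLB a ha (t - 1) (by omega) (by omega)
      rw [show a + 1 + (t - 1) = a + t by ring, Bk _ (by omega) (by omega)] at this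
      omega
  have tailz : ∀ a, S (a + n + 2) - S a = c → ∀ t, n - l + 1 ≤ t → t ≤ n + 2 →
      S (a + t) = S a + c := by
    intro a ha t ht ht'
    obtain ⟨a1, a2, a3⟩ := h.light_ends ha
    rcases eq_or_lt_of_le ht' with rfl | hlt
    · rw [← add_assoc]; omega
    · have := hLB a ha (t - 1) (by omega) (by omega)
      rw [show a + 1 + (t - 1) = a + t by ring, Bl _ (by omega) (by omega)] at this
      omega
  obtain rfl : k = l := by
    rcases lt_trichotomy k l with hlt | heq | hlt
    · refine (h.min k _ _ hk0 (by omega) (unbk (a₀ + (n - l + 1)) fun t ht ht' => ?_)).elim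
      rw [add_assoc, tailz a₀ ha₀ _ (by omega) (by omega), tailz a₀ ha₀ _ (by omega) (by omega)]
    · exact heq
    · refine (h.min l _ _ (by omega) (by omega) (unbl a₀ fun t ht ht' => ?_)).elim
      exact headz a₀ ha₀ _ (by omega) (by omega)
  have before : ∀ a, S (a + n + 2) - S a = c → S a = S (a - 1) + 1 := by
    intro a ha
    have := hst (a - 1)
    rw [sub_add_cancel] at this
    refine this.resolve_left fun h0 => h.min k _ _ hk0 (by omega) (unbk (a - 1) fun t ht ht' => ?_)
    rcases eq_or_lt_of_le ht with rfl | hpos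
    · simp
    · rw [show a - 1 + t = a + (t - 1) by ring, headz a ha _ (by omega) (by omega), h0]
  have after : ∀ a, S (a + n + 2) - S a = c → S (a + n + 3) = S (a + n + 2) + 1 := by
    intro a ha
    have := hst (a + n + 2)
    rw [show a + n + 2 + 1 = a + n + 3 by ring] at this
    refine this.resolve_left fun h0 => h.min k _ _ hk0 (by omega)
      (unbk (a + (n - k + 1)) fun t ht ht' => ?_)
    rcases eq_or_lt_of_le ht' with rfl | hlt
    · rw [show a + (n - k + 1) + (k + 2) = a + n + 3 by ring, tailz a ha _ (by omega) (by omega),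
        h0]
      omega
    · rw [add_assoc, tailz a ha _ (by omega) (by omega), tailz a ha _ (by omega) (by omega)]
  have r1 : RetPair S (n + 1) (c + 1) 1 1 := by
    refine ⟨j₀, j₀ + 1, ⟨by omega, ?_, ?_, fun x hx hx' => by omega⟩, by ring, by omega⟩
    · rw [← add_assoc]; omega
    · rw [show j₀ + 1 + (n + 1) = j₀ + n + 2 by ring]; omega
  have r2 : RetPair S (n + 1) (c + 1) 1 0 := by
    have g := hBt 1
    have := Bk 1 (by omega) hk_pos
    have g2 := h.bal (j₀ + 2)
    have g3 := hst (j₀ + n + 2)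
    rw [show j₀ + n + 2 + 1 = j₀ + 2 + n + 1 by ring] at g3
    rw [show j₀ + 1 + 1 = j₀ + 2 by ring] at g
    refine ⟨j₀ + 1, j₀ + 2, ⟨by omega, ?_, ?_, fun x hx hx' => by omega⟩, by ring, by omega⟩
    · rw [show j₀ + 1 + (n + 1) = j₀ + n + 2 by ring]; omega
    · rw [← add_assoc]; omega
  have r3 : RetPair S (n + 1) (c + 1) 3 1 := by
    have g1 := before _ ha₀
    have g2 := after _ ha₀
    have g3 := headz _ ha₀ 2 (by omega) (by omega)
    have g4 := tailz _ ha₀ n (by omega) (by omega)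
    obtain ⟨a1, a2, a3⟩ := h.light_ends ha₀
    refine ⟨a₀ - 1, a₀ + 2, ⟨by omega, ?_, ?_, fun x hx hx' => ?_⟩, by ring, by omega⟩
    · rw [show a₀ - 1 + (n + 1) = a₀ + n by ring]; omega
    · rw [show a₀ + 2 + (n + 1) = a₀ + n + 3 by ring]; omega
    · obtain rfl | rfl : x = a₀ ∨ x = a₀ + 1 := by omega
      · rw [← add_assoc]; omega
      · rw [show a₀ + 1 + (n + 1) = a₀ + n + 2 by ring]; omega
  have hall : ∀ x, S (x + 1) = S x + 1 → S (x + n + 2) - S x = c + 2 ∨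
      S (x + 1 + n + 2) - S (x + 1) = c := by
    intro x hx
    by_contra hcon
    push Not at hcon
    refine h.good.four (n + 1) (c + 1) _ _ _ _ _ _ 2 1 (by omega) r1 r2 r3 ?_
      (by omega) (by omega) (by omega) (by omega) (by omega) (by omega)
    have g1 := h.bal (x + 1)
    have g2 := h.bal (x + 2)
    have g3 := h.bal x
    have g0 : S (x - 1 + n + 2) - S (x - 1) ≠ c := fun hl => by
      have := headz _ hl 1 (by omega) (by omega)
      have := headz _ hl 2 (by omega) (by omega)
      rw [show x - 1 + 2 = x + 1 by ring] at this
      rw [sub_add_cancel] at *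
      omega
    rw [show x - 1 + n + 2 = x + n + 1 by ring] at g0
    rw [show x + 1 + n + 1 = x + n + 2 by ring] at g1
    rw [show x + 2 + n + 1 = x + n + 3 by ring] at g2
    rw [show x + 1 + n + 2 = x + n + 3 by ring] at hcon
    have s0 := hst (x - 1)
    have s1 := hst (x + 1)
    have x0 := h11 (x - 1)
    have x1 := h11 x
    rw [show x - 1 + 2 = x + 1 by ring] at x0
    rw [show x + 1 + 1 = x + 2 by ring] at s1
    rw [sub_add_cancel] at s0
    refine ⟨x, x + 2, ⟨by omega, ?_, ?_, fun y hy hy' => ?_⟩, by ring, by omega⟩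
    · rw [← add_assoc]; omega
    · rw [show x + 2 + (n + 1) = x + n + 3 by ring]; omega
    · obtain rfl : y = x + 1 := by omega
      rw [show x + 1 + (n + 1) = x + n + 2 by ring]; omega
  have nheavy : ∀ a, S (a + n + 2) - S a = c →
      S (a + (k + 1) + n + 2) - S (a + (k + 1)) ≠ c + 2 := by
    intro a ha hh
    obtain ⟨a1, a2, a3⟩ := h.light_ends ha
    have g1 := hHB _ hh (n - k - 1) (by omega) (by omega)
    have g2 := hHB _ hh (n - k) (by omega) (by omega)
    rw [show a + (k + 1) + 1 + (n - k - 1) = a + n + 1 by ring] at g1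
    rw [show a + (k + 1) + 1 + (n - k) = a + n + 2 by ring] at g2
    omega
  have lights : ∀ a, S (a + n + 2) - S a = c → S (a + (k + 2) + n + 2) - S (a + (k + 2)) = c := by
    intro a ha
    have g1 := headz a ha (k + 1) (by omega) le_rfl
    have g2 := headz a ha 1 (by omega) (by omega)
    have g3 := hLB a ha (k + 1) (by omega) (by omega)
    rw [show a + 1 + (k + 1) = a + (k + 1) + 1 by ring] at g3
    have := (hall (a + (k + 1)) (by omega)).resolve_left (nheavy a ha)
    rwa [show a + (k + 1) + 1 = a + (k + 2) by ring] at this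
  obtain ⟨y, hy, hyt⟩ := h.good.rec_right j₀ (n + 2) a₀
  have hyh : S (y + n + 2) - S y = c + 2 := by
    have := hyt (n + 2) (by omega) le_rfl
    rw [← add_assoc, ← add_assoc] at this
    omega
  obtain ⟨x, hxy, -, hx, hxm⟩ := int_greatest (p := fun a => S (a + n + 2) - S a = c) hy ha₀
  have hlt : y < x + (k + 2) := by
    by_contra hcon
    exact hxm _ (by omega) (by omega) (lights x hx)
  rcases eq_or_lt_of_le (show y ≤ x + (k + 1) by omega) with rfl | hlt'
  · exact nheavy x hx hyh
  · have g1 := headz x hx (y - x) (by omega) (by omega)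
    have g2 := headz x hx (y + 1 - x) (by omega) (by omega)
    rw [add_sub_cancel] at g1 g2
    have := (h.heavy_ends hyh).1
    omega

theorem contra_of_not_double_one (h : MinUnb S n c) (h11 : ∀ i, S (i + 2) ≠ S i + 2) : False := by
  by_cases hc : c = 0
  · refine h.toCpl.not_ones (fun i hi => h11 i ?_) (by omega)
    simp only [cpl] at hi
    omega
  · exact h.not_mixed h11 hc

theorem contra (h : MinUnb S n c) : False := by
  by_cases h11 : ∀ i, S (i + 2) ≠ S i + 2
  · exact h.contra_of_not_double_one h11
  · push Not at h11
    obtain ⟨j, hj⟩ := h11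
    refine h.toCpl.contra_of_not_double_one fun i hi => h.good.not_double (i := i) ?_ hj
    simp only [cpl] at hi
    omega

end MinUnb

theorem Good.not_unb {S : ℤ → ℤ} (h : Good S) {n i j : ℤ} (hn : 0 ≤ n) : ¬ Unb S n i j := by
  intro hu
  obtain ⟨m, h1, -, ⟨i, j, h2⟩, h3⟩ := int_least (p := fun m => ∃ i j, Unb S m i j) hn ⟨i, j, hu⟩
  exact (MinUnb.of_unb h h1 h2 fun m' i j h0 hlt hm => h3 m' h0 hlt ⟨i, j, hm⟩).contra

/-- All windows of the same length have almost the same weight. -/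
theorem Good.balanced {S : ℤ → ℤ} (h : Good S) {L : ℤ} (hL : 0 ≤ L) (i j : ℤ) :
    S (i + L) - S i ≤ S (j + L) - S j + 1 := by
  by_contra hcon
  obtain ⟨m, a, -, h1, -, h2⟩ := exists_unb h.step (L := L) (i := j) (j := i) hL (by omega)
  exact h.not_unb h1 h2

/-- The deviation of the weight of a window from its average, for a periodic balanced word. -/
theorem Good.window_close {S : ℤ → ℤ} (h : Good S) {T K : ℤ} (hT : 1 ≤ T)
    (hp : ∀ i, S (i + T) = S i + K) {L : ℤ} (hL : 0 ≤ L) (i : ℤ) :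
    L * K - (T - 1) ≤ T * (S (i + L) - S i) ∧ T * (S (i + L) - S i) ≤ L * K + (T - 1) := by
  have hper : S (i + L * T) = S i + L * K := by
    have key : ∀ n : ℕ, S (i + n * T) = S i + n * K := by
      intro n
      induction n with
      | zero => simp
      | succ n ih =>
        push_cast
        rw [show i + (n + 1) * T = i + n * T + T by ring, hp, ih]
        ring
    have := key L.toNat
    rwa [Int.toNat_of_nonneg hL] at this
  have hsum : ∀ n : ℕ, (n + 1) * (S (i + L) - S i) - n ≤ S (i + (n + 1) * L) - S i ∧
      S (i + (n + 1) * L) - S i ≤ (n + 1) * (S (i + L) - S i) + n := by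
    intro n
    induction n with
    | zero => simp
    | succ n ih =>
      have h1 := h.balanced hL i (i + (n + 1) * L)
      have h2 := h.balanced hL (i + (n + 1) * L) i
      push_cast
      rw [show i + (n + 1 + 1) * L = i + (n + 1) * L + L by ring]
      have e : (n + 1 + 1 : ℤ) * (S (i + L) - S i) =
        (n + 1) * (S (i + L) - S i) + (S (i + L) - S i) := by ring
      rw [e]
      omega
  have := hsum (T - 1).toNat
  rw [Int.toNat_of_nonneg (by omega), sub_add_cancel, mul_comm T L, hper] at this
  omega

theorem Good.not_periodic {S : ℤ → ℤ} (h : Good S) {T K : ℤ} (hT : 1 ≤ T)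
    (hp : ∀ i, S (i + T) = S i + K) : False := by
  obtain ⟨T, hT, -, ⟨K, hp⟩, hmin⟩ :=
    int_least (p := fun T => ∃ K, ∀ i, S (i + T) = S i + K) hT ⟨K, hp⟩
  have hcop : IsCoprime K T := by
    rw [Int.isCoprime_iff_gcd_eq_one]
    obtain ⟨K', hK'⟩ := Int.gcd_dvd_left K T
    obtain ⟨T', hT'⟩ := Int.gcd_dvd_right K T
    have hd : (0 : ℤ) < Int.gcd K T := by
      exact_mod_cast Int.gcd_pos_of_ne_zero_right K (by omega)
    generalize (Int.gcd K T) = d at *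
    have hT'pos : 0 < T' := by
      by_contra hcon
      nlinarith
    have hper : ∀ i, S (i + T') = S i + K' := by
      intro i
      obtain ⟨h1, h2⟩ := h.window_close hT hp hT'pos.le i
      have e1 : T' * K = T * K' := by rw [hK', hT']; ring
      rw [e1] at h1 h2
      have a1 : S (i + T') - S i < K' + 1 := by
        by_contra hcon
        nlinarith
      have a2 : K' - 1 < S (i + T') - S i := by
        by_contra hcon
        nlinarith
      omega
    have hle : T ≤ T' := by
      by_contra hcon
      exact hmin T' (by omega) (by omega) ⟨K', hper⟩
    have : (d : ℤ) ≤ 1 := by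
      by_contra hcon
      nlinarith
    omega
  obtain ⟨a, b, hab⟩ := hcop
  obtain ⟨L, c, hL, hLc⟩ : ∃ L c : ℤ, 1 ≤ L ∧ L * K = T * c + 1 := by
    refine ⟨a + T * (|a| + 1), (|a| + 1) * K - b, ?_, ?_⟩
    · nlinarith [neg_abs_le a, abs_nonneg a]
    · linear_combination hab
  obtain ⟨y, hy⟩ : ∃ y : ℤ → ℤ, y = fun i => i * K - T * S i := ⟨_, rfl⟩
  have hy' : ∀ i, y i = i * K - T * S i := fun i => by rw [hy]
  have hrange : ∀ i j, y i ≤ y j + (T - 1) := by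
    intro i j
    rw [hy', hy']
    rcases le_total i j with hij | hij
    · have := (h.window_close hT hp (L := j - i) (by omega) i).2
      rw [add_sub_cancel] at this
      linarith
    · have := (h.window_close hT hp (L := i - j) (by omega) j).1
      rw [add_sub_cancel] at this
      linarith
  have hcl : ∀ i, S (i + L) - S i = c + 1 ↔ y i = y (i + L) + (T - 1) := by
    intro i
    rw [hy', hy']
    constructor
    · intro h1
      linear_combination -hLc + T * h1
    · intro h1
      have : T * (S (i + L) - S i - (c + 1)) = 0 := by linear_combination h1 + hLc
      rcases mul_eq_zero.1 this with h2 | h2 <;> omega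
  obtain ⟨i, hi⟩ : ∃ i, ∀ j, y j ≤ y i := by
    obtain ⟨v, -, -, ⟨i, rfl⟩, hv⟩ := int_greatest (p := fun v => ∃ i, y i = v) (i := y 0)
      (b := y 0 + (T - 1)) (by omega) ⟨0, rfl⟩
    refine ⟨i, fun j => ?_⟩
    by_contra hcon
    exact hv (y j) (hrange _ _) (by omega) ⟨j, rfl⟩
  have hiL : S (i + L) - S i = c + 1 := by
    have h1 := hi (i + L)
    have h2 := hrange i (i + L)
    rw [hy', hy'] at h1 h2
    have e1 : 0 < S (i + L) - S i - c := by
      by_contra hcon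
      nlinarith
    have e2 : S (i + L) - S i - c < 2 := by
      by_contra hcon
      nlinarith
    omega
  refine h.one L (c + 1) i T K hL hiL ?_
  rintro l s ⟨p, q, ⟨hpq, h1, h2, h3⟩, rfl, rfl⟩
  have hnext : S (p + T + L) - S (p + T) = c + 1 := by
    rw [show p + T + L = p + L + T by ring, hp, hp]
    omega
  have hle : q ≤ p + T := by
    by_contra hcon
    exact h3 (p + T) (by omega) (by omega) hnext
  have hyy : y p = y q := by
    have g1 := (hcl p).1 h1
    have g2 := (hcl q).1 h2
    have g3 := hrange p (q + L)
    have g4 := hrange q (p + L)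
    omega
  have hdvd : T ∣ q - p := by
    have : T ∣ (q - p) * K := by
      rw [hy', hy'] at hyy
      exact ⟨S q - S p, by linear_combination -hyy⟩
    exact IsCoprime.dvd_of_dvd_mul_right (IsCoprime.symm ⟨a, b, hab⟩) this
  have hq : q = p + T := by
    have := Int.le_of_dvd (by omega) hdvd
    omega
  subst hq
  have := hp p
  omega

/-- The number of letters `true` among the first `n` letters of `w`. -/
def prefixSum (w : ℕ → Bool) (n : ℕ) : ℤ := ∑ k ∈ Finset.range n, if w k then 1 else 0

theorem prefixSum_zero (w : ℕ → Bool) : prefixSum w 0 = 0 := rfl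

theorem prefixSum_succ (w : ℕ → Bool) (n : ℕ) :
    prefixSum w (n + 1) = prefixSum w n + if w n then 1 else 0 := Finset.sum_range_succ _ _

theorem wordAt_length {α : Type*} (w : ℕ → α) (i n : ℕ) : (wordAt w i n).length = n := by
  simp [wordAt]

theorem wordAt_succ {α : Type*} (w : ℕ → α) (i n : ℕ) :
    wordAt w i (n + 1) = wordAt w i n ++ [w (i + n)] := by
  simp [wordAt, List.range_succ]

theorem wordAt_eq_iff {α : Type*} {w : ℕ → α} {i j n : ℕ} :
    wordAt w i n = wordAt w j n ↔ ∀ t < n, w (i + t) = w (j + t) := by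
  simp [wordAt]

theorem count_wordAt (w : ℕ → Bool) (i n : ℕ) :
    ((wordAt w i n).count true : ℤ) = prefixSum w (i + n) - prefixSum w i := by
  induction n with
  | zero => simp [wordAt]
  | succ n ih =>
    rw [wordAt_succ, List.count_append, Nat.cast_add, ih, ← add_assoc, prefixSum_succ]
    cases w (i + n) <;> simp; ring

/-- The length and the weight of a finite word. -/
def par (u : List Bool) : ℤ × ℤ := (u.length, u.count true)

theorem abEquiv_iff_par {u v : List Bool} : AbEquiv u v ↔ par u = par v := by
  have hu := List.count_false_add_count_true u
  have hv := List.count_false_add_count_true v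
  simp only [AbEquiv, par, Prod.mk.injEq, Bool.forall_bool]
  omega

theorem exactlyKAbReturns_iff {w : ℕ → Bool} {u : List Bool} {k : ℕ} :
    ExactlyKAbReturns w u k ↔ (par '' semiAbReturns w u).encard = k := by
  simp only [ExactlyKAbReturns, abEquiv_iff_par]
  constructor
  · rintro ⟨f, h1, h2, h3⟩
    have e : par '' semiAbReturns w u = Set.range (par ∘ f) := by
      ext p
      constructor
      · rintro ⟨r, hr, rfl⟩
        obtain ⟨i, hi⟩ := h2 r hr
        exact ⟨i, hi.symm⟩
      · rintro ⟨i, rfl⟩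
        obtain ⟨r, hr, hi⟩ := h3 i
        exact ⟨r, hr, hi⟩
    have hinj : Function.Injective (par ∘ f) := fun i j hij => h1 i j hij
    rw [e, ← Set.image_univ, hinj.encard_image]
    simp
  · intro h
    have hfin := Set.finite_of_encard_eq_coe h
    have : Finite (par '' semiAbReturns w u) := hfin
    have hcard : Nat.card (par '' semiAbReturns w u) = k := by
      rw [Nat.card_coe_set_eq, Set.ncard, h]
      simp
    obtain ⟨e⟩ : Nonempty (Fin k ≃ par '' semiAbReturns w u) :=
      ⟨(Finite.equivFinOfCardEq hcard).symm⟩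
    choose r hr hr' using fun i => (e i).2
    refine ⟨r, fun i j hij => ?_, fun r' h' => ?_, fun i => ⟨r i, hr i, rfl⟩⟩
    · rw [hr', hr'] at hij
      exact e.injective (Subtype.ext hij)
    · refine ⟨e.symm ⟨par r', r', h', rfl⟩, ?_⟩
      rw [hr']
      simp

/-- `(l, s)` is the pair (length, weight) of an abelian return to the class `(L, m)` in the
one-sided infinite word with prefix sums `P`. -/
def NatRetPair (P : ℕ → ℤ) (L : ℕ) (m l s : ℤ) : Prop :=
  ∃ i j : ℕ, i < j ∧ P (i + L) - P i = m ∧ P (j + L) - P j = m ∧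
    (∀ k, i < k → k < j → P (k + L) - P k ≠ m) ∧ (j : ℤ) - i = l ∧ P j - P i = s

theorem mem_abOcc_iff {w : ℕ → Bool} {u : List Bool} {i : ℕ} :
    i ∈ abOcc w u ↔ prefixSum w (i + u.length) - prefixSum w i = u.count true := by
  simp only [abOcc, Set.mem_ofPred_eq, abEquiv_iff_par, par, wordAt_length, count_wordAt,
    Prod.mk.injEq, true_and]

theorem par_image_semiAbReturns (w : ℕ → Bool) (u : List Bool) :
    par '' semiAbReturns w u =
      {p | NatRetPair (prefixSum w) u.length (u.count true) p.1 p.2} := by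
  ext ⟨l, s⟩
  constructor
  · rintro ⟨_, ⟨i, j, hi, hj, hij, hk, rfl⟩, hp⟩
    simp only [par, wordAt_length, count_wordAt, Prod.mk.injEq] at hp
    rw [Nat.add_sub_cancel' hij.le] at hp
    refine ⟨i, j, hij, mem_abOcc_iff.1 hi, mem_abOcc_iff.1 hj, fun k h1 h2 h3 => ?_, ?_, hp.2⟩
    · exact hk k h1 h2 (mem_abOcc_iff.2 h3)
    · rw [← hp.1, Nat.cast_sub hij.le]
  · rintro ⟨i, j, hij, hi, hj, hk, h1, h2⟩
    refine ⟨wordAt w i (j - i), ⟨i, j, mem_abOcc_iff.2 hi, mem_abOcc_iff.2 hj, hij,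
      fun k h1 h2 h3 => hk k h1 h2 (mem_abOcc_iff.1 h3), rfl⟩, ?_⟩
    simp only [par, wordAt_length, count_wordAt, Prod.mk.injEq]
    rw [Nat.add_sub_cancel' hij.le, Nat.cast_sub hij.le]
    exact ⟨h1, h2⟩

theorem RecurrentW.prefixSum {w : ℕ → Bool} (h : RecurrentW w) (i n N : ℕ) :
    ∃ j, N ≤ j ∧ ∀ t ≤ n, prefixSum w (j + t) - prefixSum w j =
      prefixSum w (i + t) - prefixSum w i := by
  obtain ⟨j, hj, hij⟩ := h (wordAt w i n) ⟨i, by rw [wordAt_length]⟩ N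
  rw [wordAt_length, wordAt_eq_iff] at hij
  refine ⟨j, hj, fun t ht => ?_⟩
  rw [← count_wordAt, ← count_wordAt, wordAt_eq_iff.2 fun x hx => hij x (by omega)]

/-- `S` is the prefix-sum function of a bi-infinite word, the factors of which are the factors of
the one-sided word with prefix sums `P`, each occurring arbitrarily far on both sides. -/
structure BiInfinite (P : ℕ → ℤ) (S : ℤ → ℤ) : Prop where
  step : ∀ i, S (i + 1) = S i ∨ S (i + 1) = S i + 1
  window : ∀ (i : ℤ) (n : ℕ), ∃ x : ℕ, ∀ t : ℕ, t ≤ n → S (i + t) - S i = P (x + t) - P x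
  right : ∀ (x n : ℕ) (N : ℤ), ∃ i, N ≤ i ∧ ∀ t : ℕ, t ≤ n → S (i + t) - S i = P (x + t) - P x
  left : ∀ (x n : ℕ) (N : ℤ), ∃ i, i ≤ N ∧ ∀ t : ℕ, t ≤ n → S (i + t) - S i = P (x + t) - P x

theorem exists_biInfinite {P : ℕ → ℤ} (hP : P 0 = 0)
    (hstep : ∀ i, P (i + 1) = P i ∨ P (i + 1) = P i + 1)
    (hrec : ∀ i n N, ∃ j, N ≤ j ∧ ∀ t ≤ n, P (j + t) - P j = P (i + t) - P i) :
    ∃ S, BiInfinite P S := by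
  choose p hp hp' using hrec 0
  simp only [zero_add, hP, sub_zero] at hp'
  -- `c k` is the position of the origin in the `k`th prefix, `N k` the length of that prefix
  obtain ⟨st, h0, hst⟩ : ∃ st : ℕ → ℕ × ℕ, st 0 = (0, 0) ∧ ∀ k, st (k + 1) =
      ((st k).1 + p (st k).2 1,
        p (k + 1) ((st k).1 + p (st k).2 1 + (st k).2 + k + 1) + k + 1) :=
    ⟨fun n => Nat.rec (0, 0) (fun k s => (s.1 + p s.2 1, p (k + 1) (s.1 + p s.2 1 + s.2 + k + 1) +
      k + 1)) n, rfl, fun _ => rfl⟩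
  obtain ⟨c, hc⟩ : ∃ c : ℕ → ℕ, ∀ k, c k = (st k).1 := ⟨_, fun _ => rfl⟩
  obtain ⟨N, hN⟩ : ∃ N : ℕ → ℕ, ∀ k, N k = (st k).2 := ⟨_, fun _ => rfl⟩
  have c0 : c 0 = 0 := by rw [hc, h0]
  have N0 : N 0 = 0 := by rw [hN, h0]
  have cs : ∀ k, c (k + 1) = c k + p (N k) 1 := fun k => by rw [hc, hst, hc, hN]
  have Ns : ∀ k, N (k + 1) = p (k + 1) (c (k + 1) + N k + k + 1) + k + 1 := fun k => by
    rw [cs, hN, hst, hc, hN]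
  have cN : ∀ k, c k + k ≤ N k := by
    intro k
    cases k with
    | zero => omega
    | succ k => have := hp (k + 1) (c (k + 1) + N k + k + 1); rw [Ns]; omega
  have ck : ∀ k, k ≤ c k := by
    intro k
    induction k with
    | zero => omega
    | succ k ih => have := hp (N k) 1; rw [cs]; omega
  have key : ∀ k m, k ≤ m → c k ≤ c m ∧ N k + c m ≤ N m + c k ∧
      ∀ x ≤ N k, P (x + (c m - c k)) - P (c m) = P x - P (c k) := by
    intro k m hkm
    induction m, hkm using Nat.le_induction with
    | base => simp
    | succ m hm ih =>
      obtain ⟨i1, i2, i3⟩ := ih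
      have g1 := cs m
      have g2 := hp (N m) 1
      have g3 := Ns m
      have g4 := hp (m + 1) (c (m + 1) + N m + m + 1)
      refine ⟨by omega, by omega, fun x hx => ?_⟩
      have a1 := hp' (N m) 1 (x + (c m - c k)) (by omega)
      have a2 := hp' (N m) 1 (c m) (by have := cN m; omega)
      have a3 := i3 x hx
      rw [show x + (c (m + 1) - c k) = p (N m) 1 + (x + (c m - c k)) by omega,
        show c (m + 1) = p (N m) 1 + c m by omega]
      omega
  obtain ⟨S, hS⟩ : ∃ S : ℤ → ℤ, ∀ z, S z = P (z + c z.natAbs).toNat - P (c z.natAbs) :=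
    ⟨_, fun _ => rfl⟩
  have hSP : ∀ k x : ℕ, x ≤ N k → S ((x : ℤ) - c k) = P x - P (c k) := by
    intro k x hx
    rw [hS]
    generalize hr : ((x : ℤ) - c k).natAbs = r
    have r1 := cN r
    have r2 := ck r
    obtain ⟨k1, k2, k3⟩ := key k (max k r) (le_max_left _ _)
    obtain ⟨l1, l2, l3⟩ := key r (max k r) (le_max_right _ _)
    have a1 := k3 x hx
    have a2 := l3 ((x : ℤ) - c k + c r).toNat (by omega)
    rw [show ((x : ℤ) - c k + c r).toNat + (c (max k r) - c r) = x + (c (max k r) - c k) by omega]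
      at a2
    omega
  have hwin : ∀ (i : ℤ) (n : ℕ), ∃ x : ℕ, ∀ t : ℕ, t ≤ n → S (i + t) - S i = P (x + t) - P x := by
    intro i n
    have g1 := ck (i.natAbs + n)
    have g2 := cN (i.natAbs + n)
    refine ⟨(i + c (i.natAbs + n)).toNat, fun t ht => ?_⟩
    have a1 := hSP (i.natAbs + n) ((i + c (i.natAbs + n)).toNat + t) (by omega)
    have a2 := hSP (i.natAbs + n) (i + c (i.natAbs + n)).toNat (by omega)
    rw [show (((i + c (i.natAbs + n)).toNat + t : ℕ) : ℤ) - c (i.natAbs + n) = i + t by omega] at a1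
    rw [show (((i + c (i.natAbs + n)).toNat : ℕ) : ℤ) - c (i.natAbs + n) = i by omega] at a2
    omega
  refine ⟨S, ⟨fun i => ?_, hwin, fun x n M => ?_, fun x n M => ?_⟩⟩
  · obtain ⟨x, hx⟩ := hwin i 1
    have := hx 1 le_rfl
    have := hstep x
    push_cast at *
    omega
  · obtain ⟨k, hk⟩ : ∃ k, k = x + n + M.natAbs := ⟨_, rfl⟩
    have g1 := hp (k + 1) (c (k + 1) + N k + k + 1)
    have g2 := Ns k
    have g3 := hp' (k + 1) (c (k + 1) + N k + k + 1)
    generalize p (k + 1) (c (k + 1) + N k + k + 1) = q at g1 g2 g3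
    refine ⟨q + x - c (k + 1), by omega, fun t ht => ?_⟩
    have a1 := hSP (k + 1) (q + x) (by omega)
    have a2 := hSP (k + 1) (q + x + t) (by omega)
    have a3 := g3 x (by omega)
    have a4 := g3 (x + t) (by omega)
    rw [← add_assoc] at a4
    push_cast at a1 a2
    rw [show (q : ℤ) + x - c (k + 1) + t = q + x + t - c (k + 1) by ring]
    omega
  · obtain ⟨k, hk⟩ : ∃ k, k = x + n + M.natAbs := ⟨_, rfl⟩
    have g1 := ck k
    have g2 := cN k
    refine ⟨x - c k, by omega, fun t ht => ?_⟩
    have a1 := hSP k x (by omega)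
    have a2 := hSP k (x + t) (by omega)
    push_cast at a2
    rw [show (x : ℤ) - c k + t = x + t - c k by ring]
    omega

theorem BiInfinite.retPair_iff {P : ℕ → ℤ} {S : ℤ → ℤ} (h : BiInfinite P S) {L : ℕ} {m l s : ℤ} :
    RetPair S L m l s ↔ NatRetPair P L m l s := by
  constructor
  · rintro ⟨i, j, ⟨hij, hi, hj, hk⟩, h1, h2⟩
    obtain ⟨x, hx⟩ := h.window i ((j - i).toNat + L)
    have e : ∀ t : ℕ, t ≤ (j - i).toNat →
        S (i + t + L) - S (i + t) = P (x + t + L) - P (x + t) := by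
      intro t ht
      have a1 := hx t (by omega)
      have a2 := hx (t + L) (by omega)
      rw [← add_assoc, Nat.cast_add, ← add_assoc] at a2
      omega
    have ej : i + ((j - i).toNat : ℤ) = j := by omega
    have e0 := e 0 (Nat.zero_le _)
    have e1 := e (j - i).toNat le_rfl
    have e2 := hx (j - i).toNat (by omega)
    rw [ej] at e1 e2
    simp only [Nat.cast_zero, add_zero] at e0
    refine ⟨x, x + (j - i).toNat, by omega, by omega, by omega, fun k k1 k2 k3 => ?_, by omega,
      by omega⟩
    have e3 := e (k - x) (by omega)
    rw [Nat.add_sub_cancel' k1.le, k3] at e3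
    exact hk _ (by omega) (by omega) e3
  · rintro ⟨i, j, hij, hi, hj, hk, h1, h2⟩
    obtain ⟨x, -, hx⟩ := h.right i (j - i + L) 0
    have e : ∀ t : ℕ, t ≤ j - i → S (x + t + L) - S (x + t) = P (i + t + L) - P (i + t) := by
      intro t ht
      have a1 := hx t (by omega)
      have a2 := hx (t + L) (by omega)
      rw [← add_assoc, Nat.cast_add, ← add_assoc] at a2
      omega
    have e0 := e 0 (Nat.zero_le _)
    have e1 := e (j - i) le_rfl
    have e2 := hx (j - i) (by omega)
    rw [Nat.add_sub_cancel' hij.le] at e1 e2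
    simp only [Nat.cast_zero, add_zero] at e0
    refine ⟨x, x + (j - i : ℕ), ⟨by omega, by omega, by omega, fun k k1 k2 k3 => ?_⟩, by omega,
      by omega⟩
    have e3 := e (k - x).toNat (by omega)
    rw [show x + ((k - x).toNat : ℤ) = k by omega, k3] at e3
    exact hk _ (by omega) (by omega) e3.symm

theorem BiInfinite.rec_right {P : ℕ → ℤ} {S : ℤ → ℤ} (h : BiInfinite P S) (i n N : ℤ) :
    ∃ j, N ≤ j ∧ ∀ t, 0 ≤ t → t ≤ n → S (j + t) - S j = S (i + t) - S i := by
  obtain ⟨x, hx⟩ := h.window i n.toNat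
  obtain ⟨j, hj, hjx⟩ := h.right x n.toNat N
  refine ⟨j, hj, fun t h0 h1 => ?_⟩
  lift t to ℕ using h0
  rw [hx t (by omega), hjx t (by omega)]

theorem BiInfinite.rec_left {P : ℕ → ℤ} {S : ℤ → ℤ} (h : BiInfinite P S) (i n N : ℤ) :
    ∃ j, j ≤ N ∧ ∀ t, 0 ≤ t → t ≤ n → S (j + t) - S j = S (i + t) - S i := by
  obtain ⟨x, hx⟩ := h.window i n.toNat
  obtain ⟨j, hj, hjx⟩ := h.left x n.toNat N
  refine ⟨j, hj, fun t h0 h1 => ?_⟩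
  lift t to ℕ using h0
  rw [hx t (by omega), hjx t (by omega)]

theorem BiInfinite.encard_returns {w : ℕ → Bool} {S : ℤ → ℤ} (h : BiInfinite (prefixSum w) S)
    (u : List Bool) : (par '' semiAbReturns w u).encard =
      {p : ℤ × ℤ | RetPair S u.length (u.count true) p.1 p.2}.encard := by
  rw [par_image_semiAbReturns]
  simp only [h.retPair_iff]

theorem BiInfinite.good {w : ℕ → Bool} {S : ℤ → ℤ} (h : BiInfinite (prefixSum w) S)
    (H : ∀ u, IsFactorW w u → u ≠ [] → (ExactlyKAbReturns w u 2 ∨ ExactlyKAbReturns w u 3)) :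
    Good S := by
  have H' : ∀ L m i : ℤ, 1 ≤ L → S (i + L) - S i = m →
      {p : ℤ × ℤ | RetPair S L m p.1 p.2}.encard = 2 ∨
      {p : ℤ × ℤ | RetPair S L m p.1 p.2}.encard = 3 := by
    intro L m i hL him
    lift L to ℕ using by omega
    obtain ⟨x, hx⟩ := h.window i L
    have hx := hx L le_rfl
    have := H (wordAt w x L) ⟨x, by rw [wordAt_length]⟩ fun h0 => by
      have := wordAt_length w x L
      rw [h0, List.length_nil] at this
      omega
    rw [exactlyKAbReturns_iff, exactlyKAbReturns_iff, h.encard_returns, wordAt_length,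
      count_wordAt, ← hx, him] at this
    exact_mod_cast this
  refine ⟨h.step, h.rec_right, h.rec_left, ?_, ?_⟩
  · intro L m l₁ s₁ l₂ s₂ l₃ s₃ l₄ s₄ hL h1 h2 h3 h4 h12 h13 h14 h23 h24 h34
    have ⟨i, j, ⟨_, hi, _⟩, _⟩ := h1
    have hsub : {(l₁, s₁), (l₂, s₂), (l₃, s₃), (l₄, s₄)} ⊆
        {p : ℤ × ℤ | RetPair S L m p.1 p.2} := by
      rintro p (rfl | rfl | rfl | rfl) <;> assumption
    have hc := Set.encard_le_encard hsub
    rw [Set.encard_insert_of_notMem, Set.encard_insert_of_notMem, Set.encard_pair] at hc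
    · rcases H' L m i hL hi with e | e <;> rw [e] at hc <;> revert hc <;> decide
    · simp only [ne_eq, Prod.mk.injEq]; tauto
    · simp only [Set.mem_insert_iff, Set.mem_singleton_iff, Prod.mk.injEq]; tauto
    · simp only [Set.mem_insert_iff, Set.mem_singleton_iff, Prod.mk.injEq]; tauto
  · intro L m i l s hL hi hall
    have hsub : {p : ℤ × ℤ | RetPair S L m p.1 p.2} ⊆ {(l, s)} := by
      rintro ⟨l', s'⟩ hp
      obtain ⟨rfl, rfl⟩ := hall l' s' hp
      rfl
    have hc := Set.encard_le_encard hsub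
    rw [Set.encard_singleton] at hc
    rcases H' L m i hL hi with e | e <;> rw [e] at hc <;> revert hc <;> decide

theorem setOf_factor_eq_range (w : ℕ → Bool) (n : ℕ) :
    {u | u.length = n ∧ IsFactorW w u} = Set.range fun i => wordAt w i n := by
  ext u
  constructor
  · rintro ⟨rfl, i, hi⟩
    exact ⟨i, hi.symm⟩
  · rintro ⟨i, rfl⟩
    exact ⟨wordAt_length w i n, i, by rw [wordAt_length]⟩

theorem finite_range_wordAt (w : ℕ → Bool) (n : ℕ) : (Set.range fun i => wordAt w i n).Finite :=
  (List.finite_length_eq Bool n).subset fun _ ⟨_, hi⟩ => hi ▸ wordAt_length w _ n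

theorem complexityW_eq (w : ℕ → Bool) (n : ℕ) :
    complexityW w n = (Set.range fun i => wordAt w i n).ncard := by
  rw [complexityW, setOf_factor_eq_range]

theorem complexityW_zero (w : ℕ → Bool) : complexityW w 0 = 1 := by
  rw [complexityW_eq]
  simp [wordAt]

theorem image_dropLast_range (w : ℕ → Bool) (n : ℕ) :
    List.dropLast '' (Set.range fun i => wordAt w i (n + 1)) = Set.range fun i => wordAt w i n := by
  rw [← Set.range_comp]
  congr 1
  funext i
  simp [wordAt_succ]

/-- If `w` is not ultimately periodic, then it has right special factors of every length. -/
theorem exists_rightSpecial {w : ℕ → Bool} (hw : ¬ UltPeriodicW w) (n : ℕ) :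
    ∃ i j, wordAt w i n = wordAt w j n ∧ w (i + n) = false ∧ w (j + n) = true := by
  by_contra hcon
  push Not at hcon
  have hdet : ∀ i j, wordAt w i n = wordAt w j n → w (i + n) = w (j + n) := by
    intro i j hij
    have h1 := hcon i j hij
    have h2 := hcon j i hij.symm
    cases hi : w (i + n) <;> cases hj : w (j + n) <;> simp_all
  have : Finite (Set.range fun i => wordAt w i n) := finite_range_wordAt w n
  obtain ⟨a, b, hab, hw'⟩ :=
    Finite.exists_ne_map_eq_of_infinite (Set.rangeFactorization fun i => wordAt w i n)
  replace hw' : wordAt w a n = wordAt w b n := congrArg Subtype.val hw'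
  wlog hlt : a < b generalizing a b
  · exact this b a hab.symm hw'.symm (by omega)
  have key : ∀ s, w (a + s) = w (b + s) := by
    intro s
    induction s using Nat.strong_induction_on with
    | _ s ih =>
      rcases Nat.lt_or_ge s n with hs | hs
      · exact wordAt_eq_iff.1 hw' s hs
      · have := hdet (a + (s - n)) (b + (s - n)) <| wordAt_eq_iff.2 fun t ht => by
          rw [add_assoc, add_assoc]
          exact ih _ (by omega)
        rwa [add_assoc, add_assoc, Nat.sub_add_cancel hs] at this
  refine hw ⟨b - a, by omega, a, fun m hm => ?_⟩
  have := key (m - a)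
  rw [show a + (m - a) = m by omega, show b + (m - a) = m + (b - a) by omega] at this
  exact this.symm

theorem complexityW_lt_succ {w : ℕ → Bool} (hw : ¬ UltPeriodicW w) (n : ℕ) :
    complexityW w n < complexityW w (n + 1) := by
  obtain ⟨i, j, h1, h2, h3⟩ := exists_rightSpecial hw n
  rw [complexityW_eq, complexityW_eq, ← image_dropLast_range]
  refine lt_of_le_of_ne (Set.ncard_image_le (finite_range_wordAt w _)) fun he => ?_
  have := (Set.ncard_image_iff (finite_range_wordAt w _)).1 he ⟨i, rfl⟩ ⟨j, rfl⟩
    (by simpa [wordAt_succ] using h1)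
  simp [wordAt_succ, h1, h2, h3] at this

theorem complexityW_succ_le {w : ℕ → Bool} {n : ℕ}
    (hu : ∀ i j i' j', wordAt w i n = wordAt w j n → w (i + n) = false → w (j + n) = true →
      wordAt w i' n = wordAt w j' n → w (i' + n) = false → w (j' + n) = true →
      wordAt w i n = wordAt w i' n) :
    complexityW w (n + 1) ≤ complexityW w n + 1 := by
  by_cases hex : ∃ i j, wordAt w i n = wordAt w j n ∧ w (i + n) = false ∧ w (j + n) = true
  · obtain ⟨i, j, h1, h2, h3⟩ := hex
    rw [complexityW_eq, complexityW_eq, ← Set.ncard_sdiff_singleton_add_one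
      (Set.mem_range_self (f := fun k => wordAt w k (n + 1)) j) (finite_range_wordAt w _)]
    refine Nat.add_le_add_right (Set.ncard_le_ncard_of_injOn List.dropLast ?_ ?_
      (finite_range_wordAt w _)) 1
    · rintro _ ⟨⟨k, rfl⟩, -⟩
      exact ⟨k, by simp [wordAt_succ]⟩
    · rintro _ ⟨⟨k, rfl⟩, hk⟩ _ ⟨⟨l, rfl⟩, hl⟩ hkl
      simp only [wordAt_succ, List.dropLast_concat, Set.mem_singleton_iff] at hkl hk hl ⊢
      rw [hkl]
      have g1 := hu i j k l h1 h2 h3 hkl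
      have g2 := hu i j l k h1 h2 h3 hkl.symm
      cases hk' : w (k + n) <;> cases hl' : w (l + n)
      · rfl
      · have := g1 hk' hl'
        simp [hl', h3, ← hkl, ← this, h1] at hl
      · have := g2 hl' hk'
        simp [hk', h3, hkl, ← this, h1] at hk
      · rfl
  · push Not at hex
    rw [complexityW_eq, complexityW_eq]
    refine (Set.ncard_le_ncard_of_injOn List.dropLast ?_ ?_
      (finite_range_wordAt w _)).trans (Nat.le_succ _)
    · rintro _ ⟨k, rfl⟩
      exact ⟨k, by simp [wordAt_succ]⟩
    · rintro _ ⟨k, rfl⟩ _ ⟨l, rfl⟩ hkl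
      simp only [wordAt_succ, List.dropLast_concat] at hkl ⊢
      rw [hkl]
      have g1 := hex k l hkl
      have g2 := hex l k hkl.symm
      cases hk' : w (k + n) <;> cases hl' : w (l + n) <;> simp_all

/-- A word with at most one more factor of length `n + 1` than of length `n` has at most one right
special factor of length `n`. -/
theorem rightSpecial_unique {w : ℕ → Bool} {n : ℕ}
    (hc : complexityW w (n + 1) ≤ complexityW w n + 1) {i j i' j' : ℕ}
    (h1 : wordAt w i n = wordAt w j n) (h2 : w (i + n) = false) (h3 : w (j + n) = true)
    (h1' : wordAt w i' n = wordAt w j' n) (h2' : w (i' + n) = false) (h3' : w (j' + n) = true) :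
    wordAt w i n = wordAt w i' n := by
  by_contra hne
  have hjj : wordAt w j (n + 1) ≠ wordAt w j' (n + 1) := by
    simp [wordAt_succ, h3, h3', ← h1, ← h1', hne]
  have hsub : {wordAt w j (n + 1), wordAt w j' (n + 1)} ⊆
      Set.range fun k => wordAt w k (n + 1) := by
    rintro _ (rfl | rfl) <;> exact ⟨_, rfl⟩
  have e := Set.ncard_sdiff_add_ncard_of_subset hsub (finite_range_wordAt w _)
  rw [Set.ncard_pair hjj] at e
  have hle : (Set.range fun k => wordAt w k n).ncard ≤ ((Set.range fun k => wordAt w k (n + 1)) \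
      {wordAt w j (n + 1), wordAt w j' (n + 1)}).ncard := by
    refine le_trans (Set.ncard_le_ncard (t := List.dropLast '' ((Set.range fun k =>
      wordAt w k (n + 1)) \ {wordAt w j (n + 1), wordAt w j' (n + 1)})) ?_
      (((finite_range_wordAt w _).sdiff).image _)) (Set.ncard_image_le
      ((finite_range_wordAt w _).sdiff))
    rintro _ ⟨k, rfl⟩
    by_cases hk : wordAt w k (n + 1) = wordAt w j (n + 1) ∨
      wordAt w k (n + 1) = wordAt w j' (n + 1)
    · rcases hk with hk | hk
      · refine ⟨wordAt w i (n + 1), ⟨⟨i, rfl⟩, ?_⟩, ?_⟩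
        · simp [wordAt_succ, h2, h3, h3']
        · simp only [wordAt_succ] at hk
          simp [wordAt_succ, (List.append_inj hk (by simp [wordAt_length])).1, h1]
      · refine ⟨wordAt w i' (n + 1), ⟨⟨i', rfl⟩, ?_⟩, ?_⟩
        · simp [wordAt_succ, h2', h3, h3']
        · simp only [wordAt_succ] at hk
          simp [wordAt_succ, (List.append_inj hk (by simp [wordAt_length])).1, h1']
    · exact ⟨wordAt w k (n + 1), ⟨⟨k, rfl⟩, hk⟩, by simp [wordAt_succ]⟩
  rw [complexityW_eq, complexityW_eq] at hc
  omega

theorem rightSpecial_unique_of_balanced {w : ℕ → Bool}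
    (hb : ∀ n i j, prefixSum w (i + n) - prefixSum w i ≤ prefixSum w (j + n) - prefixSum w j + 1)
    {n i j i' j' : ℕ}
    (h1 : wordAt w i n = wordAt w j n) (h2 : w (i + n) = false) (h3 : w (j + n) = true)
    (h1' : wordAt w i' n = wordAt w j' n) (h2' : w (i' + n) = false) (h3' : w (j' + n) = true) :
    wordAt w i n = wordAt w i' n := by
  classical
  rw [wordAt_eq_iff] at *
  by_contra hne
  push Not at hne
  obtain ⟨t, ht, hne, hmax⟩ : ∃ t, t < n ∧ w (i + t) ≠ w (i' + t) ∧
      ∀ s, t < s → s < n → w (i + s) = w (i' + s) := by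
    refine ⟨Nat.findGreatest (fun t => t < n ∧ w (i + t) ≠ w (i' + t)) n, ?_⟩
    obtain ⟨t, ht, hne⟩ := hne
    have g := Nat.findGreatest_spec (P := fun t => t < n ∧ w (i + t) ≠ w (i' + t)) ht.le ⟨ht, hne⟩
    refine ⟨g.1, g.2, fun s hs hs' => ?_⟩
    have := Nat.findGreatest_is_greatest hs hs'.le
    simp only [not_and, not_not] at this
    exact this hs'
  have main : ∀ a b : ℕ, w (a + t) = true → w (b + t) = false → w (a + n) = true →
      w (b + n) = false → (∀ s, t < s → s < n → w (a + s) = w (b + s)) → False := by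
    intro a b g1 g2 g3 g4 g5
    have e : wordAt w (a + t + 1) (n - t - 1) = wordAt w (b + t + 1) (n - t - 1) :=
      wordAt_eq_iff.2 fun s hs => by
        have := g5 (t + 1 + s) (by omega) (by omega)
        simpa only [add_assoc] using this
    have e1 := count_wordAt w (a + t + 1) (n - t - 1)
    have e2 := count_wordAt w (b + t + 1) (n - t - 1)
    rw [e] at e1
    rw [show a + t + 1 + (n - t - 1) = a + n by omega, prefixSum_succ, g1] at e1
    rw [show b + t + 1 + (n - t - 1) = b + n by omega, prefixSum_succ, g2] at e2
    have e3 := prefixSum_succ w (a + n)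
    have e4 := prefixSum_succ w (b + n)
    rw [g3] at e3
    rw [g4] at e4
    have := hb (n + 1 - t) (a + t) (b + t)
    rw [show a + t + (n + 1 - t) = a + n + 1 by omega,
      show b + t + (n + 1 - t) = b + n + 1 by omega] at this
    simp only [if_true, Bool.false_eq_true, if_false] at *
    omega
  cases hit : w (i + t) <;> cases hit' : w (i' + t)
  · exact hne (hit.trans hit'.symm)
  · exact main j' i (by rw [← h1' t ht, hit']) hit h3' h2 fun s hs hs' => by
      rw [← h1' s hs', hmax s hs hs']
  · exact main j i' (by rw [← h1 t ht, hit]) hit' h3 h2' fun s hs hs' => by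
      rw [← h1 s hs', hmax s hs hs']
  · exact hne (hit.trans hit'.symm)

theorem UltPeriodicW.biInfinite {w : ℕ → Bool} {S : ℤ → ℤ} (hw : UltPeriodicW w)
    (hrec : RecurrentW w) (h : BiInfinite (prefixSum w) S) :
    ∃ T : ℤ, 1 ≤ T ∧ ∀ i, S (i + T + 1) - S (i + T) = S (i + 1) - S i := by
  obtain ⟨T, hT, n₀, hn⟩ := hw
  refine ⟨T, by omega, fun i => ?_⟩
  obtain ⟨x, hx⟩ := h.window i (T + 1)
  obtain ⟨y, hy, hyx⟩ := hrec.prefixSum x (T + 1) n₀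
  have a1 := hx 1 (by omega)
  have a2 := hx T (by omega)
  have a3 := hx (T + 1) (by omega)
  have b1 := hyx 1 (by omega)
  have b2 := hyx T (by omega)
  have b3 := hyx (T + 1) (by omega)
  have c1 := prefixSum_succ w y
  have c2 := prefixSum_succ w (y + T)
  rw [hn y hy] at c2
  push_cast at a1 a3
  simp only [← add_assoc] at a3 b3
  omega

theorem ultPeriodicW_of_biInfinite {w : ℕ → Bool} {S : ℤ → ℤ} (h : BiInfinite (prefixSum w) S)
    {T n₀ : ℤ} (hT : 1 ≤ T) (hS : ∀ i, n₀ ≤ i → S (i + T + 1) - S (i + T) = S (i + 1) - S i) :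
    UltPeriodicW w := by
  lift T to ℕ using by omega
  refine ⟨T, by omega, 0, fun x _ => ?_⟩
  obtain ⟨i, hi, hx⟩ := h.right x (T + 1) n₀
  have a1 := hx 1 (by omega)
  have a2 := hx T (by omega)
  have a3 := hx (T + 1) (by omega)
  have c1 := prefixSum_succ w x
  have c2 := prefixSum_succ w (x + T)
  have := hS i hi
  push_cast at a1 a3
  simp only [← add_assoc] at a3
  cases h1 : w x <;> cases h2 : w (x + T) <;> simp [h1, h2] at * <;> omega

theorem BiInfinite.sturmianW {w : ℕ → Bool} {S : ℤ → ℤ} (h : BiInfinite (prefixSum w) S)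
    (hrec : RecurrentW w) (hS : Good S) : SturmianW w := by
  have hw : ¬ UltPeriodicW w := by
    intro hw
    obtain ⟨T, hT, hp⟩ := hw.biInfinite hrec h
    have hc : ∀ i, S (i + T) - S i = S T - S 0 := by
      intro i
      induction i using Int.induction_on with
      | zero => simp
      | succ i ih =>
        have := hp i
        rw [add_right_comm] at this
        omega
      | pred i ih =>
        have := hp (-i - 1)
        rw [add_right_comm, sub_add_cancel] at this
        omega
    exact hS.not_periodic hT (K := S T - S 0) fun i => by have := hc i; omega
  have hb : ∀ n i j,
      prefixSum w (i + n) - prefixSum w i ≤ prefixSum w (j + n) - prefixSum w j + 1 := by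
    intro n i j
    obtain ⟨a, -, ha⟩ := h.right i n 0
    obtain ⟨b, -, hb⟩ := h.right j n 0
    rw [← ha n le_rfl, ← hb n le_rfl]
    exact hS.balanced (by omega) a b
  refine ⟨hw, fun n => ?_⟩
  induction n with
  | zero => exact complexityW_zero w
  | succ n ih =>
    have h1 := complexityW_lt_succ hw n
    have h2 := complexityW_succ_le (w := w) (n := n) fun i j i' j' =>
      rightSpecial_unique_of_balanced hb
    omega

/-- The same word of length `n` occurs at positions `i` and `j`. -/
def EqWin (S : ℤ → ℤ) (n i j : ℤ) : Prop :=
  ∀ t, 0 ≤ t → t ≤ n → S (i + t) - S i = S (j + t) - S j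

theorem EqWin.symm {S : ℤ → ℤ} {n i j : ℤ} (h : EqWin S n i j) : EqWin S n j i :=
  fun t h0 h1 => (h t h0 h1).symm

theorem EqWin.trans {S : ℤ → ℤ} {n i j k : ℤ} (h : EqWin S n i j) (h' : EqWin S n j k) :
    EqWin S n i k :=
  fun t h0 h1 => (h t h0 h1).trans (h' t h0 h1)

theorem EqWin.sub {S : ℤ → ℤ} {n i j : ℤ} (h : EqWin S n i j) {c n' : ℤ} (hc : 0 ≤ c)
    (hn : c + n' ≤ n) : EqWin S n' (i + c) (j + c) := by
  intro t h0 h1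
  have a1 := h c hc (by omega)
  have a2 := h (c + t) (by omega) (by omega)
  rw [← add_assoc, ← add_assoc] at a2
  omega

theorem EqWin.snoc {S : ℤ → ℤ} {n i j : ℤ} (h : EqWin S n i j) (hn : 0 ≤ n)
    (h' : S (i + n + 1) - S (i + n) = S (j + n + 1) - S (j + n)) : EqWin S (n + 1) i j := by
  intro t h0 h1
  rcases eq_or_lt_of_le h1 with rfl | h1
  · have := h n hn le_rfl
    rw [← add_assoc, ← add_assoc]
    omega
  · exact h t h0 (by omega)

theorem EqWin.cons {S : ℤ → ℤ} {n i j : ℤ} (h : EqWin S n (i + 1) (j + 1))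
    (h' : S (i + 1) - S i = S (j + 1) - S j) : EqWin S (n + 1) i j := by
  intro t h0 h1
  rcases eq_or_lt_of_le h0 with rfl | h0
  · simp
  · have := h (t - 1) (by omega) (by omega)
    rw [add_add_sub_cancel, add_add_sub_cancel] at this
    omega

theorem eqWin_cpl {S : ℤ → ℤ} {n i j : ℤ} : EqWin (cpl S) n i j ↔ EqWin S n i j := by
  constructor <;> intro h t h0 h1 <;> have := h t h0 h1 <;> simp only [cpl] at * <;> omega

/-- Occurrences at `i` and `j` of the same word `B` of length `n`, followed by `0` and `1`. -/
def Special (S : ℤ → ℤ) (n i j : ℤ) : Prop :=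
  EqWin S n i j ∧ S (i + n + 1) = S (i + n) ∧ S (j + n + 1) = S (j + n) + 1

theorem special_cpl {S : ℤ → ℤ} {n i j : ℤ} : Special (cpl S) n i j ↔ Special S n j i := by
  constructor <;> rintro ⟨h1, h2, h3⟩
  · exact ⟨(eqWin_cpl.1 h1).symm, by simp only [cpl] at *; omega, by simp only [cpl] at *; omega⟩
  · exact ⟨(eqWin_cpl.2 h1).symm, by simp only [cpl] at *; omega, by simp only [cpl] at *; omega⟩

/-- Prefix sums of bi-infinite Sturmian words. -/
structure Stu (S : ℤ → ℤ) : Prop where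
  step : ∀ i, S (i + 1) = S i ∨ S (i + 1) = S i + 1
  rec_right : ∀ i n N, ∃ j, N ≤ j ∧ EqWin S n j i
  special : ∀ n, 0 ≤ n → ∃ i j, Special S n i j
  unique : ∀ n i j i' j', 0 ≤ n → Special S n i j → Special S n i' j' → EqWin S n i i'
  pigeon : ∀ n : ℕ, ∀ f : Fin (n + 2) → ℤ, ∃ p q, p < q ∧ EqWin S n (f p) (f q)
  aper : ∀ T n₀, 1 ≤ T → (∀ i, n₀ ≤ i → S (i + T + 1) - S (i + T) = S (i + 1) - S i) → False

theorem Stu.toCpl {S : ℤ → ℤ} (h : Stu S) : Stu (cpl S) where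
  step i := by
    have := h.step i
    simp only [cpl]; omega
  rec_right i n N := by simpa only [eqWin_cpl] using h.rec_right i n N
  special n hn := by
    obtain ⟨i, j, hij⟩ := h.special n hn
    exact ⟨j, i, special_cpl.2 hij⟩
  unique n i j i' j' hn h1 h2 := by
    rw [special_cpl] at h1 h2
    rw [eqWin_cpl]
    exact (h1.1.symm.trans (h.unique n j i j' i' hn h1 h2)).trans h2.1
  pigeon n f := by simpa only [eqWin_cpl] using h.pigeon n f
  aper T n₀ hT hp := h.aper T n₀ hT fun i hi => by
    have := hp i hi
    simp only [cpl] at this; omega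

theorem unb_cpl {S : ℤ → ℤ} {n i j : ℤ} : Unb (cpl S) n i j ↔ Unb S n j i := by
  simp only [Unb, cpl]
  constructor <;> rintro ⟨h1, h2, h3, h4, h5⟩ <;>
    refine ⟨by omega, by omega, by omega, by omega, fun t ht ht' => ?_⟩ <;>
    have := h5 t ht ht' <;> omega

/-- If `0B0` and `1B1` occur with `B` of minimal length, then `0B` is not the right special
factor. -/
theorem Stu.not_unb_aux {S : ℤ → ℤ} (h : Stu S) {n i₀ j₀ : ℤ} (hn : 0 ≤ n) (hu : Unb S n i₀ j₀)
    (hmin : ∀ m i j, 0 ≤ m → m < n → ¬ Unb S m i j)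
    (hX : ∀ a b, Special S (n + 1) a b → EqWin S (n + 1) i₀ a) : False := by
  obtain ⟨u1, u2, u3, u4, u5⟩ := hu
  have hdet : ∀ a b, EqWin S (n + 1) a b → ¬ EqWin S (n + 1) i₀ a → EqWin S (n + 2) a b := by
    intro a b hab ha
    rw [show n + 2 = n + 1 + 1 by ring]
    refine hab.snoc (by omega) ?_
    rcases h.step (a + (n + 1)) with ea | ea <;> rcases h.step (b + (n + 1)) with eb | eb
    · omega
    · exact absurd (hX a b ⟨hab, ea, eb⟩) ha
    · exact absurd ((hX b a ⟨hab.symm, eb, ea⟩).trans hab.symm) ha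
    · omega
  have hclaim : ∀ d, 0 ≤ d → d ≤ n + 1 → ¬ EqWin S (n + 1) i₀ (j₀ + d) := by
    intro d h0 h1 he
    have e1 := he 1 (by omega) (by omega)
    rcases eq_or_lt_of_le h0 with rfl | h0
    · rw [add_zero] at e1
      omega
    rcases eq_or_lt_of_le h1 with rfl | h1
    · rw [show j₀ + (n + 1) + 1 = j₀ + n + 2 by ring, show j₀ + (n + 1) = j₀ + n + 1 by ring] at e1
      omega
    refine hmin (n - d) (i₀ + d) j₀ (by omega) (by omega) ⟨?_, ?_, u3, ?_, fun t t0 t1 => ?_⟩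
    · have a1 := u5 (d - 1) (by omega) (by omega)
      have a2 := u5 d (by omega) (by omega)
      rw [add_add_sub_cancel, add_add_sub_cancel] at a1
      rw [add_right_comm, add_right_comm j₀] at a2
      omega
    · rw [show i₀ + d + (n - d) + 2 = i₀ + n + 2 by ring,
        show i₀ + d + (n - d) + 1 = i₀ + n + 1 by ring]
      exact u2
    · have a1 := he (n - d + 1) (by omega) (by omega)
      have a2 := he (n - d + 2) (by omega) (by omega)
      have b1 := u5 (n - d) (by omega) (by omega)
      have b2 := u5 (n - d + 1) (by omega) (by omega)
      rw [show j₀ + d + (n - d + 1) = j₀ + n + 1 by ring] at a1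
      rw [show j₀ + d + (n - d + 2) = j₀ + n + 2 by ring] at a2
      rw [show i₀ + 1 + (n - d) = i₀ + (n - d + 1) by ring] at b1
      rw [show i₀ + 1 + (n - d + 1) = i₀ + (n - d + 2) by ring,
        show j₀ + 1 + (n - d + 1) = j₀ + (n - d) + 2 by ring] at b2
      rw [show j₀ + 1 + (n - d) = j₀ + (n - d) + 1 by ring] at b1
      omega
    · have a0 := he 1 (by omega) (by omega)
      have a1 := he (t + 1) (by omega) (by omega)
      have b0 := u5 d (by omega) (by omega)
      have b1 := u5 (d + t) (by omega) (by omega)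
      have c1 := u5 t (by omega) (by omega)
      rw [show j₀ + d + (t + 1) = j₀ + 1 + (d + t) by ring,
        show i₀ + (t + 1) = i₀ + 1 + t by ring] at a1
      rw [show j₀ + d + 1 = j₀ + 1 + d by ring] at a0
      rw [show i₀ + d + 1 = i₀ + 1 + d by ring, add_assoc (i₀ + 1) d t]
      omega
  obtain ⟨a, b, ha, hab, hb, he⟩ : ∃ a b, j₀ ≤ a ∧ a < b ∧ b ≤ j₀ + n + 1 ∧
      EqWin S (n + 1) a b := by
    obtain ⟨p, q, hpq, he⟩ := h.pigeon (n + 1).toNat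
      (Fin.cons i₀ fun k => j₀ + (k : ℕ))
    rw [Int.toNat_of_nonneg (by omega)] at he
    obtain ⟨q, rfl⟩ := Fin.exists_succ_eq.2 (Fin.ne_zero_of_lt hpq)
    rw [Fin.cons_succ] at he
    induction p using Fin.cases with
    | zero =>
      rw [Fin.cons_zero] at he
      exact absurd he (hclaim q (by omega) (by omega))
    | succ p =>
      rw [Fin.cons_succ] at he
      have := Fin.succ_lt_succ_iff.1 hpq
      exact ⟨_, _, by omega, by omega, by omega, he⟩
  have key : ∀ t : ℕ, EqWin S (n + 1) (a + t) (b + t) ∧ ¬ EqWin S (n + 1) i₀ (a + t) := by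
    intro t
    induction t using Nat.strong_induction_on with
    | _ t ih =>
      constructor
      · rcases t with _ | t
        · simpa using he
        · obtain ⟨g1, g2⟩ := ih t (by omega)
          have := (hdet _ _ g1 g2).sub (c := 1) (n' := n + 1) (by omega) (by omega)
          push_cast
          rwa [← add_assoc, ← add_assoc]
      · by_cases hlt : a + t ≤ j₀ + n + 1
        · have := hclaim (a + t - j₀) (by omega) (by omega)
          rwa [add_sub_cancel] at this
        · obtain ⟨g1, g2⟩ := ih (t - (b - a).toNat) (by omega)
          rw [show b + ((t - (b - a).toNat : ℕ) : ℤ) = a + t by omega] at g1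
          exact fun hc => g2 (hc.trans g1.symm)
  refine h.aper (b - a) a (by omega) fun i hi => ?_
  have := (key (i - a).toNat).1 1 (by omega) (by omega)
  rw [show a + ((i - a).toNat : ℤ) = i by omega,
    show b + ((i - a).toNat : ℤ) = i + (b - a) by omega] at this
  omega

theorem Stu.not_unb {S : ℤ → ℤ} (h : Stu S) {n i j : ℤ} (hn : 0 ≤ n) : ¬ Unb S n i j := by
  intro hu
  obtain ⟨n, hn, -, ⟨i, j, hu⟩, hmin⟩ := int_least (p := fun n => ∃ i j, Unb S n i j) hn ⟨i, j, hu⟩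
  have hmin' : ∀ m i j, 0 ≤ m → m < n → ¬ Unb S m i j := fun m i j h0 h1 hm =>
    hmin m h0 h1 ⟨i, j, hm⟩
  obtain ⟨p, q, hpq⟩ := h.special (n + 1) (by omega)
  have hpq' : Special S n (p + 1) (q + 1) := by
    obtain ⟨h1, h2, h3⟩ := hpq
    refine ⟨h1.sub (by omega) (by omega), ?_, ?_⟩
    · rw [show p + 1 + n = p + (n + 1) by ring, h2]
    · rw [show q + 1 + n = q + (n + 1) by ring, h3]
  have hij : Special S n (i + 1) (j + 1) := by
    obtain ⟨h1, h2, h3, h4, h5⟩ := hu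
    refine ⟨h5, ?_, ?_⟩
    · rw [show i + 1 + n + 1 = i + n + 2 by ring, show i + 1 + n = i + n + 1 by ring, h2]
    · rw [show j + 1 + n + 1 = j + n + 2 by ring, show j + 1 + n = j + n + 1 by ring, h4]
  have he := h.unique n _ _ _ _ hn hij hpq'
  rcases h.step p with hp | hp
  · have := he.cons (by have := hu.1; omega)
    exact h.not_unb_aux hn hu hmin' fun a b hab =>
      this.trans (h.unique _ _ _ _ _ (by omega) hpq hab)
  · have := (hij.1.symm.trans he).cons (by have := hu.2.2.1; omega)
    refine h.toCpl.not_unb_aux hn (unb_cpl.2 hu)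
      (fun m i j h0 h1 hm => hmin' m j i h0 h1 (unb_cpl.1 hm)) fun a b hab => ?_
    rw [special_cpl] at hab
    rw [eqWin_cpl]
    exact this.trans ((h.unique _ _ _ _ _ (by omega) hpq hab).trans hab.1)

theorem Stu.balanced {S : ℤ → ℤ} (h : Stu S) {L : ℤ} (hL : 0 ≤ L) (i j : ℤ) :
    S (i + L) - S i ≤ S (j + L) - S j + 1 := by
  by_contra hcon
  obtain ⟨m, a, -, hm, -, hu⟩ := exists_unb h.step hL (i := j) (j := i) (by omega)
  exact h.not_unb hm hu

theorem wordAt_eq_iff_prefixSum {w : ℕ → Bool} {x y n : ℕ} :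
    wordAt w x n = wordAt w y n ↔ ∀ t ≤ n, prefixSum w (x + t) - prefixSum w x =
      prefixSum w (y + t) - prefixSum w y := by
  constructor
  · intro h t ht
    rw [← count_wordAt, ← count_wordAt, wordAt_eq_iff.2 fun s hs =>
      wordAt_eq_iff.1 h s (by omega)]
  · intro h
    refine wordAt_eq_iff.2 fun t ht => ?_
    have a1 := h t ht.le
    have a2 := h (t + 1) ht
    rw [← add_assoc, ← add_assoc, prefixSum_succ, prefixSum_succ] at a2
    cases h1 : w (x + t) <;> cases h2 : w (y + t) <;> simp [h1, h2] at * <;> omega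

theorem eqWin_iff_wordAt {w : ℕ → Bool} {S : ℤ → ℤ} {n x y : ℕ} {i j : ℤ}
    (hx : ∀ t : ℕ, t ≤ n → S (i + t) - S i = prefixSum w (x + t) - prefixSum w x)
    (hy : ∀ t : ℕ, t ≤ n → S (j + t) - S j = prefixSum w (y + t) - prefixSum w y) :
    EqWin S n i j ↔ wordAt w x n = wordAt w y n := by
  rw [wordAt_eq_iff_prefixSum]
  constructor
  · intro h t ht
    rw [← hx t ht, ← hy t ht]
    exact h t (by omega) (by omega)
  · intro h t h0 h1
    lift t to ℕ using h0
    rw [hx t (by omega), hy t (by omega)]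
    exact h t (by omega)

theorem letter_of_window {w : ℕ → Bool} {S : ℤ → ℤ} {n x : ℕ} {i : ℤ}
    (hx : ∀ t : ℕ, t ≤ n + 1 → S (i + t) - S i = prefixSum w (x + t) - prefixSum w x) :
    S (i + n + 1) = S (i + n) + if w (x + n) then 1 else 0 := by
  have a1 := hx n (by omega)
  have a2 := hx (n + 1) le_rfl
  rw [← add_assoc, prefixSum_succ] at a2
  push_cast [← add_assoc] at a2
  omega

theorem SturmianW.stu {w : ℕ → Bool} {S : ℤ → ℤ} (hw : SturmianW w)
    (h : BiInfinite (prefixSum w) S) : Stu S where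
  step := h.step
  rec_right i n N := h.rec_right i n N
  special n hn := by
    lift n to ℕ using hn
    obtain ⟨x, y, h1, h2, h3⟩ := exists_rightSpecial hw.1 n
    obtain ⟨i, -, hi⟩ := h.right x (n + 1) 0
    obtain ⟨j, -, hj⟩ := h.right y (n + 1) 0
    refine ⟨i, j, (eqWin_iff_wordAt (fun t ht => hi t (by omega))
      fun t ht => hj t (by omega)).2 h1, ?_, ?_⟩
    · rw [letter_of_window hi, h2]; simp
    · rw [letter_of_window hj, h3]; simp
  unique n i j i' j' hn := by
    rintro ⟨h1, h2, h3⟩ ⟨h1', h2', h3'⟩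
    lift n to ℕ using hn
    obtain ⟨x, hx⟩ := h.window i (n + 1)
    obtain ⟨y, hy⟩ := h.window j (n + 1)
    obtain ⟨x', hx'⟩ := h.window i' (n + 1)
    obtain ⟨y', hy'⟩ := h.window j' (n + 1)
    rw [letter_of_window hx] at h2
    rw [letter_of_window hy] at h3
    rw [letter_of_window hx'] at h2'
    rw [letter_of_window hy'] at h3'
    have e {i j : ℤ} {x y : ℕ}
        (hx : ∀ t : ℕ, t ≤ n + 1 → S (i + t) - S i = prefixSum w (x + t) - prefixSum w x)
        (hy : ∀ t : ℕ, t ≤ n + 1 → S (j + t) - S j = prefixSum w (y + t) - prefixSum w y) :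
        EqWin S n i j ↔ wordAt w x n = wordAt w y n :=
      eqWin_iff_wordAt (fun t ht => hx t (by omega)) fun t ht => hy t (by omega)
    rw [e hx hy] at h1
    rw [e hx' hy'] at h1'
    rw [e hx hx']
    exact rightSpecial_unique (by rw [hw.2, hw.2]) h1 (by simpa using h2) (by simpa using h3) h1'
      (by simpa using h2') (by simpa using h3')
  pigeon n f := by
    choose x hx using fun p => h.window (f p) n
    have hc := hw.2 n
    rw [complexityW_eq] at hc
    obtain ⟨p, -, q, -, hpq, he⟩ := Finset.exists_ne_map_eq_of_card_lt_of_maps_to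
      (s := (Finset.univ : Finset (Fin (n + 2)))) (t := (finite_range_wordAt w n).toFinset)
      (f := fun p => wordAt w (x p) n)
      (by rw [← Set.ncard_eq_toFinset_card _ (finite_range_wordAt w n), hc]; simp)
      (fun p _ => by simp)
    have he := (eqWin_iff_wordAt (hx p) (hx q)).2 he
    rcases lt_or_gt_of_ne hpq with hlt | hlt
    · exact ⟨p, q, hlt, he⟩
    · exact ⟨q, p, hlt, he.symm⟩
  aper T n₀ hT hp := hw.1 (ultPeriodicW_of_biInfinite h hT hp)

theorem mul_le_of_blocks {S : ℤ → ℤ} {L c : ℤ} (h : ∀ i, c ≤ S (i + L) - S i) (k : ℕ) (i : ℤ) :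
    k * c ≤ S (i + k * L) - S i := by
  induction k with
  | zero => simp
  | succ k ih =>
    have := h (i + k * L)
    push_cast
    rw [show i + (k + 1) * L = i + k * L + L by ring, add_mul, one_mul]
    omega

theorem le_mul_of_blocks {S : ℤ → ℤ} {L c : ℤ} (h : ∀ i, S (i + L) - S i ≤ c) (k : ℕ) (i : ℤ) :
    S (i + k * L) - S i ≤ k * c := by
  induction k with
  | zero => simp
  | succ k ih =>
    have := h (i + k * L)
    push_cast
    rw [show i + (k + 1) * L = i + k * L + L by ring, add_mul, one_mul]
    omega

theorem exists_slope {S : ℤ → ℤ}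
    (h : ∀ L i j, 0 ≤ L → S (i + L) - S i ≤ S (j + L) - S j + 1) :
    ∃ α : ℝ, ∀ i L : ℤ, 0 ≤ L → |((S (i + L) - S i : ℤ) : ℝ) - L * α| ≤ 1 := by
  obtain ⟨α, h1, h2⟩ := exists_between_of_forall_le
    (s := {r : ℝ | ∃ i L : ℤ, 0 < L ∧ r = (((S (i + L) - S i : ℤ) : ℝ) - 1) / L})
    (t := {r : ℝ | ∃ i L : ℤ, 0 < L ∧ r = (((S (i + L) - S i : ℤ) : ℝ) + 1) / L})
    ⟨_, 0, 1, one_pos, rfl⟩ ⟨_, 0, 1, one_pos, rfl⟩ (by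
      rintro _ ⟨i, L, hL, rfl⟩ _ ⟨j, M, hM, rfl⟩
      have hL' : (0 : ℝ) < L := by exact_mod_cast hL
      have hM' : (0 : ℝ) < M := by exact_mod_cast hM
      rw [div_le_div_iff₀ hL' hM']
      have a1 := mul_le_of_blocks (S := S) (L := L) (c := S (i + L) - S i - 1)
        (fun k => by have := h L i k hL.le; omega) M.toNat 0
      have a2 := le_mul_of_blocks (S := S) (L := M) (c := S (j + M) - S j + 1)
        (fun k => by have := h M k j hM.le; omega) L.toNat 0
      rw [Int.toNat_of_nonneg hM.le] at a1
      rw [Int.toNat_of_nonneg hL.le] at a2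
      have e : (0 : ℤ) + M * L = 0 + L * M := by ring
      rw [e] at a1
      have := a1.trans a2
      have : (S (i + L) - S i - 1) * M ≤ (S (j + M) - S j + 1) * L := by linarith
      exact_mod_cast this)
  refine ⟨α, fun i L hL => ?_⟩
  rcases eq_or_lt_of_le hL with rfl | hL
  · simp
  have hL' : (0 : ℝ) < L := by exact_mod_cast hL
  have a1 := h1 ⟨i, L, hL, rfl⟩
  have a2 := h2 ⟨i, L, hL, rfl⟩
  rw [div_le_iff₀ hL'] at a1
  rw [le_div_iff₀ hL'] at a2
  rw [abs_le]
  constructor <;> linarith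

theorem Stu.le_of_rational {S : ℤ → ℤ} (h : Stu S) {α : ℝ}
    (hα : ∀ i L : ℤ, 0 ≤ L → |((S (i + L) - S i : ℤ) : ℝ) - L * α| ≤ 1) {p q : ℤ} (hq : 0 < q)
    (hpq : q * α = p) (i : ℤ) : S (i + q) - S i ≤ p := by
  by_contra! hi
  have hp : ∀ j, p ≤ S (j + q) - S j := fun j => by
    have := h.balanced hq.le i j
    omega
  have hinf : {j | p < S (j + q) - S j}.Infinite := by
    refine Set.infinite_of_not_bddAbove fun ⟨M, hM⟩ => ?_
    obtain ⟨j, hj, he⟩ := h.rec_right i q (M + 1)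
    have := hM (show p < S (j + q) - S j by rw [he q hq.le le_rfl]; exact hi)
    omega
  obtain ⟨a, ha, b, hb, hab, he⟩ := hinf.exists_ne_map_eq_of_mapsTo (f := (· % q))
    (t := Set.Ico 0 q) (fun j _ => ⟨Int.emod_nonneg _ hq.ne', Int.emod_lt_of_pos _ hq⟩)
    (Set.finite_Ico _ _)
  wlog hlt : a < b generalizing a b
  · exact this b hb a ha hab.symm he.symm (by omega)
  obtain ⟨k, hk⟩ := Int.ModEq.dvd he
  have hk0 : 0 < k := by
    by_contra hcon
    nlinarith
  obtain ⟨k, rfl⟩ : ∃ k' : ℕ, k = k' + 1 := ⟨(k - 1).toNat, by omega⟩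
  have a1 := mul_le_of_blocks hp k (a + q)
  rw [show a + q + k * q = b by linarith] at a1
  have a2 := hα a ((k + 2) * q) (by positivity)
  rw [show a + (k + 2) * q = b + q by linarith] at a2
  push_cast at a2
  rw [mul_assoc, hpq] at a2
  have a3 := (abs_le.1 a2).2
  have a4 : S (b + q) - S a - (k + 2) * p ≤ 1 := by exact_mod_cast a3
  simp only [Set.mem_ofPred_eq] at ha hb
  have : ((k : ℤ) + 2) * p = k * p + 2 * p := by ring
  omega

theorem Stu.irrational {S : ℤ → ℤ} (h : Stu S) {α : ℝ}
    (hα : ∀ i L : ℤ, 0 ≤ L → |((S (i + L) - S i : ℤ) : ℝ) - L * α| ≤ 1) {p q : ℤ} (hq : 0 < q) :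
    q * α - p ≠ 0 := by
  intro hpq
  rw [sub_eq_zero] at hpq
  have h1 := h.le_of_rational hα hq hpq
  have h2 := h.toCpl.le_of_rational (α := 1 - α) (fun i L hL => by
    rw [← abs_neg]
    convert hα i L hL using 2
    simp only [cpl]
    push_cast
    ring) hq (p := q - p) (by push_cast; linarith)
  refine h.aper q 0 hq fun i _ => ?_
  have a1 := h1 i
  have a2 := h2 i
  have a3 := h1 (i + 1)
  have a4 := h2 (i + 1)
  simp only [cpl] at a2 a4
  rw [add_right_comm] at a3 a4
  omega

/-- From position `N` on, the points `i * α - S i` lie in `(A, A + 1)`, and the abelian class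
`(L, m)` occurs exactly at the positions for which they lie in `(a, b)`. -/
structure Coding (S : ℤ → ℤ) (α a b A : ℝ) (N L m : ℤ) : Prop where
  irr : ∀ l s : ℤ, 0 < l → (l : ℝ) * α - s ≠ 0
  mem : ∀ i, N ≤ i → A < i * α - S i ∧ i * α - S i < A + 1
  left_le : A ≤ a
  le_right : b ≤ A + 1
  length_lt : b - a < 1
  cls : ∀ i, N ≤ i → (S (i + L) - S i = m ↔ a < i * α - S i ∧ i * α - S i < b)
  rec_right : ∀ i n M, ∃ j, M ≤ j ∧ EqWin S n j i
  nonempty : ∃ i, S (i + L) - S i = m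
  nonneg : 0 ≤ L

theorem abRet_neg {S : ℤ → ℤ} {L m i j : ℤ} : AbRet (-S) L (-m) i j ↔ AbRet S L m i j := by
  simp only [AbRet, Pi.neg_apply]
  refine and_congr_right fun _ => and_congr (by omega) (and_congr (by omega) ?_)
  exact forall_congr' fun k => forall_congr' fun _ => forall_congr' fun _ => by omega

theorem retPair_neg {S : ℤ → ℤ} {L m l s : ℤ} :
    RetPair (-S) L (-m) l (-s) ↔ RetPair S L m l s := by
  simp only [RetPair, abRet_neg, Pi.neg_apply]
  refine exists_congr fun i => exists_congr fun j => and_congr_right fun _ =>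
    and_congr_right fun _ => by omega

theorem eqWin_neg {S : ℤ → ℤ} {n i j : ℤ} : EqWin (-S) n i j ↔ EqWin S n i j := by
  simp only [EqWin, Pi.neg_apply]
  exact forall_congr' fun k => forall_congr' fun _ => forall_congr' fun _ => by omega

namespace Coding

variable {S : ℤ → ℤ} {α a b A : ℝ} {N L m : ℤ}

theorem neg (h : Coding S α a b A N L m) : Coding (-S) (-α) (-b) (-a) (-A - 1) N L (-m) where
  irr l s hl := by
    have := h.irr l (-s) hl
    contrapose! this
    push_cast
    linarith
  mem i hi := by
    have := h.mem i hi
    simp only [Pi.neg_apply, Int.cast_neg]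
    constructor <;> linarith
  left_le := by linarith [h.le_right]
  le_right := by linarith [h.left_le]
  length_lt := by linarith [h.length_lt]
  cls i hi := by
    have := h.cls i hi
    rw [show (-S) (i + L) - (-S) i = -m ↔ S (i + L) - S i = m by simp only [Pi.neg_apply]; omega,
      this]
    simp only [Pi.neg_apply, Int.cast_neg]
    constructor <;> rintro ⟨h1, h2⟩ <;> constructor <;> linarith
  rec_right := by simpa only [eqWin_neg] using h.rec_right
  nonempty := by
    obtain ⟨i, hi⟩ := h.nonempty
    exact ⟨i, by simp only [Pi.neg_apply]; omega⟩
  nonneg := h.nonneg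

theorem int_eq {x y A : ℝ} {s : ℤ} (hx : A < x ∧ x < A + 1) (hy : A < y ∧ y < A + 1)
    (h : y - x = s) : s = 0 := by
  have h1 : (-1 : ℝ) < s := by linarith
  have h2 : (s : ℝ) < 1 := by linarith
  have h1' : -1 < s := by exact_mod_cast h1
  have h2' : s < 1 := by exact_mod_cast h2
  omega

theorem next (h : Coding S α a b A N L m) {i l s : ℤ} (hi : N ≤ i) (hl : 0 < l)
    (h1 : a < i * α - S i + (l * α - s)) (h2 : i * α - S i + (l * α - s) < b) :
    S (i + l + L) - S (i + l) = m ∧ S (i + l) - S i = s := by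
  have h3 := h.mem (i + l) (by omega)
  have e : S (i + l) - S i - s = 0 := int_eq h3
    ⟨h.left_le.trans_lt h1, h2.trans_le h.le_right⟩ (by push_cast; ring)
  refine ⟨(h.cls _ (by omega)).2 ?_, by omega⟩
  have e' : ((S (i + l) : ℤ) : ℝ) = S i + s := by exact_mod_cast (by omega : S (i + l) = S i + s)
  rw [e']
  push_cast
  constructor <;> linarith

theorem far (h : Coding S α a b A N L m) {l s : ℤ} (hr : RetPair S L m l s) (M : ℤ) :
    ∃ i, M ≤ i ∧ N ≤ i ∧ AbRet S L m i (i + l) ∧ S (i + l) - S i = s := by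
  obtain ⟨i, j, ⟨hij, hi, hj, hk⟩, rfl, rfl⟩ := hr
  obtain ⟨x, hx, he⟩ := h.rec_right i (j - i + L) (max M N)
  have hL := h.nonneg
  have e : ∀ t, 0 ≤ t → t ≤ j - i → S (x + t + L) - S (x + t) = S (i + t + L) - S (i + t) := by
    intro t h0 h1
    have a1 := he t h0 (by omega)
    have a2 := he (t + L) (by omega) (by omega)
    rw [← add_assoc, ← add_assoc] at a2
    omega
  have e0 := e 0 le_rfl (by omega)
  have e1 := e (j - i) (by omega) le_rfl
  have e2 := he (j - i) (by omega) (by omega)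
  rw [add_sub_cancel] at e1 e2
  rw [add_zero, add_zero] at e0
  refine ⟨x, by omega, by omega, ⟨by omega, by omega, by omega, fun k k1 k2 => ?_⟩, by omega⟩
  have e3 := e (k - x) (by omega) (by omega)
  rw [add_sub_cancel] at e3
  rw [e3]
  exact hk _ (by omega) (by omega)

theorem displacement (h : Coding S α a b A N L m) {l s : ℤ} (hr : RetPair S L m l s) (M : ℤ) :
    0 < l ∧ ∃ i, M ≤ i ∧ N ≤ i ∧ AbRet S L m i (i + l) ∧ S (i + l) - S i = s ∧
      a < i * α - S i ∧ i * α - S i < b ∧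
      a < i * α - S i + (l * α - s) ∧ i * α - S i + (l * α - s) < b := by
  obtain ⟨i, h1, h2, h3, h4⟩ := h.far hr M
  have hl : 0 < l := by have := h3.1; omega
  have c1 := (h.cls i h2).1 h3.2.1
  have c2 := (h.cls (i + l) (by omega)).1 h3.2.2.1
  have e' : ((S (i + l) : ℤ) : ℝ) = S i + s := by exact_mod_cast (by omega : S (i + l) = S i + s)
  rw [e'] at c2
  push_cast at c2
  exact ⟨hl, i, h1, h2, h3, h4, c1.1, c1.2, by linarith, by linarith⟩

theorem exists_far (h : Coding S α a b A N L m) (M : ℤ) : ∃ i, M ≤ i ∧ S (i + L) - S i = m := by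
  obtain ⟨i, hi⟩ := h.nonempty
  obtain ⟨j, hj, he⟩ := h.rec_right i L M
  exact ⟨j, hj, by rw [he L h.nonneg le_rfl]; exact hi⟩

theorem exists_retPair (h : Coding S α a b A N L m) : ∃ l s, RetPair S L m l s := by
  obtain ⟨i, -, hi⟩ := h.exists_far 0
  obtain ⟨j, hj, hj'⟩ := h.exists_far (i + 1)
  obtain ⟨k, k1, -, k2, k3⟩ := int_least (p := fun j => S (j + L) - S j = m) hj hj'
  exact ⟨k - i, S k - S i, i, k, ⟨by omega, hi, k2, fun t t1 t2 => k3 t (by omega) t2⟩, rfl, rfl⟩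

/-- Some abelian return moves the point to the right. -/
theorem exists_pos (h : Coding S α a b A N L m) : ∃ l s, RetPair S L m l s ∧ 0 < l * α - s := by
  by_contra! hcon
  have hneg : ∀ l s, RetPair S L m l s → l * α - s < 0 := fun l s hr =>
    lt_of_le_of_ne (hcon l s hr) (h.irr l s (h.displacement hr 0).1)
  have hdec : ∀ n : ℕ, ∀ i j : ℤ, S (i + L) - S i = m → S (j + L) - S j = m → j = i + n →
      j * α - S j ≤ i * α - S i := by
    intro n
    induction n using Nat.strong_induction_on with
    | _ n ih =>
      intro i j hi hj hij
      rcases Nat.eq_zero_or_pos n with rfl | hn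
      · obtain rfl : j = i := by omega
        exact le_rfl
      by_cases hk : ∃ k, i < k ∧ k < j ∧ S (k + L) - S k = m
      · obtain ⟨k, k1, k2, k3⟩ := hk
        exact (ih (j - k).toNat (by omega) k j k3 hj (by omega)).trans
          (ih (k - i).toNat (by omega) i k hi k3 (by omega))
      · push Not at hk
        have := hneg (j - i) (S j - S i) ⟨i, j, ⟨by omega, hi, hj, hk⟩, rfl, rfl⟩
        push_cast at this
        linarith
  obtain ⟨l, s, hr⟩ := h.exists_retPair
  have hδ := hneg l s hr
  obtain ⟨i₁, hi₁, hi₁'⟩ := h.exists_far N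
  have hbdd : BddBelow {r : ℝ | ∃ i : ℤ, N ≤ i ∧ S (i + L) - S i = m ∧ r = i * α - S i} :=
    ⟨a, fun r ⟨i, hi, hi', hr⟩ => hr ▸ ((h.cls i hi).1 hi').1.le⟩
  obtain ⟨_, ⟨i, hi, hi', rfl⟩, hlt⟩ := Real.lt_sInf_add_pos
    (s := {r : ℝ | ∃ i : ℤ, N ≤ i ∧ S (i + L) - S i = m ∧ r = i * α - S i})
    ⟨_, i₁, hi₁, hi₁', rfl⟩ (ε := -(l * α - s)) (by linarith)
  obtain ⟨hl, j, hj, hj', hret, hs, -⟩ := h.displacement hr i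
  have d1 := hdec (j - i).toNat i j hi' hret.2.1 (by omega)
  have d2 := csInf_le hbdd ⟨j + l, by omega, hret.2.2.1, rfl⟩
  have e' : ((S (j + l) : ℤ) : ℝ) = S j + s := by exact_mod_cast (by omega : S (j + l) = S j + s)
  rw [e'] at d2
  push_cast at d2
  linarith

/-- `(l, s)` is the first displacement to the right by less than `t`. -/
structure FirstRight (α t : ℝ) (l s : ℤ) : Prop where
  pos : 0 < l
  disp_pos : 0 < l * α - s
  disp_lt : l * α - s < t
  le : ∀ l' s' : ℤ, 0 < l' → 0 < l' * α - s' → l' * α - s' < t → l ≤ l'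

theorem exists_firstRight (h : Coding S α a b A N L m) : ∃ l s, FirstRight α (b - a) l s := by
  obtain ⟨l, s, hr, hpos⟩ := h.exists_pos
  obtain ⟨hl, i, -, -, -, -, i1, i2, i3, i4⟩ := h.displacement hr 0
  obtain ⟨l, hl, -, ⟨s, h1, h2⟩, hmin⟩ := int_least (b := 1) (i := l)
    (p := fun l => ∃ s : ℤ, 0 < l * α - s ∧ l * α - s < b - a) (by omega)
    ⟨s, hpos, by linarith⟩
  refine ⟨l, s, by omega, h1, h2, fun l' s' h0 h1 h2 => ?_⟩
  by_contra hlt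
  exact hmin l' (by omega) (by omega) ⟨s', h1, h2⟩

theorem classify_pos (h : Coding S α a b A N L m) {l₁ s₁ l₂ s₂ l s : ℤ}
    (h₁ : FirstRight α (b - a) l₁ s₁) (h₂ : FirstRight (-α) (b - a) l₂ (-s₂))
    (hr : RetPair S L m l s) (hpos : 0 < l * α - s) :
    (l = l₁ ∧ s = s₁) ∨ (l = l₁ + l₂ ∧ s = s₁ + s₂) := by
  obtain ⟨hl, i, -, hi, hret, hs, i1, i2, i3, i4⟩ := h.displacement hr 0
  have hK : ∀ l' s' : ℤ, 0 < l' → a < i * α - S i + (l' * α - s') →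
      i * α - S i + (l' * α - s') < b → l ≤ l' ∧ (l = l' → s = s') := by
    intro l' s' h0 h1 h2
    obtain ⟨g1, g2⟩ := h.next hi h0 h1 h2
    constructor
    · by_contra hlt
      exact hret.2.2.2 (i + l') (by omega) (by omega) g1
    · rintro rfl
      omega
  have p1 := h₁.disp_pos
  have p2 := h₁.disp_lt
  have q1 := h₂.disp_pos
  have q2 := h₂.disp_lt
  have l1 := h₁.pos
  have l2 := h₂.pos
  push_cast at q1 q2
  have hle := h₁.le l s hl hpos (by linarith)
  by_cases hb : i * α - S i + (l₁ * α - s₁) < b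
  · obtain ⟨k1, k2⟩ := hK l₁ s₁ h₁.pos (by linarith) hb
    exact Or.inl ⟨by omega, k2 (by omega)⟩
  push Not at hb
  have hlt : l₁ < l := by
    refine lt_of_le_of_ne hle ?_
    rintro rfl
    have : s - s₁ = 0 := int_eq (A := 0) (x := l₁ * α - s) (y := l₁ * α - s₁)
      ⟨hpos, by linarith [h.length_lt]⟩ ⟨p1, by linarith [h.length_lt]⟩ (by push_cast; ring)
    obtain rfl : s = s₁ := by omega
    linarith
  have hge := h₂.le (l - l₁) (-(s - s₁)) (by omega) (by push_cast; linarith)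
    (by push_cast; linarith)
  refine Or.inr ?_
  by_cases ha : a < i * α - S i + (l₂ * α - s₂)
  · have := (hK l₂ s₂ h₂.pos ha (by linarith)).1
    omega
  push Not at ha
  obtain ⟨k1, k2⟩ := hK (l₁ + l₂) (s₁ + s₂) (by omega) (by push_cast; linarith)
    (by push_cast; linarith)
  exact ⟨by omega, k2 (by omega)⟩

theorem encard_retPair (h : Coding S α a b A N L m) :
    {p : ℤ × ℤ | RetPair S L m p.1 p.2}.encard = 2 ∨
      {p : ℤ × ℤ | RetPair S L m p.1 p.2}.encard = 3 := by
  obtain ⟨l₁, s₁, h₁⟩ := h.exists_firstRight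
  obtain ⟨l₂, s₂, h₂⟩ := h.neg.exists_firstRight
  obtain ⟨s₂, rfl⟩ : ∃ s, s₂ = -s := ⟨-s₂, by omega⟩
  rw [show -a - -b = b - a by ring] at h₂
  have hsub : {p : ℤ × ℤ | RetPair S L m p.1 p.2} ⊆
      {(l₁, s₁), (l₂, s₂), (l₁ + l₂, s₁ + s₂)} := by
    rintro ⟨l, s⟩ (hp : RetPair S L m l s)
    simp only [Set.mem_insert_iff, Set.mem_singleton_iff, Prod.mk.injEq]
    have hl := (h.displacement hp 0).1
    rcases lt_trichotomy 0 (l * α - s) with hpos | hz | hneg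
    · have := h.classify_pos h₁ h₂ hp hpos
      tauto
    · exact absurd hz.symm (h.irr l s hl)
    · have := h.neg.classify_pos (l₁ := l₂) (s₁ := -s₂) (l₂ := l₁) (s₂ := -s₁)
        (by rwa [show -a - -b = b - a by ring])
        (by rwa [show -a - -b = b - a by ring, neg_neg, neg_neg])
        (retPair_neg.2 hp) (by push_cast; linarith)
      omega
  have hle : {p : ℤ × ℤ | RetPair S L m p.1 p.2}.encard ≤ 3 := by
    refine (Set.encard_le_encard hsub).trans ?_
    refine (Set.encard_insert_le _ _).trans ?_
    refine (add_le_add_left (Set.encard_insert_le _ _) 1).trans ?_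
    rw [Set.encard_singleton]
    norm_num
  have hge : 2 ≤ {p : ℤ × ℤ | RetPair S L m p.1 p.2}.encard := by
    obtain ⟨l, s, hr, hpos⟩ := h.exists_pos
    obtain ⟨l', s', hr', hpos'⟩ := h.neg.exists_pos
    obtain ⟨s', rfl⟩ : ∃ s, s' = -s := ⟨-s', by omega⟩
    rw [retPair_neg] at hr'
    have hne : (l, s) ≠ (l', s') := by
      rintro ⟨⟩
      push_cast at hpos'
      linarith
    rw [← Set.encard_pair hne]
    refine Set.encard_le_encard ?_
    rintro _ (rfl | rfl) <;> assumption
  generalize {p : ℤ × ℤ | RetPair S L m p.1 p.2}.encard = e at hle hge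
  lift e to ℕ using ne_top_of_le_ne_top (by simp) hle
  norm_cast at *
  omega

end Coding

theorem Stu.exists_coding {S : ℤ → ℤ} (h : Stu S) {L m i₀ : ℤ} (hL : 1 ≤ L)
    (hi₀ : S (i₀ + L) - S i₀ = m) : ∃ α a b A N, Coding S α a b A N L m := by
  obtain ⟨α, hα⟩ := exists_slope fun L i j hL => h.balanced (L := L) hL i j
  have hdist : ∀ i j : ℤ, (i * α - S i) - (j * α - S j) ≤ 1 := by
    intro i j
    rcases le_total i j with hij | hij
    · have := (abs_le.1 (hα i (j - i) (by omega))).2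
      rw [add_sub_cancel] at this
      push_cast at this
      linarith
    · have := (abs_le.1 (hα j (i - j) (by omega))).1
      rw [add_sub_cancel] at this
      push_cast at this
      linarith
  have hinj : ∀ i j : ℤ, i < j → (i * α - S i : ℝ) ≠ j * α - S j := by
    intro i j hij he
    refine h.irrational hα (p := S j - S i) (q := j - i) (by omega) ?_
    push_cast
    linarith
  have hne : ∀ c : ℝ, ∃ N : ℤ, ∀ i : ℤ, N ≤ i → (i * α - S i : ℝ) ≠ c := by
    intro c
    by_cases hc : ∃ i : ℤ, (i * α - S i : ℝ) = c
    · obtain ⟨i, rfl⟩ := hc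
      exact ⟨i + 1, fun j hj => (hinj i j (by omega)).symm⟩
    · push Not at hc
      exact ⟨0, fun i _ => hc i⟩
  obtain ⟨A, hA⟩ : ∃ A, A = sInf (Set.range fun i : ℤ => (i * α - S i : ℝ)) := ⟨_, rfl⟩
  have hA1 : ∀ i : ℤ, A ≤ i * α - S i := fun i => by
    rw [hA]
    exact csInf_le ⟨0 * α - S 0 - 1, by
      rintro _ ⟨j, rfl⟩
      have := hdist 0 j
      push_cast at this
      linarith⟩ ⟨i, rfl⟩
  have hA2 : ∀ i : ℤ, i * α - S i ≤ A + 1 := fun i => by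
    rw [← sub_le_iff_le_add, hA]
    refine le_csInf (Set.range_nonempty _) ?_
    rintro _ ⟨j, rfl⟩
    have := hdist i j
    linarith
  obtain ⟨N₁, hN₁⟩ := hne A
  obtain ⟨N₂, hN₂⟩ := hne (A + 1)
  have hmem : ∀ i : ℤ, max N₁ N₂ ≤ i → A < i * α - S i ∧ i * α - S i < A + 1 := fun i hi =>
    ⟨lt_of_le_of_ne (hA1 i) (hN₁ i (by omega)).symm, lt_of_le_of_ne (hA2 i) (hN₂ i (by omega))⟩
  have hθ : (L * α - m : ℝ) ≠ 0 := h.irrational hα (by omega)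
  refine ⟨α, A + max 0 (-(L * α - m)), A + 1 - max 0 (L * α - m), A, max N₁ N₂, ?_⟩
  refine ⟨fun l s hl => h.irrational hα hl, hmem, ?_, ?_, ?_, fun i hi => ?_, h.rec_right,
    ⟨i₀, hi₀⟩, by omega⟩
  · linarith [le_max_left 0 (-(L * α - m))]
  · linarith [le_max_left 0 (L * α - m)]
  · rcases lt_or_gt_of_ne hθ with hθ | hθ
    · linarith [le_max_right 0 (-(L * α - m)), le_max_left 0 (L * α - m)]
    · linarith [le_max_left 0 (-(L * α - m)), le_max_right 0 (L * α - m)]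
  · have m1 := hmem i hi
    have m2 := hmem (i + L) (by omega)
    push_cast at m2
    constructor
    · intro hm
      have e' : ((S (i + L) : ℤ) : ℝ) = S i + m := by
        exact_mod_cast (by omega : S (i + L) = S i + m)
      rw [e'] at m2
      rcases lt_or_gt_of_ne hθ with hθ | hθ
      · rw [max_eq_right (by linarith), max_eq_left (by linarith)]
        constructor <;> linarith
      · rw [max_eq_left (by linarith), max_eq_right (by linarith)]
        constructor <;> linarith
    · rintro ⟨h1, h2⟩
      have h3 := le_max_right 0 (-(L * α - m))
      have h4 := le_max_right 0 (L * α - m)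
      have := Coding.int_eq (A := A) (x := i * α - S i + (L * α - m))
        (y := (i + L) * α - S (i + L)) (s := m - (S (i + L) - S i)) ⟨by linarith, by linarith⟩ m2
        (by push_cast; ring)
      omega

theorem SturmianW.abReturns {w : ℕ → Bool} {S : ℤ → ℤ} (hw : SturmianW w)
    (h : BiInfinite (prefixSum w) S) {u : List Bool} (hu : IsFactorW w u) (hne : u ≠ []) :
    ExactlyKAbReturns w u 2 ∨ ExactlyKAbReturns w u 3 := by
  obtain ⟨x, hx⟩ := hu
  obtain ⟨i, -, hi⟩ := h.right x u.length 0
  have hi := hi u.length le_rfl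
  rw [← count_wordAt, ← hx] at hi
  have := List.length_pos_iff.2 hne
  obtain ⟨α, a, b, A, N, hc⟩ := (hw.stu h).exists_coding (by omega) hi
  rw [exactlyKAbReturns_iff, exactlyKAbReturns_iff, h.encard_returns]
  exact_mod_cast hc.encard_retPair

/-- A recurrent infinite binary word is Sturmian iff every (nonempty) factor has exactly
two or three abelian returns. -/
theorem stmt0 (w : ℕ → Bool) (hrec : RecurrentW w) :
    SturmianW w ↔
      ∀ u, IsFactorW w u → u ≠ [] →
        (ExactlyKAbReturns w u 2 ∨ ExactlyKAbReturns w u 3) := by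
  obtain ⟨S, hS⟩ := exists_biInfinite (prefixSum_zero w)
    (fun i => by rw [prefixSum_succ]; cases w i <;> simp) hrec.prefixSum
  exact ⟨fun hw u hu hne => hw.abReturns hS hu hne, fun H => hS.sturmianW hrec (hS.good H)⟩
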